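/- Let R be a Gorenstein local ring of dimension d, let I be a strongly Cohen-Macaulay R-ideal of height two with analytic spread ℓ(I) = ℓ satisfying G_{ℓ+1}, let F be a free R-module of rank e − 1 > 0, and set E = I ⊕ F. Then ℓ(E) = ℓ + e − 1, E satisfies G_{ℓ(E)−e+2}, I is of linear type, E^j ≅ ⊕_{0≤i≤j} (I^i ⊗_R F^{j−i}) for all j, and Ext_R^{j+1}(E^j, R) = 0 for 1 ≤ j ≤ ℓ(E) − e + 1. -/

import Mathlib

set_option maxHeartbeats 8000000
set_option synthInstance.maxHeartbeats 4000000

open scoped TensorProduct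

noncomputable section

universe u

section Defs
variable (R : Type u) [CommRing R]

/-- The total ring of fractions of `R`. -/
abbrev TotalQuot := Localization (nonZeroDivisors R)

/-- `E` has rank `e`: `E ⊗_R Quot(R)` is free of rank `e` over the total quotient ring. -/
def HasRank (E : Type u) [AddCommGroup E] [Module R E] (e : ℕ) : Prop :=
  Nonempty ((TotalQuot R ⊗[R] E) ≃ₗ[TotalQuot R] (Fin e → TotalQuot R))

/-- Complement of a prime ideal, with the primality hypothesis explicit. -/
def primeCompl' (p : Ideal R) (hp : p.IsPrime) : Submonoid R :=
  @Ideal.primeCompl R _ p hp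

/-- Minimal number of generators of a module. -/
def minGens (E : Type u) [AddCommGroup E] [Module R E] : ℕ :=
  sInf {n | ∃ f : Fin n → E, Submodule.span R (Set.range f) = ⊤}

/-- The grade of an ideal `I` on a module `M`: supremum of lengths of
`M`-regular sequences contained in `I`. -/
def sequenceGrade (I : Ideal R) (M : Type u) [AddCommGroup M] [Module R M] : ℕ∞ :=
  sSup {n : ℕ∞ | ∃ rs : List R, (rs.length : ℕ∞) = n ∧ (∀ r ∈ rs, r ∈ I) ∧
    RingTheory.Sequence.IsRegular M rs}

/-- Depth of a module over a local ring. -/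
def moduleDepth [IsLocalRing R] (M : Type u) [AddCommGroup M] [Module R M] : ℕ∞ :=
  sequenceGrade R (IsLocalRing.maximalIdeal R) M

/-- The grade of a module: grade of its annihilator on `R`. -/
def moduleGrade (M : Type u) [AddCommGroup M] [Module R M] : ℕ∞ :=
  sequenceGrade R (Module.annihilator R M) R

/-- Dimension of a module: Krull dimension of `R` modulo the annihilator. -/
def moduleDim (M : Type u) [AddCommGroup M] [Module R M] : WithBot ℕ∞ :=
  ringKrullDim (R ⧸ Module.annihilator R M)

/-- Krull dimension of the localization `R_p`. -/
def localDimAt (p : Ideal R) (hp : p.IsPrime) : WithBot ℕ∞ :=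
  ringKrullDim (Localization (primeCompl' R p hp))

/-- Height of an ideal: infimum of `dim R_p` over primes `p ⊇ I`. -/
def idealHeight (I : Ideal R) : WithBot ℕ∞ :=
  sInf {d | ∃ (p : Ideal R) (hp : p.IsPrime), I ≤ p ∧ d = localDimAt R p hp}

/-- A local ring is Cohen-Macaulay if its depth equals its dimension. -/
def IsCMLocalRing [IsLocalRing R] : Prop :=
  (moduleDepth R R : WithBot ℕ∞) = ringKrullDim R

/-- A ring is Cohen-Macaulay if all its localizations at maximal ideals are. -/
def IsCMRing : Prop :=
  ∀ (p : Ideal R), ∀ hp : p.IsMaximal,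
    letI : p.IsPrime := hp.isPrime
    (moduleDepth (Localization.AtPrime p) (Localization.AtPrime p) : WithBot ℕ∞)
      = ringKrullDim (Localization.AtPrime p)

/-- A finite module over a local ring is Cohen-Macaulay if it is zero or
its depth equals its dimension. -/
def IsCMModule [IsLocalRing R] (M : Type u) [AddCommGroup M] [Module R M] : Prop :=
  Subsingleton M ∨ (moduleDepth R M : WithBot ℕ∞) = moduleDim R M

open CategoryTheory in
/-- Vanishing of `Ext_R^n(M, N)`. -/
def extVanish (M N : Type u) [AddCommGroup M] [Module R M] [AddCommGroup N] [Module R N]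
    (n : ℕ) : Prop :=
  Subsingleton (((Ext R (ModuleCat.{u} R) n).obj (Opposite.op (ModuleCat.of R M))).obj
    (ModuleCat.of R N))

/-- A Noetherian local ring is Gorenstein iff it is Cohen-Macaulay and `R` has finite
injective dimension, i.e. `Ext^i(k, R) = 0` for all large `i`. -/
def IsGorensteinLocalRing [IsLocalRing R] : Prop :=
  IsCMLocalRing R ∧ ∃ n : ℕ, ∀ i : ℕ, n < i → extVanish R (IsLocalRing.ResidueField R) R i

variable (E : Type u) [AddCommGroup E] [Module R E]

/-- Defining relations of the symmetric algebra, presented as the free commutative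
`R`-algebra on `E` modulo linearity relations. -/
def symRels : Set (MvPolynomial E R) :=
  {p | ∃ x y : E, p = MvPolynomial.X (x + y) - MvPolynomial.X x - MvPolynomial.X y} ∪
  {p | ∃ (r : R) (x : E), p = MvPolynomial.X (r • x) - MvPolynomial.C r * MvPolynomial.X x}

/-- The symmetric algebra of a module. -/
abbrev SymModAlg := MvPolynomial E R ⧸ Ideal.span (symRels R E)

/-- The `R`-torsion ideal of an `R`-algebra `A`. -/
def torsionIdeal (A : Type u) [CommRing A] [Algebra R A] : Ideal A where
  carrier := {a | ∃ r ∈ nonZeroDivisors R, r • a = 0}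
  zero_mem' := ⟨1, one_mem _, smul_zero _⟩
  add_mem' := by
    rintro a b ⟨r, hr, ha⟩ ⟨s, hs, hb⟩
    refine ⟨r * s, mul_mem hr hs, ?_⟩
    have h1 : (r * s) • a = 0 := by rw [mul_comm, mul_smul, ha, smul_zero]
    have h2 : (r * s) • b = 0 := by rw [mul_smul, hb, smul_zero]
    rw [smul_add, h1, h2, add_zero]
  smul_mem' := by
    rintro c a ⟨r, hr, ha⟩
    exact ⟨r, hr, by rw [smul_comm, ha, smul_zero]⟩

/-- The Rees algebra of a module: the symmetric algebra modulo `R`-torsion. -/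
abbrev ReesModAlg := SymModAlg R E ⧸ torsionIdeal R (SymModAlg R E)

/-- The canonical map `E → R(E)`. -/
def reesι (x : E) : ReesModAlg R E :=
  Ideal.Quotient.mk _ (Ideal.Quotient.mk _ (MvPolynomial.X x))

/-- The `j`-th power `E^j` of a module: the `j`-th graded component of its Rees
algebra, i.e. the `R`-span of products of `j` elements of `E`. -/
def reesPower (j : ℕ) : Submodule R (ReesModAlg R E) :=
  Submodule.span R {a | ∃ f : Fin j → E, a = ∏ i, reesι R E (f i)}

/-- A module is of linear type if its symmetric algebra is `R`-torsion-free,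
i.e. the natural surjection `S(E) → R(E)` is an isomorphism. -/
def IsLinearType : Prop := torsionIdeal R (SymModAlg R E) = ⊥

/-- The extension of the maximal ideal to the Rees algebra. -/
def fiberIdeal [IsLocalRing R] : Ideal (ReesModAlg R E) :=
  Ideal.map (algebraMap R (ReesModAlg R E)) (IsLocalRing.maximalIdeal R)

/-- The analytic spread: Krull dimension of the special fiber ring `R(E) ⊗ k`. -/
def analyticSpread [IsLocalRing R] : WithBot ℕ∞ :=
  ringKrullDim (ReesModAlg R E ⧸ fiberIdeal R E)

/-- The submodule `U·E^r` of the Rees algebra. -/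
def mulPower (U : Submodule R E) (r : ℕ) : Submodule R (ReesModAlg R E) :=
  Submodule.span R {a | ∃ u ∈ U, ∃ f : Fin r → E, a = reesι R E u * ∏ i, reesι R E (f i)}

/-- `U` is a reduction of `E` if `E^{r+1} = U·E^r` for some `r`. -/
def IsReduction (U : Submodule R E) : Prop :=
  ∃ r : ℕ, reesPower R E (r + 1) = mulPower R E U r

/-- A minimal reduction. -/
def IsMinimalReduction (U : Submodule R E) : Prop :=
  IsReduction R E U ∧ ∀ U' : Submodule R E, U' ≤ U → IsReduction R E U' → U' = U

/-- The reduction number of a reduction `U`. -/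
def reductionNumberOf (U : Submodule R E) : ℕ :=
  sInf {r | reesPower R E (r + 1) = mulPower R E U r}

/-- The reduction number of `E`. -/
def reductionNumber : ℕ :=
  sInf {r | ∃ U : Submodule R E, IsMinimalReduction R E U ∧ reductionNumberOf R E U = r}

/-- The condition `G_s` for a module of rank `e`:
`μ(E_p) ≤ dim R_p + e - 1` for all primes with `1 ≤ dim R_p ≤ s - 1`. -/
def Gcond (e s : ℕ) : Prop :=
  ∀ (p : Ideal R) (hp : p.IsPrime),
    (1 : WithBot ℕ∞) ≤ localDimAt R p hp → localDimAt R p hp + 1 ≤ (s : WithBot ℕ∞) →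
    (minGens (Localization (primeCompl' R p hp)) (LocalizedModule (primeCompl' R p hp) E)
        : WithBot ℕ∞) ≤ localDimAt R p hp + ((e - 1 : ℕ) : WithBot ℕ∞)

/-- The condition `G_∞` for a module of rank `e`. -/
def GcondInf (e : ℕ) : Prop := ∀ s : ℕ, Gcond R E e s

/-- The condition `G_s` for an ideal: `μ(I_p) ≤ dim R_p` for all primes `p ⊇ I`
with `dim R_p ≤ s - 1`. -/
def GcondIdeal (I : Ideal R) (s : ℕ) : Prop :=
  ∀ (p : Ideal R) (hp : p.IsPrime), I ≤ p → localDimAt R p hp + 1 ≤ (s : WithBot ℕ∞) →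
    (minGens (Localization (primeCompl' R p hp)) (LocalizedModule (primeCompl' R p hp) ↥I)
        : WithBot ℕ∞) ≤ localDimAt R p hp

/-- The `0`-th Fitting ideal of a module. -/
def fitting0 (M : Type u) [AddCommGroup M] [Module R M] : Ideal R :=
  ⨆ (n : ℕ) (π : (Fin n → R) →ₗ[R] M) (_ : Function.Surjective π),
    Ideal.span {d | ∃ A : Matrix (Fin n) (Fin n) R,
      (∀ jc : Fin n, π (fun i => A i jc) = 0) ∧ d = A.det}

end Defs
section Koszul
variable (R : Type u) [CommRing R]

/-- The Koszul differential on the exterior algebra of `R^n`, given by contraction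
against the functional `v ↦ ∑ x i * v i`. -/
def koszulDiff (n : ℕ) (x : Fin n → R) :
    ExteriorAlgebra R (Fin n → R) →ₗ[R] ExteriorAlgebra R (Fin n → R) :=
  CliffordAlgebra.contractLeft (∑ i, x i • LinearMap.proj i)

/-- Cycles of the Koszul complex in homological degree `i`. -/
def koszulCycles (n : ℕ) (x : Fin n → R) (i : ℕ) :
    Submodule R (ExteriorAlgebra R (Fin n → R)) :=
  (⋀[R]^i (Fin n → R)) ⊓ LinearMap.ker (koszulDiff R n x)

/-- The `i`-th Koszul homology of the sequence `x`. -/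
abbrev koszulHomology (n : ℕ) (x : Fin n → R) (i : ℕ) :=
  ↥(koszulCycles R n x i) ⧸
    Submodule.comap (koszulCycles R n x i).subtype
      (Submodule.map (koszulDiff R n x) (⋀[R]^(i + 1) (Fin n → R)))

/-- An ideal is strongly Cohen-Macaulay if all Koszul homology modules of a generating
set are Cohen-Macaulay. -/
def IsStronglyCM [IsLocalRing R] (I : Ideal R) : Prop :=
  ∃ (n : ℕ) (x : Fin n → R), Ideal.span (Set.range x) = I ∧
    ∀ i : ℕ, IsCMModule R (koszulHomology R n x i)

end Koszul

set_option maxHeartbeats 800000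
set_option linter.unusedSectionVars false
set_option linter.unusedVariables false
set_option linter.unusedSimpArgs false
set_option linter.style.haveILetI false

namespace S9
open CategoryTheory

section Ext1
variable {R : Type u} [CommRing R]

/-- `Ext^k(M,R)` -/
abbrev E (M : Type u) [AddCommGroup M] [Module R M] (k : ℕ) : Type u :=
  Abelian.Ext.{u} (ModuleCat.of R M) (ModuleCat.of R R) k

theorem extVanish_iff (M : Type u) [AddCommGroup M] [Module R M] (k : ℕ) :
    extVanish R M R (k+1) ↔ Subsingleton (E (R := R) M (k+1)) := by
  unfold extVanish
  let P := projectiveResolution (ModuleCat.of R M)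
  have e1 := (P.isoExt (R := R) (k+1) (ModuleCat.of R R)).toLinearEquiv.toEquiv
  rw [e1.subsingleton_congr]
  rw [← ModuleCat.isZero_iff_subsingleton]
  rw [← HomologicalComplex.exactAt_iff_isZero_homology,
    HomologicalComplex.exactAt_iff' _ k (k+1) (k+2) (by simp) (by simp),
    ShortComplex.moduleCat_exact_iff]
  constructor
  · intro h
    refine ⟨fun a b => ?_⟩
    suffices H : ∀ a : E (R := R) M (k+1), a = 0 by rw [H a, H b]
    intro a
    obtain ⟨f, hf, rfl⟩ := P.extMk_surjective a (k+2) rfl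
    rw [P.extMk_eq_zero_iff f (k+2) rfl hf k rfl]
    obtain ⟨g, hg⟩ := h f hf
    exact ⟨g, hg⟩
  · intro h x hx
    have := h.elim (P.extMk x (k+2) rfl hx) 0
    rw [P.extMk_eq_zero_iff x (k+2) rfl hx k rfl] at this
    obtain ⟨g, hg⟩ := this
    exact ⟨g, hg⟩

/-- the image of `Ext^k(M,R)` at the prime `p` is zero -/
def V (p : Ideal R) (M : Type u) [AddCommGroup M] [Module R M] (k : ℕ) : Prop :=
  ∃ s ∉ p, ∀ x : E (R := R) M k, s • x = 0

variable {A B C : Type u} [AddCommGroup A] [AddCommGroup B] [AddCommGroup C]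
  [Module R A] [Module R B] [Module R C]

theorem shortExact (f : A →ₗ[R] B) (g : B →ₗ[R] C) (hf : Function.Injective f)
    (hfg : Function.Exact f g) (hg : Function.Surjective g) :
    (ShortComplex.mk (ModuleCat.ofHom f) (ModuleCat.ofHom g)
      (by ext x; exact hfg.apply_apply_eq_zero x)).ShortExact :=
  ModuleCat.shortComplex_shortExact _ hfg hf hg

variable (p : Ideal R) [hp : p.IsPrime]

theorem smul_mk0_comp (r : R) {k : ℕ} (f : A →ₗ[R] B) (x : E (R := R) B k) :
    (Abelian.Ext.mk₀ (ModuleCat.ofHom f)).comp (r • x) (zero_add k) =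
     r • (Abelian.Ext.mk₀ (ModuleCat.ofHom f)).comp x (zero_add k) := by simp

theorem V_mid (f : A →ₗ[R] B) (g : B →ₗ[R] C) (hf : Function.Injective f)
    (hfg : Function.Exact f g) (hg : Function.Surjective g) {k : ℕ}
    (hA : V p A k) (hC : V p C k) : V p B k := by
  obtain ⟨s, hs, hA⟩ := hA
  obtain ⟨t, ht, hC⟩ := hC
  refine ⟨t * s, fun h => (hp.mem_or_mem h).elim ht hs, fun x => ?_⟩
  have h1 := hA ((Abelian.Ext.mk₀ (ModuleCat.ofHom f)).comp x (zero_add k))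
  rw [← smul_mk0_comp] at h1
  obtain ⟨y, hy⟩ := Abelian.Ext.contravariant_sequence_exact₂ (shortExact f g hf hfg hg) _ (s • x) h1
  rw [mul_smul, ← hy]
  change t • (Abelian.Ext.mk₀ (ModuleCat.ofHom g)).comp y (zero_add k) = 0
  rw [← smul_mk0_comp, hC]; simp

theorem V_left (f : A →ₗ[R] B) (g : B →ₗ[R] C) (hf : Function.Injective f)
    (hfg : Function.Exact f g) (hg : Function.Surjective g) {k : ℕ}
    (hB : V p B k) (hC : V p C (k+1)) : V p A k := by
  obtain ⟨s, hs, hB⟩ := hB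
  obtain ⟨t, ht, hC⟩ := hC
  refine ⟨s * t, fun h => (hp.mem_or_mem h).elim hs ht, fun x => ?_⟩
  have hS := shortExact f g hf hfg hg
  have h1 := hC (hS.extClass.comp x (add_comm 1 k))
  rw [← Abelian.Ext.comp_smul] at h1
  obtain ⟨y, hy⟩ := Abelian.Ext.contravariant_sequence_exact₁ hS _ (t • x) _ h1
  rw [mul_smul, ← hy]
  change s • (Abelian.Ext.mk₀ (ModuleCat.ofHom f)).comp y (zero_add k) = 0
  rw [← smul_mk0_comp, hB]; simp

theorem V_right (f : A →ₗ[R] B) (g : B →ₗ[R] C) (hf : Function.Injective f)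
    (hfg : Function.Exact f g) (hg : Function.Surjective g) {k : ℕ}
    (hA : V p A k) (hB : V p B (k+1)) : V p C (k+1) := by
  obtain ⟨s, hs, hA⟩ := hA
  obtain ⟨t, ht, hB⟩ := hB
  refine ⟨s * t, fun h => (hp.mem_or_mem h).elim hs ht, fun x => ?_⟩
  have hS := shortExact f g hf hfg hg
  have h1 := hB ((Abelian.Ext.mk₀ (ModuleCat.ofHom g)).comp x (zero_add (k+1)))
  rw [← smul_mk0_comp] at h1
  obtain ⟨y, hy⟩ := Abelian.Ext.contravariant_sequence_exact₃ hS _ (t • x) h1 (add_comm 1 k)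
  rw [mul_smul, ← hy, ← Abelian.Ext.comp_smul, hA]; simp

theorem V_right0 (g : B →ₗ[R] C) (hg : Function.Surjective g)
    (hB : V p B 0) : V p C 0 := by
  obtain ⟨t, ht, hB⟩ := hB
  refine ⟨t, ht, fun x => ?_⟩
  have h1 := hB ((Abelian.Ext.mk₀ (ModuleCat.ofHom g)).comp x (zero_add 0))
  rw [← smul_mk0_comp] at h1
  have : Epi (ModuleCat.ofHom g) := (ModuleCat.epi_iff_surjective _).2 hg
  apply Abelian.Ext.precomp_mk₀_injective_of_epi _ (ModuleCat.ofHom g)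
  simpa using h1

theorem V_free [Module.Free R A] (k : ℕ) : V p A (k+1) := by
  have : Module.Projective R A := inferInstance
  have : Projective (ModuleCat.of R A) := ModuleCat.projective_of_free (Module.Free.chooseBasis R A)
  exact ⟨1, hp.one_notMem, fun x => by rw [Abelian.Ext.eq_zero_of_projective x, smul_zero]⟩

/-- retract up to `s` -/
theorem V_retract (f : A →ₗ[R] B) (g : B →ₗ[R] A) (s : R) (hs : s ∉ p)
    (h : ∀ x, g (f x) = s • x) {k : ℕ} (hB : V p B k) : V p A k := by
  obtain ⟨t, ht, hB⟩ := hB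
  refine ⟨t * s, fun h => (hp.mem_or_mem h).elim ht hs, fun x => ?_⟩
  have e : s • x = (Abelian.Ext.mk₀ (ModuleCat.ofHom f)).comp
      ((Abelian.Ext.mk₀ (ModuleCat.ofHom g)).comp x (zero_add k)) (zero_add k) := by
    rw [Abelian.Ext.mk₀_comp_mk₀_assoc]
    have : ModuleCat.ofHom f ≫ ModuleCat.ofHom g = s • 𝟙 (ModuleCat.of R A) := by
      ext x; exact h x
    rw [this, Abelian.Ext.mk₀_smul]; simp
  rw [mul_smul, e, ← smul_mk0_comp, hB]; simp

theorem V_kill (s : R) (hs : s ∉ p) (h : ∀ x : A, s • x = 0) (k : ℕ) : V p A k := by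
  refine ⟨s, hs, fun x => ?_⟩
  have : s • 𝟙 (ModuleCat.of R A) = 0 := by ext x; exact h x
  have h2 : s • x = (Abelian.Ext.mk₀ (s • 𝟙 (ModuleCat.of R A))).comp x (zero_add k) := by
    rw [Abelian.Ext.mk₀_smul]; simp
  rw [h2, this]; simp

theorem V_equiv (e : A ≃ₗ[R] B) {k : ℕ} (hB : V p B k) : V p A k :=
  V_retract p e.toLinearMap e.symm.toLinearMap 1 hp.one_notMem (by simp) hB

theorem V_mono {p q : Ideal R} (h : p ≤ q) {k : ℕ} (hB : V q A k) : V p A k := by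
  obtain ⟨s, hs, hB⟩ := hB
  exact ⟨s, fun h' => hs (h h'), hB⟩

theorem V_subsingleton [Subsingleton A] (k : ℕ) : V p A k :=
  V_kill p 1 hp.one_notMem (fun x => Subsingleton.elim _ _) k

theorem V_prod {k : ℕ} (hA : V p A k) (hB : V p B k) : V p (A × B) k :=
  V_mid p (LinearMap.inl R A B) (LinearMap.snd R A B) LinearMap.inl_injective
    (Function.Exact.inl_snd) LinearMap.snd_surjective hA hB

theorem V_pi {n : ℕ} {M : Fin n → Type u} [∀ i, AddCommGroup (M i)] [∀ i, Module R (M i)] {k : ℕ}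
    (h : ∀ i, V p (M i) k) : V p (∀ i, M i) k := by
  induction n with
  | zero => exact V_subsingleton p k
  | succ n ih =>
    exact V_equiv p (Fin.consLinearEquiv R M).symm (V_prod p (h 0) (ih fun i => h i.succ))

theorem V_local [IsLocalRing R] {k : ℕ} :
    V (IsLocalRing.maximalIdeal R) A k ↔ Subsingleton (E (R := R) A k) := by
  constructor
  · rintro ⟨s, hs, h⟩
    simp only [IsLocalRing.mem_maximalIdeal, mem_nonunits_iff, not_not] at hs
    exact ⟨fun a b => by rw [← hs.smul_left_cancel, h, h]⟩
  · intro h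
    exact ⟨1, Ideal.IsPrime.one_notMem inferInstance, fun x => Subsingleton.elim _ _⟩

theorem nak_aux {M : Type u} [AddCommGroup M] [Module R M] [Module.Finite R M] (x t : R) (hx : x ∈ p)
    (ht : t ∉ p) (h : ∀ y : M, ∃ z : M, t • y = x • z) : ∃ s ∉ p, ∀ y : M, s • y = 0 := by
  obtain ⟨P, hm, -, hc, h0⟩ :=
    LinearMap.exists_monic_and_natDegree_eq_and_coeff_mem_pow_and_aeval_eq_zero R
      (LinearMap.lsmul R M t) (Ideal.span {x}) (by
        rintro _ ⟨y, rfl⟩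
        obtain ⟨z, hz⟩ := h y
        simp only [LinearMap.lsmul_apply]
        rw [hz]
        exact Submodule.smul_mem_smul (Ideal.mem_span_singleton_self x) trivial)
  refine ⟨P.eval t, fun hmem => ?_, fun y => ?_⟩
  · rw [Polynomial.eval_eq_sum_range, Finset.sum_range_succ] at hmem
    have h1 : ∑ i ∈ Finset.range P.natDegree, P.coeff i * t ^ i ∈ p := by
      refine Ideal.sum_mem _ fun i hi => Ideal.mul_mem_right _ _ ?_
      have := hc i
      have hlt : P.natDegree - i ≠ 0 := by simp at hi; omega
      exact ((Ideal.span_singleton_le_iff_mem _).2 hx) (Ideal.pow_le_self hlt this)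
    have h2 := (Submodule.add_mem_iff_right _ h1).1 hmem
    rw [hm.coeff_natDegree, one_mul] at h2
    exact ht (hp.mem_of_pow_mem _ h2)
  · have h1 : LinearMap.lsmul R M t = algebraMap R (Module.End R M) t := by ext; rfl
    rw [h1, Polynomial.aeval_algebraMap_apply] at h0
    have := congrArg (fun f => f y) h0
    simpa using this

theorem lsmul_comp (x : R) {k : ℕ} (z : E (R := R) A k) :
    (Abelian.Ext.mk₀ (ModuleCat.ofHom (LinearMap.lsmul R A x))).comp z (zero_add k) = x • z := by
  have : ModuleCat.ofHom (LinearMap.lsmul R A x) = x • 𝟙 (ModuleCat.of R A) := by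
    ext x; rfl
  rw [this, Abelian.Ext.mk₀_smul]; simp

/-- Nakayama: `x ∈ p` regular on `M` and `V_{k+1}(M/xM)` imply `V_k(M)`. -/
theorem V_nak' [IsNoetherianRing R] [Module.Finite R A] (x : R) (hx : x ∈ p)
    (hreg : IsSMulRegular A x) (g : A →ₗ[R] C) (hg : Function.Surjective g)
    (hex : ∀ a, g a = 0 ↔ ∃ b, x • b = a) {k : ℕ} (h : V p C (k+1)) : V p A k := by
  obtain ⟨t, ht, h⟩ := h
  have hS := shortExact (LinearMap.lsmul R A x) g hreg (fun a => hex a) hg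
  refine nak_aux p x t hx ht fun y => ?_
  have h1 : hS.extClass.comp (t • y) (add_comm 1 k) = 0 := by
    rw [Abelian.Ext.comp_smul]; exact h _
  obtain ⟨z, hz⟩ := Abelian.Ext.contravariant_sequence_exact₁ hS _ (t • y) _ h1
  refine ⟨z, ?_⟩
  rw [← hz]
  exact lsmul_comp x z

theorem V_nak [IsNoetherianRing R] [Module.Finite R A] (x : R) (hx : x ∈ p)
    (hreg : IsSMulRegular A x) {k : ℕ} (h : V p (QuotSMulTop x A) (k+1)) : V p A k := by
  refine V_nak' p x hx hreg (Submodule.mkQ _) (Submodule.mkQ_surjective _) (fun a => ?_) h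
  simp [Submodule.mem_smul_pointwise_iff_exists]

/-- hom characterisations of `V 0` -/
theorem V_zero_iff : V p A 0 ↔ ∃ s ∉ p, ∀ (f : A →ₗ[R] R) (a : A), s * f a = 0 := by
  unfold V
  refine exists_congr fun s => and_congr_right fun _ => ?_
  let e : E (R := R) A 0 ≃ₗ[R] (A →ₗ[R] R) :=
    (Abelian.Ext.linearEquiv₀ (R := R)).trans ModuleCat.homLinearEquiv
  constructor
  · intro h f a
    have := congrArg (fun f => f a) (congrArg e (h (e.symm f)))
    simpa using this
  · intro h x
    apply e.injective
    ext a
    simpa using h (e x) a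

/-- A dimension shift: vanishing of `Ext^1` for `B` with `Ext^1` zero in terms of extension of maps. -/
theorem V_one_iff (f : A →ₗ[R] B) (g : B →ₗ[R] C) (hf : Function.Injective f)
    (hfg : Function.Exact f g) (hg : Function.Surjective g) [Module.Free R B] :
    V p C 1 ↔ ∃ s ∉ p, ∀ (φ : A →ₗ[R] R), ∃ ψ : B →ₗ[R] R, s • φ = ψ ∘ₗ f := by
  have : Projective (ModuleCat.of R B) := ModuleCat.projective_of_free (Module.Free.chooseBasis R B)
  have hS := shortExact f g hf hfg hg
  let e : ∀ (A : Type u) [AddCommGroup A] [Module R A], E (R := R) A 0 ≃ₗ[R] (A →ₗ[R] R) :=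
    fun A _ _ => (Abelian.Ext.linearEquiv₀ (R := R)).trans ModuleCat.homLinearEquiv
  have he : ∀ y : E (R := R) B 0, e A ((Abelian.Ext.mk₀ (ModuleCat.ofHom f)).comp y (zero_add 0)) =
      (e B y) ∘ₗ f := by
    intro y
    have hz := Abelian.Ext.mk₀_linearEquiv₀_apply (R := R) y
    generalize hz' : Abelian.Ext.linearEquiv₀ (R := R) y = z at hz
    subst hz
    have : Abelian.Ext.linearEquiv₀ (R := R) (Abelian.Ext.mk₀ (ModuleCat.ofHom f ≫ z)) =
      ModuleCat.ofHom f ≫ z := Abelian.Ext.addEquiv₀.right_inv _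
    simp only [Abelian.Ext.mk₀_comp_mk₀, e, LinearEquiv.trans_apply, this, hz']
    ext; rfl
  unfold V
  refine exists_congr fun s => and_congr_right fun _ => ?_
  constructor
  · intro h φ
    have h1 := h (hS.extClass.comp ((e A).symm φ) (add_comm 1 0))
    rw [← Abelian.Ext.comp_smul] at h1
    obtain ⟨y, hy⟩ := Abelian.Ext.contravariant_sequence_exact₁ hS _ _ _ h1
    refine ⟨e B y, ?_⟩
    rw [← he]
    have := congrArg (e A) hy
    rw [map_smul, LinearEquiv.apply_symm_apply] at this
    exact this.symm
  · intro h x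
    obtain ⟨y, hy⟩ := Abelian.Ext.contravariant_sequence_exact₃ hS _ x
      (Abelian.Ext.eq_zero_of_projective _) (add_comm 1 0)
    obtain ⟨ψ, hψ⟩ := h (e A y)
    rw [← hy, ← Abelian.Ext.comp_smul]
    have h3 : s • y = (Abelian.Ext.mk₀ (ModuleCat.ofHom f)).comp ((e B).symm ψ) (zero_add 0) := by
      apply (e A).injective
      rw [he, map_smul, hψ, LinearEquiv.apply_symm_apply]
    change hS.extClass.comp (s • y) _ = 0
    rw [h3]
    exact ShortComplex.ShortExact.extClass_comp_assoc _ _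

end Ext1
end S9

namespace S9
open CategoryTheory

section Gor
variable {R : Type u} [CommRing R] [IsNoetherianRing R]

/-- the height as natural number -/
def ht (p : Ideal R) : ℕ := p.height.toNat

theorem coe_ht (p : Ideal R) [hp : p.IsPrime] : (ht p : ℕ∞) = p.height :=
  ENat.natCast_toNat (Ideal.height_ne_top_of_isPrime)

theorem ht_lt {p q : Ideal R} [hp : p.IsPrime] [hq : q.IsPrime] (h : p < q) : ht p < ht q := by
  have := Ideal.height_add_one_le_of_lt_of_isPrime h
  rw [← coe_ht, ← coe_ht] at this
  exact_mod_cast this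

theorem ht_le {p q : Ideal R} [hp : p.IsPrime] [hq : q.IsPrime] (h : p ≤ q) : ht p ≤ ht q := by
  rcases h.lt_or_eq with h | h
  · exact (ht_lt h).le
  · rw [h]

theorem exists_ht_pred {p : Ideal R} [hp : p.IsPrime] {n : ℕ} (h : ht p = n + 1) :
    ∃ q : Ideal R, q.IsPrime ∧ q < p ∧ ht q = n := by
  have h1 : Order.height (⟨p, hp⟩ : PrimeSpectrum R) = n + 1 := by
    rw [← PrimeSpectrum.height_eq_orderHeight, ← coe_ht, h]; norm_cast
  obtain ⟨-, ⟨y, hy, hyn⟩, -⟩ := Order.height_eq_coe_add_one_iff.1 h1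
  refine ⟨y.asIdeal, y.2, hy, ?_⟩
  rw [← PrimeSpectrum.height_eq_orderHeight] at hyn
  simp [ht, hyn]

theorem V_filt (p : Ideal R) [hp : p.IsPrime] (N : Type u) [AddCommGroup N] [Module R N] [hN : Module.Finite R N] (k : ℕ)
    (h : ∀ q : PrimeSpectrum R, q ∈ Module.support R N → q.asIdeal ≤ p → V p (R ⧸ q.asIdeal) k) :
    V p N k := by
  revert h
  induction hN using IsNoetherianRing.induction_on_isQuotientEquivQuotientPrime R with
  | subsingleton N => intro h; exact V_subsingleton p k
  | quotient N q e =>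
    intro h
    refine V_equiv p e ?_
    by_cases hq : q.asIdeal ≤ p
    · refine h q ?_ hq
      rw [e.support_eq, Module.support_eq_zeroLocus, Ideal.annihilator_quotient]
      exact (PrimeSpectrum.mem_zeroLocus _ _).2 subset_rfl
    · obtain ⟨s, hs, hsp⟩ := Set.not_subset.1 hq
      refine V_kill p s hsp (fun x => ?_) k
      obtain ⟨x, rfl⟩ := Ideal.Quotient.mk_surjective x
      rw [← Ideal.Quotient.mk_eq_mk, ← Submodule.Quotient.mk_smul, Submodule.Quotient.mk_eq_zero]
      exact Ideal.mul_mem_right _ _ hs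
  | exact N₁ N₂ N₃ f g hf hg hfg h₁ h₃ =>
    intro h
    have := Module.support_of_exact hfg hf hg
    exact V_mid p f g hf hfg hg (h₁ fun q hq => h q (this ▸ Or.inl hq))
      (h₃ fun q hq => h q (this ▸ Or.inr hq))

/-- Cutting `R/p` by an element. -/
theorem V_cut (p q : Ideal R) [hp : p.IsPrime] [hq : q.IsPrime] (x : R) (hxq : x ∈ q) (hxp : x ∉ p) (k : ℕ)
    (h : ∀ q' : Ideal R, ∀ _ : q'.IsPrime, p < q' → q' ≤ q → V q (R ⧸ q') (k+1)) : V q (R ⧸ p) k := by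
  have hreg : IsSMulRegular (R ⧸ p) x := by
    rw [isSMulRegular_iff_right_eq_zero_of_smul]
    intro y hy
    obtain ⟨y, rfl⟩ := Ideal.Quotient.mk_surjective y
    rw [← Ideal.Quotient.mk_eq_mk, ← Submodule.Quotient.mk_smul, Submodule.Quotient.mk_eq_zero] at hy
    rw [Ideal.Quotient.eq_zero_iff_mem]
    exact (hp.mem_or_mem hy).resolve_left hxp
  refine V_nak q x hxq hreg (V_filt q _ _ fun q' hq' hle => h _ q'.2 ?_ hle)
  rw [Module.support_eq_zeroLocus] at hq'
  have h1 : Module.annihilator R (QuotSMulTop x (R ⧸ p)) ≤ q'.asIdeal := hq'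
  have h2 : p ≤ q'.asIdeal := by
    refine le_trans (fun a ha => ?_) h1
    rw [Module.mem_annihilator]
    intro y
    obtain ⟨y, rfl⟩ := Submodule.Quotient.mk_surjective _ y
    obtain ⟨y, rfl⟩ := Ideal.Quotient.mk_surjective y
    have : a • (Ideal.Quotient.mk p y) = 0 := by
      rw [← Ideal.Quotient.mk_eq_mk, ← Submodule.Quotient.mk_smul, Submodule.Quotient.mk_eq_zero]
      exact Ideal.mul_mem_right _ _ ha
    rw [← Submodule.Quotient.mk_smul, this, Submodule.Quotient.mk_zero]
  have h3 : x ∈ q'.asIdeal := by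
    refine h1 ?_
    rw [Module.mem_annihilator]
    intro y
    obtain ⟨y, rfl⟩ := Submodule.Quotient.mk_surjective _ y
    rw [← Submodule.Quotient.mk_smul, Submodule.Quotient.mk_eq_zero]
    exact Submodule.smul_mem_pointwise_smul _ _ _ trivial
  exact lt_of_le_of_ne h2 fun e => hxp (e ▸ h3)

theorem not_V_of_emb (p : Ideal R) [hp : p.IsPrime] (h : p ∈ associatedPrimes R R) : ¬ V p (R ⧸ p) 0 := by
  rw [V_zero_iff]
  rintro ⟨s, hs, h1⟩
  obtain ⟨-, f, hf⟩ := (isAssociatedPrime_iff_exists_injective_linearMap _ _).1 (AssociatedPrimes.mem_iff.1 h)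
  have h2 := h1 f
  have h3 : f (s • Ideal.Quotient.mk p 1) = 0 := by
    rw [map_smul]; exact h2 _
  rw [← map_zero f] at h3
  have h4 := hf h3
  rw [← Ideal.Quotient.mk_eq_mk, ← Submodule.Quotient.mk_smul, Submodule.Quotient.mk_eq_zero] at h4
  simp at h4
  exact hs h4

theorem not_V_ht (n : ℕ) : ∀ (p : Ideal R) [hp : p.IsPrime], ht p = n → ¬ V p (R ⧸ p) n := by
  induction n with
  | zero =>
    intro p hp h
    apply not_V_of_emb
    have h0 : p.height = 0 := by rw [← coe_ht, h]; rfl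
    rw [Ideal.height_eq_zero_iff] at h0
    apply Module.associatedPrimes.minimalPrimes_annihilator_subset_associatedPrimes R R
    rwa [(Module.annihilator_eq_bot (R := R) (M := R)).2 inferInstance]
  | succ n ih =>
    intro p hp h hV
    obtain ⟨q, hq, hlt, hqn⟩ := exists_ht_pred h
    obtain ⟨x, hx, hxq⟩ := Set.exists_of_ssubset hlt
    refine ih q hqn (V_mono hlt.le (V_cut q p x hx hxq n fun q' hq' h1 h2 => ?_))
    rcases h2.lt_or_eq with h2 | h2
    · have := ht_lt h1; have := ht_lt h2; omega
    · rwa [h2]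

/-- local Gorenstein type condition -/
def Gd (p : Ideal R) : Prop := ∀ k, ht p < k → V p (R ⧸ p) k

theorem V_big_aux (p : Ideal R) [hp : p.IsPrime] (r : ℕ) (h : ∀ k, r < k → V p (R ⧸ p) k) (n : ℕ) : 
    ∀ (q : Ideal R) [hq : q.IsPrime], q ≤ p → ht q + n = ht p → ∀ k, r < k → V p (R ⧸ q) k := by
  induction n using Nat.strong_induction_on with
  | _ n ih =>
    intro q hq hqp hn k hk
    rcases hqp.lt_or_eq with hlt | heq
    · obtain ⟨x, hx, hxq⟩ := Set.exists_of_ssubset hlt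
      refine V_cut q p x hx hxq k fun q' hq' h1 h2 => ?_
      have := ht_lt h1
      have := ht_le h2
      exact ih (ht p - ht q') (by omega) q' h2 (by omega) (k+1) (by omega)
    · subst heq
      exact h k hk

theorem V_big_of (p : Ideal R) [hp : p.IsPrime] (r : ℕ) (h : ∀ k, r < k → V p (R ⧸ p) k)
    (N : Type u) [AddCommGroup N] [Module R N]
    [Module.Finite R N] {k : ℕ} (hk : r < k) : V p N k := by
  refine V_filt p N k fun q _ hq => ?_
  have := ht_le hq
  exact V_big_aux p r h (ht p - ht q.asIdeal) q.asIdeal hq (by omega) k hk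

/-- depth consequence -/
theorem ass_lemma (p : Ideal R) [hp : p.IsPrime] (hG : Gd p) {M : Type u} [AddCommGroup M] [Module R M]
    [Module.Finite R M] {t : ℕ} (ht' : t < ht p) (hM : ∀ k, t < k → V p M k) (N : Submodule R M)
    (hN : ∀ q : Ideal R, q.IsPrime → q < p → ∃ s ∉ q, ∀ x ∈ N, s • x = 0) : ∃ s ∉ p, ∀ x ∈ N, s • x = 0 := by
  by_contra hcon
  push Not at hcon
  have h1 : Module.annihilator R N ≤ p := by
    intro s hs
    by_contra hsp
    obtain ⟨x, hx, hx0⟩ := hcon s hsp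
    exact hx0 (by simpa using congrArg Subtype.val ((Module.mem_annihilator.1 hs) ⟨x, hx⟩))
  obtain ⟨q, hq, hqp⟩ := Ideal.exists_minimalPrimes_le h1
  have hqa := Module.associatedPrimes.minimalPrimes_annihilator_subset_associatedPrimes R N hq
  have hqprime : q.IsPrime := hq.1.1
  rcases hqp.lt_or_eq with hlt | rfl
  · obtain ⟨s, hs, hs'⟩ := hN q hqprime hlt
    exact hs (hq.1.2 (Module.mem_annihilator.2 fun x => Subtype.ext (hs' x x.2)))
  · obtain ⟨f, hf⟩ : ∃ f : (R ⧸ q) →ₗ[R] N, Function.Injective f := by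
      exact ((isAssociatedPrime_iff_exists_injective_linearMap _ _).1 (AssociatedPrimes.mem_iff.1 hqa)).2
    have hinj : Function.Injective (N.subtype ∘ₗ f) := by
      simpa using (Subtype.val_injective.comp hf)
    exact not_V_ht _ q rfl (V_left q (N.subtype ∘ₗ f) (LinearMap.range (N.subtype ∘ₗ f)).mkQ hinj
      (LinearMap.exact_map_mkQ_range _) (Submodule.mkQ_surjective _) (hM _ ht') (V_big_of q _ hG _ (by omega)))

theorem V_quot_reg (p : Ideal R) [hp : p.IsPrime] (rs : List R) : ∀ (M : Type u) [AddCommGroup M] [Module R M] (t : ℕ)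
    (h : ∀ k, t < k → V p M k) (hreg : RingTheory.Sequence.IsWeaklyRegular M rs),
    ∀ k, t + rs.length < k → V p (M ⧸ (Ideal.ofList rs • ⊤ : Submodule R M)) k := by
  induction rs with
  | nil =>
    intro M _ _ t h _ k hk
    refine V_equiv p (Submodule.quotEquivOfEqBot _ (by simp)) (h k (by simpa using hk))
  | cons r rs ih =>
    intro M _ _ t h hreg k hk
    rw [RingTheory.Sequence.isWeaklyRegular_cons_iff] at hreg
    refine V_equiv p (Submodule.quotOfListConsSMulTopEquivQuotSMulTopInner M r rs) ?_
    refine ih (QuotSMulTop r M) (t+1) (fun k hk => ?_) hreg.2 k (by simp at hk; omega)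
    obtain ⟨k, rfl⟩ : ∃ k', k = k' + 1 := ⟨k-1, by omega⟩
    refine V_right p (LinearMap.lsmul R M r) (Submodule.mkQ _) hreg.1 ?_ (Submodule.mkQ_surjective _)
      (h _ (by omega)) (h _ (by omega))
    intro x
    rw [← LinearMap.mem_ker, Submodule.ker_mkQ]
    simp [Submodule.mem_smul_pointwise_iff_exists]

end Gor

section GorLocal
variable {R : Type u} [CommRing R] [IsNoetherianRing R] [IsLocalRing R] 

/-- `Ext^i(k,R)=0` for `i ≠ d` -/
def GorL (R : Type u) [CommRing R] [IsLocalRing R] (d : ℕ) : Prop :=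
  ∀ i, i ≠ d → V (IsLocalRing.maximalIdeal R) (R ⧸ IsLocalRing.maximalIdeal R) i

theorem gor_chain {d : ℕ} (hG : GorL R d) (n : ℕ) : ∀ (p : Ideal R) [hp : p.IsPrime],
    ht p + n = ht (IsLocalRing.maximalIdeal R) →
    ∃ δ : ℕ, (δ : ℕ∞) ≤ Order.coheight (⟨p, hp⟩ : PrimeSpectrum R) ∧
     ∀ k, ¬ V p (R ⧸ p) k → k + δ = d := by
  induction n using Nat.strong_induction_on with
  | _ n ih =>
    intro p hp hn
    rcases (IsLocalRing.le_maximalIdeal hp.ne_top).lt_or_eq with hlt | heq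
    · -- choose a prime above p with minimal height
      have hex : ∃ m, ∃ q : Ideal R, ∃ _ : q.IsPrime, p < q ∧ ht q = m :=
        ⟨_, _, inferInstance, hlt, rfl⟩
      classical
      obtain ⟨q, hq, hpq, hqm⟩ := Nat.find_spec hex
      have h1 := ht_lt hpq
      have h2 := ht_le (IsLocalRing.le_maximalIdeal hq.ne_top)
      obtain ⟨δ, hδ, hV⟩ := ih (ht (IsLocalRing.maximalIdeal R) - ht q) (by omega) q (by omega)
      refine ⟨δ + 1, ?_, fun k hk => ?_⟩
      · refine le_trans ?_ (Order.coheight_add_one_le (a := (⟨q, hq⟩ : PrimeSpectrum R)) hpq)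
        push_cast; gcongr
      · obtain ⟨x, hx, hxq⟩ := Set.exists_of_ssubset hpq
        have := hV (k+1) fun h' => hk (V_mono hpq.le (V_cut p q x hx hxq k fun q' hq' h1 h2 => ?_))
        · omega
        · rcases h2.lt_or_eq with h2 | h2
          · have := ht_lt h2
            have := Nat.find_min' hex ⟨q', hq', h1, rfl⟩
            omega
          · rwa [h2]
    · subst heq
      refine ⟨0, by simp, fun k hk => ?_⟩
      by_contra h
      exact hk (hG k h)

theorem gor_main {d : ℕ} (hG : GorL R d) (p : Ideal R) [hp : p.IsPrime] :
    (∃ δ : ℕ, ht p + δ = d ∧ (δ : ℕ∞) ≤ Order.coheight (⟨p, hp⟩ : PrimeSpectrum R)) ∧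
     ∀ k, k ≠ ht p → V p (R ⧸ p) k := by
  obtain ⟨δ, hδ, h⟩ := gor_chain hG (ht (IsLocalRing.maximalIdeal R) - ht p) p
    (by have := ht_le (IsLocalRing.le_maximalIdeal hp.ne_top); omega)
  have h1 := h _ (not_V_ht _ p rfl)
  refine ⟨⟨δ, h1, hδ⟩, fun k hk => ?_⟩
  by_contra h'
  have := h k h'
  omega

theorem gor_of (hG : IsGorensteinLocalRing R) {d : ℕ} (hd : ringKrullDim R = d) : GorL R d := by
  obtain ⟨hcm, n, hn⟩ := hG
  have hdep : moduleDepth R R = d := by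
    unfold IsCMLocalRing at hcm
    rw [hd] at hcm
    exact_mod_cast hcm
  set m := IsLocalRing.maximalIdeal R with hm
  have h0 : (0 : ℕ∞) ∈ {n : ℕ∞ | ∃ rs : List R, (rs.length : ℕ∞) = n ∧ (∀ r ∈ rs, r ∈ m) ∧
    RingTheory.Sequence.IsRegular R rs} := ⟨[], by simp, by simp, RingTheory.Sequence.IsRegular.nil R R⟩
  have : Nonempty {n : ℕ∞ | ∃ rs : List R, (rs.length : ℕ∞) = n ∧ (∀ r ∈ rs, r ∈ m) ∧
    RingTheory.Sequence.IsRegular R rs} := ⟨_, h0⟩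
  have h1 := ENat.sSup_mem_of_nonempty_of_lt_top (s := {n : ℕ∞ | ∃ rs : List R, (rs.length : ℕ∞) = n ∧ (∀ r ∈ rs, r ∈ m) ∧
    RingTheory.Sequence.IsRegular R rs}) (show _ < ⊤ by
    change moduleDepth R R < ⊤
    rw [hdep]; exact ENat.natCast_lt_top d)
  change ∃ rs : List R, (rs.length : ℕ∞) = moduleDepth R R ∧ _ at h1
  obtain ⟨rs, hlen, hmem, hreg⟩ := h1
  have hlen' : rs.length = d := by rw [hdep] at hlen; exact_mod_cast hlen
  have hlt : ∀ i < d, V m (R ⧸ m) i := by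
    intro i hi
    rw [hm, V_local]
    refine ModuleCat.subsingleton_ext_of_exists_isRegular m (ModuleCat.of R (R ⧸ m)) ?_ (ModuleCat.of R R) ?_ rs hmem hreg i (by omega)
    · change Module.support R (R ⧸ m) ⊆ _
      rw [Module.support_eq_zeroLocus, Ideal.annihilator_quotient]
    · change m • (⊤ : Submodule R R) < ⊤
      rw [smul_eq_mul, Ideal.mul_top]
      exact (IsLocalRing.maximalIdeal.isMaximal R).ne_top.lt_top
  have hgt : ∀ j, ∀ k, n - j < k → d < k → V m (R ⧸ m) k := by
    intro j
    induction j with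
    | zero =>
      intro k hk hk'
      obtain ⟨k, rfl⟩ : ∃ k', k = k' + 1 := ⟨k-1, by omega⟩
      rw [hm, V_local]
      exact (extVanish_iff _ _).1 (hn _ (by omega))
    | succ j ih =>
      intro k hk hdk
      by_cases hk' : n - j < k
      · exact ih k hk' hdk
      have hk2 : k = n - j := by omega
      have hbig : ∀ l, k < l → V m (R ⧸ m) l := fun l hl => ih l (by omega) (by omega)
      have hass : m ∈ associatedPrimes R (R ⧸ (Ideal.ofList rs • ⊤ : Submodule R R)) := by
        by_contra hcon
        have h2 : ¬ ((m : Set R) ⊆ ⋃ q ∈ associatedPrimes R (R ⧸ (Ideal.ofList rs • ⊤ : Submodule R R)), (q : Set R)) := by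
          intro hsub
          obtain ⟨q, hq, hle⟩ := (Ideal.subset_union_prime_finite (associatedPrimes.finite R _) (f := id) m m (fun q hq _ _ => hq.1)).1 hsub
          have := (IsLocalRing.maximalIdeal.isMaximal R).eq_of_le hq.1.ne_top hle
          exact hcon (by rw [hm, this]; exact hq)
        rw [biUnion_associatedPrimes_eq_compl_regular] at h2
        obtain ⟨x, hx, hx2⟩ := Set.not_subset.1 h2
        have hx3 : IsSMulRegular (R ⧸ (Ideal.ofList rs • ⊤ : Submodule R R)) x := by simpa using hx2
        have h3 : ((rs ++ [x]).length : ℕ∞) ≤ moduleDepth R R := by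
          refine le_sSup ⟨rs ++ [x], rfl, ?_, ?_⟩
          · intro r hr
            rcases List.mem_append.1 hr with h | h
            · exact hmem r h
            · simp at h; rwa [h]
          · rw [IsLocalRing.isRegular_iff_isWeaklyRegular_of_subset_maximalIdeal]
            · rw [RingTheory.Sequence.isWeaklyRegular_append_iff]
              exact ⟨hreg.1, by simpa [RingTheory.Sequence.isWeaklyRegular_singleton_iff] using hx3⟩
            · intro r hr
              rcases List.mem_append.1 hr with h | h
              · exact hmem r h
              · simp at h; rwa [h]
        rw [hdep] at h3
        simp [hlen'] at h3
        norm_cast at h3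
        omega
      obtain ⟨-, f, hf⟩ := (isAssociatedPrime_iff_exists_injective_linearMap _ _).1 (AssociatedPrimes.mem_iff.1 hass)
      refine V_left m f (LinearMap.range f).mkQ hf
        (LinearMap.exact_map_mkQ_range _) (Submodule.mkQ_surjective _) ?_ (V_big_of m k hbig _ (by omega))
      refine V_quot_reg m rs R 0 (fun k hk => ?_) hreg.1 k (by omega)
      obtain ⟨k, rfl⟩ : ∃ k', k = k' + 1 := ⟨k-1, by omega⟩
      exact V_free m k
  intro i hi
  rcases lt_or_gt_of_ne hi with h | h
  · exact hlt i h
  · exact hgt n i (by omega) h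

theorem V_big {d : ℕ} (hG : GorL R d) (p : Ideal R) [hp : p.IsPrime] (N : Type u) [AddCommGroup N] [Module R N]
    [Module.Finite R N] {k : ℕ} (hk : ht p < k) : V p N k :=
  V_big_of p (ht p) (fun k hk => (gor_main hG p).2 k (by omega)) N hk

theorem gor_Gd {d : ℕ} (hG : GorL R d) (p : Ideal R) [hp : p.IsPrime] : Gd p := fun k hk => (gor_main hG p).2 k (by omega)

end GorLocal
end S9

namespace S9
open CategoryTheory

section Kos
variable {ι : Type} [LinearOrder ι] [Fintype ι]

/-- sign -/
def sg (j : ι) (T : Finset ι) : ℤ := (-1) ^ (T.filter (· < j)).card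

theorem sg_sq (j : ι) (T : Finset ι) : sg j T * sg j T = 1 := by
  unfold sg; rw [← mul_pow]; simp

theorem sg_insert_lt {i j : ι} {T : Finset ι} (h : i ∉ T) (hij : i < j) : sg j (insert i T) = - sg j T := by
  unfold sg
  rw [Finset.filter_insert, if_pos hij, Finset.card_insert_of_notMem (by simp [h]), pow_succ]; ring

theorem sg_insert_ge {i j : ι} {T : Finset ι} (hij : ¬ i < j) : sg j (insert i T) = sg j T := by
  unfold sg
  rw [Finset.filter_insert, if_neg hij]

theorem sg_erase (j : ι) (T : Finset ι) : sg j (T.erase j) = sg j T := by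
  unfold sg
  congr 2
  ext a; simp
  intro h1 h2; exact h1.ne

variable {S : Type u} [CommRing S] {M : Type u} [AddCommGroup M] [Module S M]

/-- contraction -/
def pa (S : Type u) [CommRing S] {M : Type u} [AddCommGroup M] [Module S M] (j : ι) :
    (Finset ι → M) →ₗ[S] (Finset ι → M) where
  toFun z T := if j ∈ T then 0 else sg j T • z (insert j T)
  map_add' x y := by ext T; simp only [Pi.add_apply]; split_ifs <;> simp
  map_smul' c y := by ext T; simp only [Pi.smul_apply, RingHom.id_apply]; split_ifs <;> first | exact smul_comm _ _ _ | simp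

/-- wedge -/
def we (S : Type u) [CommRing S] {M : Type u} [AddCommGroup M] [Module S M] (j : ι) :
    (Finset ι → M) →ₗ[S] (Finset ι → M) where
  toFun z T := if j ∈ T then sg j T • z (T.erase j) else 0
  map_add' x y := by ext T; simp only [Pi.add_apply]; split_ifs <;> simp
  map_smul' c y := by ext T; simp only [Pi.smul_apply, RingHom.id_apply]; split_ifs <;> first | exact smul_comm _ _ _ | simp

theorem pa_apply (j : ι) (z : Finset ι → M) (T : Finset ι) :
    pa S j z T = if j ∈ T then 0 else sg j T • z (insert j T) := rfl
theorem we_apply (j : ι) (z : Finset ι → M) (T : Finset ι) :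
    we S j z T = if j ∈ T then sg j T • z (T.erase j) else 0 := rfl

theorem pa_pa_self (j : ι) (z : Finset ι → M) : pa S j (pa S j z) = 0 := by
  ext T; simp [pa_apply]

theorem pa_pa (i j : ι) (z : Finset ι → M) : pa S i (pa S j z) = - pa S j (pa S i z) := by
  rcases eq_or_ne i j with rfl | hij
  · simp [pa_pa_self]
  ext T
  simp only [pa_apply, Pi.neg_apply, Finset.mem_insert, hij, hij.symm, false_or]
  by_cases hi : i ∈ T <;> by_cases hj : j ∈ T <;> simp [hi, hj]
  rw [Finset.insert_comm j i, smul_smul, smul_smul, ← neg_smul]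
  congr 1
  rcases lt_or_gt_of_ne hij with h | h
  · rw [sg_insert_lt hi h, sg_insert_ge h.not_gt]; ring
  · rw [sg_insert_lt hj h, sg_insert_ge h.not_gt]; ring

theorem we_we_self (j : ι) (z : Finset ι → M) : we S j (we S j z) = 0 := by
  ext T; simp [we_apply]

theorem we_we (i j : ι) (z : Finset ι → M) : we S i (we S j z) = - we S j (we S i z) := by
  rcases eq_or_ne i j with rfl | hij
  · simp [we_we_self]
  ext T
  simp only [we_apply, Pi.neg_apply, Finset.mem_erase, hij, hij.symm]
  by_cases hi : i ∈ T <;> by_cases hj : j ∈ T <;> simp [hi, hj, hij, hij.symm]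
  rw [Finset.erase_right_comm, smul_smul, smul_smul, ← neg_smul]
  congr 1
  obtain ⟨T', hT', rfl⟩ : ∃ T', i ∉ T' ∧ T = insert i T' := ⟨T.erase i, by simp, by simp [hi]⟩
  have hj' : j ∈ T' := by simpa [hij.symm] using hj
  obtain ⟨T, hT, rfl⟩ : ∃ T, j ∉ T ∧ T' = insert j T := ⟨T'.erase j, by simp, by simp [hj']⟩
  have hi' : i ∉ T := fun h => hT' (by simp [h])
  have a1 : sg i (insert i (insert j T)) = sg i (insert j T) := sg_insert_ge (by simp)
  have a2 : sg j (insert i (insert j T)) = sg j (insert i T) := by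
    rw [Finset.insert_comm]; exact sg_insert_ge (by simp)
  have a3 : sg j (insert j T) = sg j T := sg_insert_ge (by simp)
  have a4 : sg i (insert i T) = sg i T := sg_insert_ge (by simp)
  have e2 : (insert i (insert j T)).erase j = insert i T := by
    rw [Finset.insert_comm, Finset.erase_insert (by simp [hT, hij.symm])]
  rw [Finset.erase_insert hT', e2, a1, a2, a3, a4]
  rcases lt_or_gt_of_ne hij with h | h
  · rw [sg_insert_lt hi' h, sg_insert_ge h.not_gt]; ring
  · rw [sg_insert_lt hT h, sg_insert_ge h.not_gt]; ring

theorem pa_we_self (j : ι) (z : Finset ι → M) : pa S j (we S j z) + we S j (pa S j z) = z := by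
  ext T
  simp only [pa_apply, we_apply, Pi.add_apply]
  by_cases hj : j ∈ T
  · simp [hj, sg_erase, smul_smul, sg_sq]
  · simp [hj, smul_smul, sg_insert_ge, sg_sq]

theorem pa_we_ne {i j : ι} (hij : i ≠ j) (z : Finset ι → M) : pa S i (we S j z) + we S j (pa S i z) = 0 := by
  ext T
  simp only [pa_apply, we_apply, Pi.add_apply]
  by_cases hi : i ∈ T <;> by_cases hj : j ∈ T <;> simp [hi, hj, hij, hij.symm]
  rw [Finset.erase_insert_of_ne hij, smul_smul, smul_smul, ← add_smul]
  convert zero_smul ℤ _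
  obtain ⟨T, hT, rfl⟩ : ∃ T', j ∉ T' ∧ T = insert j T' := ⟨T.erase j, by simp, by simp [hj]⟩
  have hi' : i ∉ T := fun h => hi (by simp [h])
  have a2 : sg j (insert i (insert j T)) = sg j (insert i T) := by
    rw [Finset.insert_comm]; exact sg_insert_ge (by simp)
  have a3 : sg j (insert j T) = sg j T := sg_insert_ge (by simp)
  rw [Finset.erase_insert hT, a2, a3]
  rcases lt_or_gt_of_ne hij with h | h
  · rw [sg_insert_lt hi' h, sg_insert_ge h.not_gt]; ring
  · rw [sg_insert_lt hT h, sg_insert_ge h.not_gt]; ring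

/-- differential -/
def D (u : ι → S) : (Finset ι → M) →ₗ[S] (Finset ι → M) := ∑ j, u j • pa S j
/-- wedge with a vector -/
def W (c : ι → S) : (Finset ι → M) →ₗ[S] (Finset ι → M) := ∑ j, c j • we S j

theorem D_apply (u : ι → S) (z : Finset ι → M) : D u z = ∑ j, u j • pa S j z := by simp [D]
theorem W_apply (u : ι → S) (z : Finset ι → M) : W u z = ∑ j, u j • we S j z := by simp [W]

theorem D_D_comm (u v : ι → S) (z : Finset ι → M) : D u (D v z) = - D v (D u z) := by
  simp only [D_apply, map_sum, map_smul, Finset.smul_sum]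
  rw [Finset.sum_comm, ← Finset.sum_neg_distrib]
  refine Finset.sum_congr rfl fun i _ => ?_
  rw [← Finset.sum_neg_distrib]
  refine Finset.sum_congr rfl fun j _ => ?_
  rw [pa_pa j i, smul_neg, smul_neg, smul_comm, pa_pa i j, smul_neg, smul_neg]
  try simp

theorem anti_sum {N : Type*} [AddCommGroup N] (a : ι → ι → N) (h : ∀ i j, a i j = - a j i) (h0 : ∀ i, a i i = 0) :
    ∑ i, ∑ j, a i j = 0 := by
  rw [← Finset.sum_product']
  refine Finset.sum_involution (fun x _ => (x.2, x.1)) ?_ ?_ ?_ ?_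
  · rintro ⟨i, j⟩ _; simp [h i j]
  · rintro ⟨i, j⟩ _ h1 h2
    simp at h2
    apply h1; rw [h2.1]; exact h0 _
  · simp
  · simp

theorem D_D (u : ι → S) (z : Finset ι → M) : D u (D u z) = 0 := by
  simp only [D_apply, map_sum, map_smul, Finset.smul_sum]
  refine anti_sum _ (fun i j => ?_) (fun i => ?_)
  · rw [pa_pa j i, smul_neg, smul_neg, smul_comm]
  · rw [pa_pa_self]; simp

theorem W_W (u : ι → S) (z : Finset ι → M) : W u (W u z) = 0 := by
  simp only [W_apply, map_sum, map_smul, Finset.smul_sum]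
  refine anti_sum _ (fun i j => ?_) (fun i => ?_)
  · rw [we_we j i, smul_neg, smul_neg, smul_comm]
  · rw [we_we_self]; simp

theorem pa_we (i j : ι) (z : Finset ι → M) : pa S i (we S j z) = (if i = j then z else 0) - we S j (pa S i z) := by
  split_ifs with h
  · subst h; rw [eq_sub_iff_add_eq, pa_we_self]
  · rw [eq_sub_iff_add_eq, pa_we_ne h]

theorem D_we (u : ι → S) (j : ι) (z : Finset ι → M) : D u (we S j z) = u j • z - we S j (D u z) := by
  simp only [D_apply, pa_we, smul_sub, Finset.sum_sub_distrib, map_sum, map_smul]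
  simp

theorem D_W (u c : ι → S) (z : Finset ι → M) : D u (W c z) = (∑ j, u j * c j) • z - W c (D u z) := by
  simp only [W_apply, map_sum, map_smul, D_we, smul_sub, Finset.sum_sub_distrib, Finset.sum_smul, smul_smul, mul_comm]

theorem D_pa (u : ι → S) (j : ι) (z : Finset ι → M) : D u (pa S j z) = - pa S j (D u z) := by
  simp only [D_apply, map_sum, map_smul]
  rw [← Finset.sum_neg_distrib]
  exact Finset.sum_congr rfl fun i _ => by rw [pa_pa, smul_neg]

variable (S M) in
/-- support -/
def Sp (l : Finset ι) : Submodule S (Finset ι → M) where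
  carrier := {z | ∀ T, ¬ T ⊆ l → z T = 0}
  zero_mem' T _ := rfl
  add_mem' {x y} hx hy T h := by simp [hx T h, hy T h]
  smul_mem' c x hx T h := by simp [hx T h]

variable (S M) in
/-- degree -/
def Dg (i : ℕ) : Submodule S (Finset ι → M) where
  carrier := {z | ∀ T, T.card ≠ i → z T = 0}
  zero_mem' T _ := rfl
  add_mem' {x y} hx hy T h := by simp [hx T h, hy T h]
  smul_mem' c x hx T h := by simp [hx T h]

theorem mem_Sp {l : Finset ι} {z : Finset ι → M} : z ∈ Sp S M l ↔ ∀ T, ¬ T ⊆ l → z T = 0 := Iff.rfl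
theorem mem_Dg {i : ℕ} {z : Finset ι → M} : z ∈ Dg S M i ↔ ∀ T, T.card ≠ i → z T = 0 := Iff.rfl

theorem Sp_mono {l l' : Finset ι} (h : l ⊆ l') : Sp S M l ≤ Sp S M l' := fun z hz T hT => hz T fun h' => hT (h'.trans h)
theorem Sp_univ (z : Finset ι → M) : z ∈ Sp S M Finset.univ := fun T hT => absurd (Finset.subset_univ _) hT

theorem pa_Sp {l : Finset ι} (j : ι) {z : Finset ι → M} (hz : z ∈ Sp S M l) : pa S j z ∈ Sp S M (l.erase j) := by
  intro T hT
  rw [pa_apply]; split_ifs with h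
  · rfl
  · rw [hz, smul_zero]
    intro h'; apply hT
    intro a ha
    exact Finset.mem_erase.2 ⟨fun e => h (e ▸ ha), h' (Finset.mem_insert_of_mem ha)⟩

theorem pa_zero_of {l : Finset ι} {j : ι} (hj : j ∉ l) {z : Finset ι → M} (hz : z ∈ Sp S M l) : pa S j z = 0 := by
  ext T
  rw [pa_apply]; split_ifs with h
  · rfl
  · rw [hz, smul_zero]; rfl
    intro h'; exact hj (h' (Finset.mem_insert_self _ _))

theorem we_Sp {l : Finset ι} (j : ι) {z : Finset ι → M} (hz : z ∈ Sp S M l) : we S j z ∈ Sp S M (insert j l) := by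
  intro T hT
  rw [we_apply]; split_ifs with h
  · rw [hz, smul_zero]
    intro h'; apply hT
    intro a ha
    rcases eq_or_ne a j with rfl | hne
    · simp
    · exact Finset.mem_insert_of_mem (h' (Finset.mem_erase.2 ⟨hne, ha⟩))
  · rfl

theorem D_Sp {l : Finset ι} (u : ι → S) {z : Finset ι → M} (hz : z ∈ Sp S M l) : D u z ∈ Sp S M l := by
  rw [D_apply]
  exact Submodule.sum_mem _ fun j _ => Submodule.smul_mem _ _ (Sp_mono (Finset.erase_subset _ _) (pa_Sp j hz))

theorem W_Sp {l : Finset ι} {c : ι → S} (hc : ∀ j ∉ l, c j = 0) {z : Finset ι → M} (hz : z ∈ Sp S M l) : W c z ∈ Sp S M l := by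
  rw [W_apply]
  refine Submodule.sum_mem _ fun j _ => ?_
  by_cases hj : j ∈ l
  · refine Submodule.smul_mem _ _ ?_
    have := we_Sp j hz
    rwa [Finset.insert_eq_of_mem hj] at this
  · rw [hc j hj]; simp

theorem pa_Dg {i : ℕ} (j : ι) {z : Finset ι → M} (hz : z ∈ Dg S M (i+1)) : pa S j z ∈ Dg S M i := by
  intro T hT
  rw [pa_apply]; split_ifs with h
  · rfl
  · rw [hz, smul_zero]
    rw [Finset.card_insert_of_notMem h]; omega

theorem pa_Dg0 (j : ι) {z : Finset ι → M} (hz : z ∈ Dg S M 0) : pa S j z = 0 := by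
  ext T
  rw [pa_apply]; split_ifs with h
  · rfl
  · rw [hz, smul_zero]; rfl
    rw [Finset.card_insert_of_notMem h]; omega

theorem we_Dg {i : ℕ} (j : ι) {z : Finset ι → M} (hz : z ∈ Dg S M i) : we S j z ∈ Dg S M (i+1) := by
  intro T hT
  rw [we_apply]; split_ifs with h
  · rw [hz, smul_zero]
    have := Finset.card_erase_add_one h; omega
  · rfl

theorem D_Dg {i : ℕ} (u : ι → S) {z : Finset ι → M} (hz : z ∈ Dg S M (i+1)) : D u z ∈ Dg S M i := by
  rw [D_apply]
  exact Submodule.sum_mem _ fun j _ => Submodule.smul_mem _ _ (pa_Dg j hz)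

theorem D_Dg0 (u : ι → S) {z : Finset ι → M} (hz : z ∈ Dg S M 0) : D u z = 0 := by
  rw [D_apply]
  exact Finset.sum_eq_zero fun j _ => by rw [pa_Dg0 j hz, smul_zero]

theorem W_Dg {i : ℕ} (u : ι → S) {z : Finset ι → M} (hz : z ∈ Dg S M i) : W u z ∈ Dg S M (i+1) := by
  rw [W_apply]
  exact Submodule.sum_mem _ fun j _ => Submodule.smul_mem _ _ (we_Dg j hz)

variable (S) in
/-- degree projection -/
def pr (i : ℕ) : (Finset ι → M) →ₗ[S] (Finset ι → M) where
  toFun z T := if T.card = i then z T else 0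
  map_add' x y := by ext T; simp only [Pi.add_apply]; split_ifs <;> simp
  map_smul' c y := by ext T; simp only [Pi.smul_apply, RingHom.id_apply]; split_ifs <;> simp

theorem pr_apply (i : ℕ) (z : Finset ι → M) (T : Finset ι) : pr S i z T = if T.card = i then z T else 0 := rfl

theorem pr_Dg (i : ℕ) (z : Finset ι → M) : pr S i z ∈ Dg S M i := fun T hT => by simp [pr_apply, hT]

theorem pr_of_Dg {i : ℕ} {z : Finset ι → M} (hz : z ∈ Dg S M i) : pr S i z = z := by
  ext T; rw [pr_apply]; split_ifs with h
  · rfl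
  · exact (hz T h).symm

theorem pr_Sp {i : ℕ} {l : Finset ι} {z : Finset ι → M} (hz : z ∈ Sp S M l) : pr S i z ∈ Sp S M l := by
  intro T hT; rw [pr_apply, hz T hT]; simp

theorem pr_pa (i : ℕ) (j : ι) (z : Finset ι → M) : pr S i (pa S j z) = pa S j (pr S (i+1) z) := by
  ext T; simp only [pr_apply, pa_apply]
  by_cases h : j ∈ T
  · simp [h]
  · simp [h, Finset.card_insert_of_notMem]

theorem pr_D (i : ℕ) (u : ι → S) (z : Finset ι → M) : pr S i (D u z) = D u (pr S (i+1) z) := by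
  simp only [D_apply, map_sum, map_smul, pr_pa]

theorem sum_pr (z : Finset ι → M) : ∑ i ∈ Finset.range (Fintype.card ι + 1), pr S i z = z := by
  ext T
  simp only [Finset.sum_apply, pr_apply]
  rw [Finset.sum_ite_eq]
  simp [Nat.lt_succ_of_le (Finset.card_le_univ T)]

/-- coefficient maps -/
theorem D_map {S' : Type u} [CommRing S'] {M' : Type u} [AddCommGroup M'] [Module S' M'] (φ : M →+ M')
    (u : ι → S) (u' : ι → S') (h : ∀ j m, φ (u j • m) = u' j • φ m) (z : Finset ι → M) :
    D u' (fun T => φ (z T)) = fun T => φ (D u z T) := by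
  ext T
  simp only [D_apply, Finset.sum_apply, map_sum, Pi.smul_apply, h]
  refine Finset.sum_congr rfl fun j _ => ?_
  congr 1
  simp only [pa_apply]
  split_ifs <;> simp

/-- splitting -/
theorem split_eq (b : ι) (z : Finset ι → M) : z = pa S b (we S b z) + we S b (pa S b z) := (pa_we_self b z).symm

/-- the step identity -/
theorem step_id {l : Finset ι} {b : ι} (u v c : ι → S) (s0 : S)
    (hu : s0 * u b = ∑ j, u j * c j) (z g' w1 r : Finset ι → M) (s1 s2 : S)
    (hzu : D u z = 0) (hzv : D v z = 0)
    (hg'u : D u g' = 0) (hg'v : D v g' = s1 • pa S b z)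
    (hF : s2 • (s1 • (s0 • pa S b (we S b z) + W c (pa S b z)) + (s0 * v b - ∑ j, v j * c j) • g') = r + D v w1)
    (hw1 : D u w1 = 0) : 
    D u (s2 • (W c g' - s0 • we S b g') + w1) = 0 ∧
    D v (s2 • (W c g' - s0 • we S b g') + w1) = (s2 * s0 * s1) • z - r := by
  constructor
  · simp only [map_add, map_smul, map_sub, D_W, D_we, hg'u, hw1, map_zero, sub_zero, add_zero, smul_smul, hu, sub_self, smul_zero]
  · have h2 := eq_sub_of_add_eq' hF.symm
    simp only [map_add, map_smul, map_sub, D_W, D_we, hg'v, h2]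
    conv_rhs => rw [split_eq (S := S) b z]
    simp only [smul_sub, smul_add, smul_smul, sub_smul]
    module

theorem step_f' {b : ι} (u c : ι → S) (s0 : S) (z : Finset ι → M) (hz : D u z = 0) :
    D u (s0 • pa S b (we S b z) + W c (pa S b z)) = -((s0 * u b - ∑ j, u j * c j) • pa S b z) := by
  simp only [map_add, map_smul, D_pa, D_we, D_W, hz, map_zero, sub_zero, smul_neg, neg_zero, sub_smul, smul_smul]
  module

theorem step_g {b : ι} (u : ι → S) (z : Finset ι → M) (hz : D u z = 0) : D u (pa S b z) = 0 := by
  rw [D_pa, hz, map_zero, neg_zero]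

theorem f_Sp {l : Finset ι} {b : ι} {z : Finset ι → M} (hz : z ∈ Sp S M (insert b l)) (hb : b ∉ l) : pa S b (we S b z) ∈ Sp S M l := by
  have := pa_Sp b (we_Sp b hz)
  simpa [hb] using this

theorem g_Sp {l : Finset ι} {b : ι} {z : Finset ι → M} (hz : z ∈ Sp S M (insert b l)) (hb : b ∉ l) : pa S b z ∈ Sp S M l := by
  have := pa_Sp b hz
  simpa [hb] using this

end Kos
end S9

namespace S9
open CategoryTheory

section Bridge
variable {R : Type u} [CommRing R] {n : ℕ}

/-- vacuum -/
def vac (ι : Type) [LinearOrder ι] (R : Type u) [CommRing R] : Finset ι → R := Pi.single ∅ 1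

theorem vac_Dg {ι : Type} [LinearOrder ι] [Fintype ι] : vac ι R ∈ Dg R R 0 := by
  intro T hT
  unfold vac
  rw [Pi.single_eq_of_ne]
  rintro rfl; simp at hT

/-- wedge operators as linear map to endomorphisms -/
def Wl (n : ℕ) (R : Type u) [CommRing R] : (Fin n → R) →ₗ[R] Module.End R (Finset (Fin n) → R) where
  toFun c := W c
  map_add' a b := by refine LinearMap.ext fun z => ?_; simp [W_apply, add_smul, Finset.sum_add_distrib]
  map_smul' a b := by refine LinearMap.ext fun z => ?_; simp [W_apply, mul_smul, Finset.smul_sum]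

/-- bridge -/
def Ps (n : ℕ) (R : Type u) [CommRing R] : ExteriorAlgebra R (Fin n → R) →ₗ[R] (Finset (Fin n) → R) :=
  (LinearMap.applyₗ (vac (Fin n) R)) ∘ₗ
    (ExteriorAlgebra.lift R ⟨Wl n R, fun c => LinearMap.ext fun z => W_W c z⟩).toLinearMap

theorem Ps_mul (c : Fin n → R) (z : ExteriorAlgebra R (Fin n → R)) :
    Ps n R (ExteriorAlgebra.ι R c * z) = W c (Ps n R z) := by
  simp [Ps]; rfl

theorem Ps_one : Ps n R 1 = vac (Fin n) R := by simp [Ps]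

theorem Ps_alg (r : R) : Ps n R (algebraMap _ _ r) = r • vac (Fin n) R := by 
  rw [Algebra.algebraMap_eq_smul_one, map_smul, Ps_one]

theorem Ps_diff (x : Fin n → R) (z : ExteriorAlgebra R (Fin n → R)) :
    Ps n R (koszulDiff R n x z) = D x (Ps n R z) := by
  induction z using CliffordAlgebra.left_induction with
  | algebraMap r =>
    rw [koszulDiff, CliffordAlgebra.contractLeft_algebraMap]
    rw [map_zero]
    refine Eq.symm ((congrArg (D x) (Ps_alg r)).trans ?_)
    rw [map_smul, D_Dg0 x vac_Dg, smul_zero]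
  | add a b ha hb => simp only [map_add, ha, hb]
  | ι_mul a c ha =>
    rw [koszulDiff, CliffordAlgebra.contractLeft_ι_mul, map_sub, map_smul]
    erw [Ps_mul, Ps_mul]
    rw [D_W, ← ha]
    congr 2
    simp

theorem we_single (j : Fin n) (T : Finset (Fin n)) (hj : j ∉ T) :
    we R j (Pi.single T (1 : R)) = sg j (insert j T) • (Pi.single (insert j T) (1 : R) : Finset (Fin n) → R) := by
  ext T'
  rw [we_apply]
  by_cases h : j ∈ T'
  · by_cases h2 : T' = insert j T
    · subst h2; simp [hj]
    · have h3 : T'.erase j ≠ T := by rintro rfl; simp [h] at h2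
      simp [h, h2, h3, Pi.single_apply]
  · have h2 : T' ≠ insert j T := by rintro rfl; simp at h
    simp [h, h2, Pi.single_apply]

theorem W_single (j : Fin n) (z : Finset (Fin n) → R) : W (Pi.single j (1 : R)) z = we R j z := by
  rw [W_apply, Finset.sum_eq_single j]
  · simp
  · intro b _ hb; simp [hb]
  · simp

theorem Ps_surj : Function.Surjective (Ps n R) := by
  have h : ∀ T : Finset (Fin n), (Pi.single T (1:R) : Finset (Fin n) → R) ∈ LinearMap.range (Ps n R) := by
    intro T
    induction T using Finset.induction_on with
    | empty => exact ⟨1, Ps_one⟩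
    | insert j T hj ih =>
      obtain ⟨z, hz⟩ := ih
      refine ⟨sg j (insert j T) • (ExteriorAlgebra.ι R (Pi.single j 1) * z), ?_⟩
      rw [map_zsmul, Ps_mul, hz, W_single, we_single j T hj, smul_smul, sg_sq, one_smul]
  rw [← LinearMap.range_eq_top, eq_top_iff]
  intro z _
  rw [show z = ∑ T, z T • (Pi.single T (1:R) : Finset (Fin n) → R) by
    ext T'; simp [Finset.sum_apply, Pi.single_apply]]
  exact Submodule.sum_mem _ fun T _ => Submodule.smul_mem _ _ (h T)

theorem Ps_bij : Function.Bijective (Ps n R) := by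
  refine ⟨?_, Ps_surj⟩
  have e : ExteriorAlgebra R (Fin n → R) ≃ₗ[R] (Finset (Fin n) → R) := (Pi.basisFun R (Fin n)).ExteriorAlgebra.equivFun
  have : Module.Finite R (ExteriorAlgebra R (Fin n → R)) := Module.Finite.of_basis (Pi.basisFun R (Fin n)).ExteriorAlgebra
  have h2 : Function.Surjective (e.symm.toLinearMap ∘ₗ Ps n R) := e.symm.surjective.comp Ps_surj
  have h3 := OrzechProperty.injective_of_surjective_endomorphism _ h2
  exact Function.Injective.of_comp h3

/-- bridge equivalence -/
def Pe (n : ℕ) (R : Type u) [CommRing R] : ExteriorAlgebra R (Fin n → R) ≃ₗ[R] (Finset (Fin n) → R) :=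
  LinearEquiv.ofBijective (Ps n R) Ps_bij

theorem Ps_Dg {i : ℕ} {z : ExteriorAlgebra R (Fin n → R)} (hz : z ∈ ⋀[R]^i (Fin n → R)) : Ps n R z ∈ Dg R R i := by
  induction i generalizing z with
  | zero =>
    simp only [ExteriorAlgebra.exteriorPower, pow_zero, Submodule.mem_one] at hz
    obtain ⟨r, rfl⟩ := hz
    rw [Ps_alg]; exact Submodule.smul_mem _ _ vac_Dg
  | succ i ih =>
    rw [ExteriorAlgebra.exteriorPower, pow_succ'] at hz
    induction hz using Submodule.mul_induction_on' with
    | mem_mul_mem a ha b hb =>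
      obtain ⟨c, rfl⟩ := ha
      rw [Ps_mul]
      exact W_Dg c (ih hb)
    | add a _ b _ ha hb => rw [map_add]; exact Submodule.add_mem _ ha hb

theorem Ps_Dg_iff {i : ℕ} {z : ExteriorAlgebra R (Fin n → R)} : z ∈ ⋀[R]^i (Fin n → R) ↔ Ps n R z ∈ Dg R R i := by
  classical
  refine ⟨Ps_Dg, fun h => ?_⟩
  have h1 := DirectSum.sum_support_decompose (fun i => ⋀[R]^i (Fin n → R)) z
  have h2 : pr R i (Ps n R z) = Ps n R (DirectSum.decompose (fun i => ⋀[R]^i (Fin n → R)) z i) := by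
    conv_lhs => rw [← h1]
    rw [map_sum, map_sum, Finset.sum_eq_single i]
    · exact pr_of_Dg (Ps_Dg (SetLike.coe_mem _))
    · intro k _ hk
      have := Ps_Dg (SetLike.coe_mem (DirectSum.decompose (fun i => ⋀[R]^i (Fin n → R)) z k))
      ext T
      rw [pr_apply]
      split_ifs with hT
      · exact this T (by omega)
      · rfl
    · intro hi
      rw [DFinsupp.notMem_support_iff.1 hi]; simp
  rw [pr_of_Dg h] at h2
  rw [Ps_bij.1 h2]
  exact SetLike.coe_mem _

/-- model cycles -/
def Zm {ι : Type} [LinearOrder ι] [Fintype ι] {R : Type u} [CommRing R] (x : ι → R) (l : Finset ι) (i : ℕ) : Submodule R (Finset ι → R) :=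
  Sp R R l ⊓ (Dg R R i ⊓ LinearMap.ker (D x))

/-- model boundaries -/
def Bm {ι : Type} [LinearOrder ι] [Fintype ι] {R : Type u} [CommRing R] (x : ι → R) (i : ℕ) : Submodule R (Finset ι → R) :=
  (Dg R R (i+1)).map (D x)

/-- model homology -/
abbrev Hm {ι : Type} [LinearOrder ι] [Fintype ι] {R : Type u} [CommRing R] (x : ι → R) (i : ℕ) :=
  ↥(Zm x Finset.univ i) ⧸ (Bm x i).comap (Zm x Finset.univ i).subtype

theorem mem_Zm_univ {x : Fin n → R} {i : ℕ} {z : Finset (Fin n) → R} : z ∈ Zm x Finset.univ i ↔ z ∈ Dg R R i ∧ D x z = 0 := by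
  simp only [Zm, Submodule.mem_inf, LinearMap.mem_ker]
  exact ⟨fun h => h.2, fun h => ⟨Sp_univ z, h⟩⟩

/-- homology comparison -/
def He (x : Fin n → R) (i : ℕ) : koszulHomology R n x i ≃ₗ[R] Hm x i := by
  have h1 : (koszulCycles R n x i).map (Pe n R : _ →ₗ[R] _) = Zm x Finset.univ i := by
    ext z
    rw [mem_Zm_univ]
    constructor
    · rintro ⟨y, ⟨hy1, hy2⟩, rfl⟩
      refine ⟨Ps_Dg hy1, ?_⟩
      change D x (Ps n R y) = 0
      rw [← Ps_diff, LinearMap.mem_ker.1 hy2, map_zero]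
    · rintro ⟨h1, h2⟩
      obtain ⟨y, rfl⟩ := Ps_bij.2 z
      refine ⟨y, ⟨Ps_Dg_iff.2 h1, ?_⟩, rfl⟩
      rw [← Ps_diff] at h2
      exact Ps_bij.1 (by rw [h2, map_zero])
  refine Submodule.Quotient.equiv _ _ (((Pe n R).submoduleMap _).trans (LinearEquiv.ofEq _ _ h1)) ?_
  ext z
  simp only [Submodule.mem_comap, Bm]
  constructor
  · rintro ⟨y, ⟨w, hw, hw2⟩, rfl⟩
    refine ⟨Ps n R w, Ps_Dg hw, ?_⟩
    rw [← Ps_diff, hw2]; rfl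
  · rintro ⟨w, hw, hw2⟩
    obtain ⟨w, rfl⟩ := Ps_bij.2 w
    obtain ⟨y, hy⟩ := (((Pe n R).submoduleMap (koszulCycles R n x i)).trans (LinearEquiv.ofEq _ _ h1)).surjective z
    refine ⟨y, ⟨w, Ps_Dg_iff.2 hw, ?_⟩, hy⟩
    apply Ps_bij.1
    rw [Ps_diff, hw2, ← hy]; rfl

end Bridge
end S9

namespace S9
open CategoryTheory

section Acy
variable {R : Type u} [CommRing R] [IsNoetherianRing R] {L : Type u} [AddCommGroup L] [Module R L]
  (δ : L →ₗ[R] L) (C : ℕ → Submodule R L)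

/-- cokernels of the complex -/
abbrev Qc (j : ℕ) := ↥(C j) ⧸ ((C (j+1)).map δ).comap (C j).subtype

/-- local exactness -/
def ExAt (p : Ideal R) (i : ℕ) : Prop := ∀ z ∈ C i, δ z = 0 → ∃ s ∉ p, ∃ w ∈ C (i+1), δ w = s • z

theorem uniform_kill {M : Type u} [AddCommGroup M] [Module R M] (p : Ideal R) [hp : p.IsPrime] (K : Submodule R M) (hK : K.FG)
    (h : ∀ x ∈ K, ∃ s ∉ p, s • x = 0) : ∃ s ∉ p, ∀ x ∈ K, s • x = 0 := by
  induction K, hK using Submodule.fg_induction with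
  | singleton x =>
    obtain ⟨s, hs, h⟩ := h x (Submodule.mem_span_singleton_self x)
    refine ⟨s, hs, fun y hy => ?_⟩
    obtain ⟨a, rfl⟩ := Submodule.mem_span_singleton.1 hy
    rw [smul_comm, h, smul_zero]
  | sup A B hA hB ihA ihB =>
    obtain ⟨s, hs, h1⟩ := ihA fun x hx => h x (Submodule.mem_sup_left hx)
    obtain ⟨t, ht, h2⟩ := ihB fun x hx => h x (Submodule.mem_sup_right hx)
    refine ⟨s * t, fun h => (hp.mem_or_mem h).elim hs ht, fun y hy => ?_⟩
    obtain ⟨a, ha, b, hb, rfl⟩ := Submodule.mem_sup.1 hy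
    rw [smul_add, mul_comm, mul_smul, h1 a ha, mul_comm, mul_smul, h2 b hb]; simp


theorem acy_V (hδ : ∀ z, δ (δ z) = 0) (hC : ∀ i, ∀ z ∈ C (i+1), δ z ∈ C i) (hfg : ∀ i, (C i).FG)
    (p : Ideal R) [hp : p.IsPrime]
    (hA : ∀ i k, 0 < k → V p (C i) k) {N : ℕ} (hN : ∀ i, N < i → ∀ z ∈ C i, ∃ s ∉ p, s • z = 0) (n : ℕ) :
    ∀ j, j + n = N + 1 → (∀ i, j < i → ExAt δ C p i) → ∀ k, 1 ≤ k → N < k + j → V p (Qc δ C j) k := by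
  have key : ∀ j k, V p ((C (j+1)).map δ) k → V p (Qc δ C j) (k+1) := by
    intro j k hB
    have hle : (C (j+1)).map δ ≤ C j := by
      rintro _ ⟨z, hz, rfl⟩; exact hC j z hz
    refine V_right p (Submodule.inclusion hle) (Submodule.mkQ _) (Submodule.inclusion_injective hle) ?_ (Submodule.mkQ_surjective _) hB (hA j _ (by omega))
    intro x
    rw [← LinearMap.mem_ker, Submodule.ker_mkQ, Submodule.mem_comap]
    constructor
    · intro h; exact ⟨⟨_, h⟩, rfl⟩
    · rintro ⟨y, rfl⟩; exact y.2
  have hkill : ∀ j k, N ≤ j → V p ((C (j+1)).map δ) k := by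
    intro j k hj
    obtain ⟨s, hs, h⟩ := uniform_kill p (C (j+1)) (hfg _) (hN (j+1) (by omega))
    refine V_kill p s hs ?_ k
    rintro ⟨_, z, hz, rfl⟩
    ext; simp [← map_smul, h z hz]
  induction n with
  | zero =>
    intro j hj hex k hk hk'
    obtain ⟨k, rfl⟩ : ∃ k', k = k' + 1 := ⟨k-1, by omega⟩
    exact key j k (hkill j k (by omega))
  | succ n ih =>
    intro j hj hex k hk hk'
    obtain ⟨k, rfl⟩ : ∃ k', k = k' + 1 := ⟨k-1, by omega⟩
    refine key j k ?_
    by_cases hjN : N ≤ j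
    · exact hkill j k hjN
    obtain ⟨k, rfl⟩ : ∃ k', k = k' + 1 := ⟨k-1, by omega⟩
    have hQ := ih (j+1) (by omega) (fun i hi => hex i (by omega)) (k+1) (by omega) (by omega)
    let f : Qc δ C (j+1) →ₗ[R] (C (j+1)).map δ := Submodule.liftQ _ (δ.submoduleMap (C (j+1))) (by
      rintro z ⟨w, hw, hw2⟩
      rw [LinearMap.mem_ker]; ext
      change δ (z : L) = 0
      have : δ w = (z : L) := hw2
      rw [← this, hδ w])
    have hf : Function.Surjective f := by
      rintro ⟨_, z, hz, rfl⟩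
      exact ⟨Submodule.Quotient.mk ⟨z, hz⟩, rfl⟩
    have hfgQ : Module.Finite R (C (j+1)) := Module.Finite.iff_fg.2 (hfg _)
    obtain ⟨s, hs, hs'⟩ := uniform_kill p (LinearMap.ker f) (IsNoetherian.noetherian _) (by
      intro x hx
      obtain ⟨⟨z, hz⟩, rfl⟩ := Submodule.Quotient.mk_surjective _ x
      have hz0 : δ z = 0 := congrArg Subtype.val (LinearMap.mem_ker.1 hx)
      obtain ⟨s, hs, w, hw, hw2⟩ := hex (j+1) (by omega) z hz hz0
      refine ⟨s, hs, ?_⟩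
      rw [← Submodule.Quotient.mk_smul, Submodule.Quotient.mk_eq_zero]
      exact ⟨w, hw, hw2⟩)
    refine V_right p (LinearMap.ker f).subtype f Subtype.val_injective (LinearMap.exact_subtype_ker_map f) hf
      (V_kill p s hs (fun x => Subtype.ext (hs' x x.2)) k) hQ

/-- acyclicity lemma -/
theorem acy (hδ : ∀ z, δ (δ z) = 0) (hC : ∀ i, ∀ z ∈ C (i+1), δ z ∈ C i) (hfg : ∀ i, (C i).FG)
    (p : Ideal R) [hp : p.IsPrime]
    (hG : Gd p) (hA : ∀ i k, 0 < k → V p (C i) k) {N : ℕ} (hN : ∀ i, N < i → ∀ z ∈ C i, ∃ s ∉ p, s • z = 0)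
    (hNp : N < ht p) (hq : ∀ q : Ideal R, q.IsPrime → q < p → ∀ i, 1 ≤ i → ExAt δ C q i) :
    ∀ i, 1 ≤ i → ExAt δ C p i := by
  have main : ∀ n j, 1 ≤ j → N + 1 - j = n → ExAt δ C p j := by
    intro n
    induction n using Nat.strong_induction_on with
    | _ n ih =>
      intro j hj hn
      by_cases hjN : N < j
      · intro z hz _
        obtain ⟨s, hs, h⟩ := hN j hjN z hz
        exact ⟨s, hs, 0, zero_mem _, by rw [h, map_zero]⟩
      have hex : ∀ i, j < i → ExAt δ C p i := fun i hi => ih (N + 1 - i) (by omega) i (by omega) rfl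
      have hV := acy_V δ C hδ hC hfg p hA hN (N+1-j) j (by omega) hex
      have hfgQ : Module.Finite R (C j) := Module.Finite.iff_fg.2 (hfg _)
      let X : Submodule R (Qc δ C j) := (LinearMap.ker (δ ∘ₗ (C j).subtype)).map (Submodule.mkQ _)
      obtain ⟨s, hs, h⟩ := ass_lemma p hG hNp (fun k hk => hV k (by omega) (by omega)) X (by
        intro q hqp hqlt
        refine uniform_kill q X (IsNoetherian.noetherian _) ?_
        rintro _ ⟨⟨z, hz⟩, hz0, rfl⟩
        obtain ⟨s, hs, w, hw, hw2⟩ := hq q hqp hqlt j hj z hz (LinearMap.mem_ker.1 hz0)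
        refine ⟨s, hs, ?_⟩
        rw [Submodule.mkQ_apply, ← Submodule.Quotient.mk_smul, Submodule.Quotient.mk_eq_zero]
        exact ⟨w, hw, hw2⟩)
      intro z hz hz0
      have h1 := h (Submodule.mkQ _ ⟨z, hz⟩) ⟨⟨z, hz⟩, LinearMap.mem_ker.2 hz0, rfl⟩
      rw [Submodule.mkQ_apply, ← Submodule.Quotient.mk_smul, Submodule.Quotient.mk_eq_zero] at h1
      obtain ⟨w, hw, hw2⟩ := h1
      exact ⟨s, hs, w, hw, hw2⟩
  exact fun i hi => main _ i hi rfl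

theorem acy0 (hδ : ∀ z, δ (δ z) = 0) (hC : ∀ i, ∀ z ∈ C (i+1), δ z ∈ C i) (hfg : ∀ i, (C i).FG)
    (p : Ideal R) [hp : p.IsPrime]
    (hG : Gd p) (hA : ∀ i k, 0 < k → V p (C i) k) {N : ℕ} (hN : ∀ i, N < i → ∀ z ∈ C i, ∃ s ∉ p, s • z = 0)
    (hNp : N < ht p) (hex : ∀ i, 1 ≤ i → ExAt δ C p i) (X : Submodule R L) (hX : X ≤ C 0)
    (hq : ∀ q : Ideal R, q.IsPrime → q < p → ∀ z ∈ X, ∃ s ∉ q, ∃ w ∈ C 1, δ w = s • z) :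
    ∀ z ∈ X, ∃ s ∉ p, ∃ w ∈ C 1, δ w = s • z := by
  have hV := acy_V δ C hδ hC hfg p hA hN (N+1) 0 (by omega) hex
  have hfgQ : Module.Finite R (C 0) := Module.Finite.iff_fg.2 (hfg _)
  let X' : Submodule R (Qc δ C 0) := (X.comap (C 0).subtype).map (Submodule.mkQ _)
  obtain ⟨s, hs, h⟩ := ass_lemma p hG hNp (fun k hk => hV k (by omega) (by omega)) X' (by
    intro q hqp hqlt
    refine uniform_kill q X' (IsNoetherian.noetherian _) ?_
    rintro _ ⟨⟨z, hz⟩, hz0, rfl⟩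
    obtain ⟨s, hs, w, hw, hw2⟩ := hq q hqp hqlt z hz0
    refine ⟨s, hs, ?_⟩
    rw [Submodule.mkQ_apply, ← Submodule.Quotient.mk_smul, Submodule.Quotient.mk_eq_zero]
    exact ⟨w, hw, hw2⟩)
  intro z hz
  have h1 := h (Submodule.mkQ _ ⟨z, hX hz⟩) ⟨⟨z, hX hz⟩, hz, rfl⟩
  rw [Submodule.mkQ_apply, ← Submodule.Quotient.mk_smul, Submodule.Quotient.mk_eq_zero] at h1
  obtain ⟨w, hw, hw2⟩ := h1
  exact ⟨s, hs, w, hw, hw2⟩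

end Acy
end S9

namespace S9
open CategoryTheory

section Zl
variable {ι : Type} [LinearOrder ι] [Fintype ι] {R : Type u} [CommRing R]
  (p : Ideal R) [hp : p.IsPrime]

theorem V_Dg (i k : ℕ) (hk : 0 < k) : V p (Dg R R i : Submodule R (Finset ι → R)) k := by
  obtain ⟨k, rfl⟩ : ∃ k', k = k' + 1 := ⟨k-1, by omega⟩
  refine V_retract p (Submodule.subtype _) (LinearMap.codRestrict (Dg R R i) (pr R i) (pr_Dg i)) 1 hp.one_notMem ?_ (V_free p k)
  rintro ⟨z, hz⟩
  ext1
  simp [pr_of_Dg hz]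

theorem V_Z_of_H (x : ι → R) (h : ∀ i k, 2 < k → V p (Hm x i) k) (i : ℕ) :
    ∀ k, 0 < k → V p (Zm x Finset.univ i) k := by
  induction i with
  | zero =>
    intro k hk
    have : Zm x Finset.univ 0 = Dg R R 0 := by
      refine le_antisymm (fun z hz => hz.2.1) fun z hz => ⟨Sp_univ z, hz, LinearMap.mem_ker.2 (D_Dg0 x hz)⟩
    rw [this]; exact V_Dg p 0 k hk
  | succ i ih =>
    intro k hk
    have hBle : Bm x i ≤ Zm x Finset.univ i := by
      rintro _ ⟨z, hz, rfl⟩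
      exact ⟨Sp_univ _, D_Dg x hz, LinearMap.mem_ker.2 (D_D x z)⟩
    have hB : V p (Bm x i) (k+1) := by
      refine V_left p (Submodule.inclusion hBle) (Submodule.mkQ _) (Submodule.inclusion_injective _) ?_ (Submodule.mkQ_surjective _) (ih _ (by omega)) (h i _ (by omega))
      intro y
      rw [← LinearMap.mem_ker, Submodule.ker_mkQ, Submodule.mem_comap]
      constructor
      · intro h; exact ⟨⟨_, h⟩, rfl⟩
      · rintro ⟨y, rfl⟩; exact y.2
    have hZle : Zm x Finset.univ (i+1) ≤ Dg R R (i+1) := fun z hz => hz.2.1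
    refine V_left p (Submodule.inclusion hZle) ((D x).submoduleMap (Dg R R (i+1))) (Submodule.inclusion_injective _) ?_
      (LinearMap.submoduleMap_surjective _ _) (V_Dg p _ k hk) hB
    intro y
    constructor
    · intro h
      exact ⟨⟨y, Sp_univ _, y.2, congrArg Subtype.val h⟩, rfl⟩
    · rintro ⟨y, rfl⟩
      ext1
      exact y.2.2.2

/-- `x` restricted to `l` generates `p`-locally -/
def PG (x : ι → R) (l : Finset ι) : Prop :=
  ∀ b, ∃ s ∉ p, ∃ c : ι → R, (∀ j ∉ l, c j = 0) ∧ s * x b = ∑ j, x j * c j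

theorem PG_mono {ι' : Type} [Fintype ι'] {R' : Type u} [CommRing R'] (p' : Ideal R') {x : ι' → R'} {l l' : Finset ι'}
    (h : l ⊆ l') (hl : PG p' x l) : PG p' x l' := fun b => by
  obtain ⟨s, hs, c, hc, h2⟩ := hl b
  exact ⟨s, hs, c, fun j hj => hc j fun h' => hj (h h'), h2⟩

theorem PG_le {ι' : Type} [Fintype ι'] {R' : Type u} [CommRing R'] (p' : Ideal R') {x : ι' → R'} {l : Finset ι'} {q : Ideal R'}
    (h : q ≤ p') (hl : PG p' x l) : PG q x l := fun b => by
  obtain ⟨s, hs, c, hc, h2⟩ := hl b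
  exact ⟨s, fun h' => hs (h h'), c, hc, h2⟩

theorem pa_we_Sp {l : Finset ι} {b : ι} (hb : b ∉ l) {M : Type u} [AddCommGroup M] [Module R M] {z : Finset ι → M} (hz : z ∈ Sp R M l) :
    pa R b (we R b z) = z := by
  have := pa_we_self (S := R) b z
  rwa [pa_zero_of hb hz, map_zero, add_zero] at this

theorem W_pa_Dg {S : Type u} [CommRing S] {M : Type u} [AddCommGroup M] [Module S M] {i : ℕ} (c : ι → S) (b : ι) {z : Finset ι → M} (hz : z ∈ Dg S M i) : W c (pa S b z) ∈ Dg S M i := by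
  cases i with
  | zero => rw [pa_Dg0 b hz, map_zero]; exact zero_mem _
  | succ i => exact W_Dg c (pa_Dg b hz)

theorem V_Z_step (x : ι → R) {l : Finset ι} {b : ι} (hb : b ∉ l) (hl : PG p x l) (i k : ℕ)
    (h : V p (Zm x (insert b l) i) k) : V p (Zm x l i) k := by
  obtain ⟨s, hs, c, hc, h2⟩ := hl b
  have hle : Zm x l i ≤ Zm x (insert b l) i := fun z hz => ⟨Sp_mono (Finset.subset_insert _ _) hz.1, hz.2⟩
  let g : Zm x (insert b l) i →ₗ[R] Zm x l i :=
    LinearMap.restrict (s • (pa R b ∘ₗ we R b) + W c ∘ₗ pa R b) (by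
      rintro z ⟨h1, h3, h4⟩
      refine ⟨?_, ?_, ?_⟩
      · exact Submodule.add_mem _ (Submodule.smul_mem _ _ (f_Sp h1 hb)) (W_Sp hc (g_Sp h1 hb))
      · exact Submodule.add_mem _ (Submodule.smul_mem _ _ (pa_Dg b (we_Dg b h3))) (W_pa_Dg c b h3)
      · have := step_f' (b := b) x c s z h4
        rw [h2, sub_self, zero_smul, neg_zero] at this
        exact this)
  refine V_retract p (Submodule.inclusion hle) g s hs ?_ h
  rintro ⟨z, hz⟩
  ext1
  change s • pa R b (we R b z) + W c (pa R b z) = s • z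
  rw [pa_we_Sp hb hz.1, pa_zero_of hb hz.1, map_zero, add_zero]

theorem V_Z_sub (x : ι → R) {l : Finset ι} (hl : PG p x l) (i k : ℕ)
    (h : V p (Zm x Finset.univ i) k) : V p (Zm x l i) k := by
  have : ∀ n l, PG p x l → (Finset.univ \ l).card = n → V p (Zm x l i) k := by
    intro n
    induction n with
    | zero =>
      intro l _ hn
      rw [Finset.card_eq_zero, Finset.sdiff_eq_empty_iff_subset, Finset.univ_subset_iff] at hn
      rwa [hn]
    | succ n ih =>
      intro l hl hn
      obtain ⟨b, hb⟩ : (Finset.univ \ l).Nonempty := by rw [← Finset.card_pos]; omega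
      have hb' : b ∉ l := by simpa using hb
      refine V_Z_step p x hb' hl i k (ih _ (PG_mono p (Finset.subset_insert _ _) hl) ?_)
      rw [Finset.sdiff_insert, Finset.card_erase_of_mem hb]; omega
  exact this _ l hl rfl

theorem Sp_of_Dg0 {M : Type u} [AddCommGroup M] [Module R M] {z : Finset ι → M} (hz : z ∈ Dg R M 0) (l : Finset ι) : z ∈ Sp R M l := by
  intro T hT
  apply hz
  intro h; apply hT
  rw [Finset.card_eq_zero.1 h]; exact Finset.empty_subset _

theorem Sp_of_pa {M : Type u} [AddCommGroup M] [Module R M] {l : Finset ι} {b : ι} (hb : b ∉ l) {z : Finset ι → M} (hz : z ∈ Sp R M (insert b l)) (h : pa R b z = 0) : z ∈ Sp R M l := by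
  have := f_Sp hz hb
  rwa [eq_sub_of_add_eq (pa_we_self (S := R) b z), h, map_zero, sub_zero] at this

theorem V_Z_up (x : ι → R) {l : Finset ι} {b : ι} (hb : b ∉ l) (c : ι → R) (hc : ∀ j ∉ l, c j = 0)
    (hx : x b = ∑ j, x j * c j) (k : ℕ) (h : ∀ i, V p (Zm x l i) k) (i : ℕ) : V p (Zm x (insert b l) i) k := by
  cases i with
  | zero =>
    have : Zm x (insert b l) 0 = Zm x l 0 := by
      ext z; exact ⟨fun hz => ⟨Sp_of_Dg0 hz.2.1 _, hz.2⟩, fun hz => ⟨Sp_of_Dg0 hz.2.1 _, hz.2⟩⟩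
    rw [this]; exact h 0
  | succ i =>
    have hle : Zm x l (i+1) ≤ Zm x (insert b l) (i+1) := fun z hz => ⟨Sp_mono (Finset.subset_insert _ _) hz.1, hz.2⟩
    let g : Zm x (insert b l) (i+1) →ₗ[R] Zm x l i := LinearMap.restrict (pa R b) (by
      rintro z ⟨h1, h3, h4⟩
      exact ⟨g_Sp h1 hb, pa_Dg b h3, step_g x z h4⟩)
    refine V_mid p (Submodule.inclusion hle) g (Submodule.inclusion_injective _) ?_ ?_ (h (i+1)) (h i)
    · rintro ⟨z, hz⟩
      constructor
      · intro h0
        exact ⟨⟨z, Sp_of_pa hb hz.1 (congrArg Subtype.val h0), hz.2⟩, rfl⟩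
      · rintro ⟨⟨y, hy⟩, h⟩
        have h' : y = z := congrArg Subtype.val h
        subst h'
        ext1
        exact pa_zero_of hb hy.1
    · rintro ⟨z, hz⟩
      have hz4 : D x z = 0 := hz.2.2
      refine ⟨⟨we R b z - W c z, ?_, ?_, ?_⟩, ?_⟩
      · exact Submodule.sub_mem _ (we_Sp b hz.1) (Sp_mono (Finset.subset_insert _ _) (W_Sp hc hz.1))
      · exact Submodule.sub_mem _ (we_Dg b hz.2.1) (W_Dg c hz.2.1)
      · rw [SetLike.mem_coe, LinearMap.mem_ker, map_sub, D_we, D_W, hz4, hx]; simp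
      · ext1
        change pa R b (we R b z - W c z) = z
        rw [map_sub, pa_we_Sp hb hz.1, pa_zero_of hb (W_Sp hc hz.1), sub_zero]

/-- transfer along an order embedding -/
theorem V_Z_emb {κ : Type} [LinearOrder κ] [Fintype κ] (φ : ι ↪o κ) (x : κ → R) (k : ℕ) (i : ℕ)
    (h : V p (Zm (x ∘ φ) Finset.univ i) k) : V p (Zm x (Finset.univ.map φ.toEmbedding) i) k := by
  classical
  have hsg : ∀ (j : ι) (T : Finset ι), sg (φ j) (T.map φ.toEmbedding) = sg j T := by
    intro j T
    unfold sg
    congr 1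
    rw [Finset.filter_map, Finset.card_map]
    congr 1
    ext a; simp
  have hsub : ∀ T : Finset κ, T ⊆ Finset.univ.map φ.toEmbedding → ∃ T' : Finset ι, T'.map φ.toEmbedding = T := by
    intro T hT
    obtain ⟨T', -, h⟩ := Finset.subset_map_iff.1 hT
    exact ⟨T', h.symm⟩
  let f0 : (Finset κ → R) →ₗ[R] (Finset ι → R) := LinearMap.funLeft R R (Finset.map φ.toEmbedding)
  have hf0 : ∀ z ∈ Sp R R (Finset.univ.map φ.toEmbedding), D (x ∘ φ) (f0 z) = f0 (D x z) := by
    intro z hz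
    ext T
    change _ = D x z (T.map φ.toEmbedding)
    simp only [D_apply, Finset.sum_apply, Pi.smul_apply, pa_apply]
    have : ∀ j ∉ (Finset.univ.map φ.toEmbedding), x j • (if j ∈ T.map φ.toEmbedding then 0 else sg j (T.map φ.toEmbedding) • z (insert j (T.map φ.toEmbedding))) = 0 := by
      intro j hj
      split_ifs
      · simp
      · rw [hz, smul_zero, smul_zero]
        intro h; exact hj (h (Finset.mem_insert_self _ _))
    rw [← Finset.sum_subset (Finset.subset_univ (Finset.univ.map φ.toEmbedding)) (fun j _ hj => this j hj), Finset.sum_map]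
    refine Finset.sum_congr rfl fun j _ => ?_
    simp only [Function.comp_apply, RelEmbedding.coe_toEmbedding, Finset.mem_map' , hsg]
    have e : insert (φ j) (T.map φ.toEmbedding) = (insert j T).map φ.toEmbedding := by
      rw [Finset.map_insert]; rfl
    have e2 : (φ j ∈ T.map φ.toEmbedding) ↔ j ∈ T := by simp
    rw [e]
    simp only [e2]
    rfl
  let g0 : (Finset ι → R) →ₗ[R] (Finset κ → R) :=
    { toFun := fun z T => if T ⊆ Finset.univ.map φ.toEmbedding then z (T.preimage φ φ.injective.injOn) else 0
      map_add' := fun a b => by ext T; simp only [Pi.add_apply]; split_ifs <;> simp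
      map_smul' := fun a b => by ext T; simp only [Pi.smul_apply, RingHom.id_apply]; split_ifs <;> simp }
  have hpre : ∀ T : Finset ι, (T.map φ.toEmbedding).preimage φ φ.injective.injOn = T := by
    intro T; ext a; simp
  have hfg : ∀ z, f0 (g0 z) = z := by
    intro z; ext T
    change (if T.map φ.toEmbedding ⊆ Finset.univ.map φ.toEmbedding then z ((T.map φ.toEmbedding).preimage φ φ.injective.injOn) else 0) = _
    rw [if_pos (Finset.map_subset_map.2 (Finset.subset_univ _)), hpre]
  have hgSp : ∀ z, g0 z ∈ Sp R R (Finset.univ.map φ.toEmbedding) := fun z T hT => if_neg hT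
  have hinj : ∀ z ∈ Sp R R (Finset.univ.map φ.toEmbedding), f0 z = 0 → z = 0 := by
    intro z hz h
    ext T
    by_cases hT : T ⊆ Finset.univ.map φ.toEmbedding
    · obtain ⟨T', rfl⟩ := hsub T hT
      exact congrFun h T'
    · exact hz T hT
  have hgf : ∀ z ∈ Sp R R (Finset.univ.map φ.toEmbedding), g0 (f0 z) = z := by
    intro z hz
    exact sub_eq_zero.1 (hinj _ (Submodule.sub_mem _ (hgSp _) hz) (by rw [map_sub, hfg, sub_self]))
  let f : Zm x (Finset.univ.map φ.toEmbedding) i →ₗ[R] Zm (x ∘ φ) Finset.univ i := LinearMap.restrict f0 (by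
    rintro z ⟨h1, h2, h3⟩
    refine ⟨Sp_univ _, fun T hT => h2 _ (by rwa [Finset.card_map]), ?_⟩
    rw [SetLike.mem_coe, LinearMap.mem_ker, hf0 z h1, LinearMap.mem_ker.1 h3, map_zero])
  let g : Zm (x ∘ φ) Finset.univ i →ₗ[R] Zm x (Finset.univ.map φ.toEmbedding) i := LinearMap.restrict g0 (by
    rintro z ⟨h1, h2, h3⟩
    refine ⟨hgSp _, fun T hT => ?_, ?_⟩
    · by_cases hT' : T ⊆ Finset.univ.map φ.toEmbedding
      · obtain ⟨T', rfl⟩ := hsub T hT'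
        have := congrFun (hfg z) T'
        exact this.trans (h2 T' (by rwa [Finset.card_map] at hT))
      · exact hgSp z T hT'
    · refine hinj _ (D_Sp x (hgSp z)) ?_
      rw [← hf0 _ (hgSp z), hfg, LinearMap.mem_ker.1 h3])
  refine V_retract p f g 1 hp.one_notMem ?_ h
  rintro ⟨z, hz⟩
  ext1
  rw [one_smul]
  exact hgf z hz.1

end Zl
end S9

namespace S9
open CategoryTheory
open MvPolynomial (C X coeff monomial)

section Cl
variable {κ : Type} [LinearOrder κ] [Fintype κ] {σ : Type} [Fintype σ] {R : Type u} [CommRing R]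

/-- coefficients -/
def cf (R : Type u) [CommRing R] (α : σ →₀ ℕ) : (Finset κ → MvPolynomial σ R) →ₗ[R] (Finset κ → R) :=
  LinearMap.compLeft (MvPolynomial.lcoeff R α) _

/-- monomials -/
def mo (R : Type u) [CommRing R] (α : σ →₀ ℕ) : (Finset κ → R) →ₗ[R] (Finset κ → MvPolynomial σ R) :=
  LinearMap.compLeft (monomial α) _

/-- polynomial degree projection -/
def Pj (e : ℕ) : (Finset κ → MvPolynomial σ R) →ₗ[R] (Finset κ → MvPolynomial σ R) :=
  LinearMap.compLeft (MvPolynomial.homogeneousComponent e) _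

theorem cf_apply (α : σ →₀ ℕ) (z : Finset κ → MvPolynomial σ R) (T) : cf R α z T = coeff α (z T) := rfl
theorem mo_apply (α : σ →₀ ℕ) (z : Finset κ → R) (T) : mo R α z T = monomial α (z T) := rfl
theorem Pj_apply (e : ℕ) (z : Finset κ → MvPolynomial σ R) (T) : Pj e z T = MvPolynomial.homogeneousComponent e (z T) := rfl

/-- constants -/
abbrev uC (σ : Type) (x : κ → R) : κ → MvPolynomial σ R := fun j => C (x j)

theorem C_smul (s : R) (z : Finset κ → MvPolynomial σ R) : (C s : MvPolynomial σ R) • z = s • z := by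
  ext1 T; simp [MvPolynomial.smul_eq_C_mul]

theorem D_cf (x : κ → R) (α : σ →₀ ℕ) (z : Finset κ → MvPolynomial σ R) : D x (cf R α z) = cf R α (D (uC σ x) z) := 
  D_map (S := MvPolynomial σ R) (MvPolynomial.lcoeff R α).toAddMonoidHom (uC σ x) x (fun j m => by simp [uC]) z

theorem D_mo (x : κ → R) (α : σ →₀ ℕ) (z : Finset κ → R) : D (uC σ x) (mo R α z) = mo R α (D x z) := 
  D_map (S := R) (monomial α).toAddMonoidHom x (uC σ x) (fun j m => by simp [uC, MvPolynomial.C_mul_monomial]) z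

theorem D_Pj (x : κ → R) (e : ℕ) (z : Finset κ → MvPolynomial σ R) : D (uC σ x) (Pj e z) = Pj e (D (uC σ x) z) := 
  D_map (S := MvPolynomial σ R) (MvPolynomial.homogeneousComponent e).toAddMonoidHom (uC σ x) (uC σ x) (fun j m => by simp [uC, MvPolynomial.homogeneousComponent_C_mul]) z

/-- entries are variables or zero -/
def Lin (v : κ → MvPolynomial σ R) : Prop := ∀ j, v j = 0 ∨ ∃ k, v j = X k

theorem hc_X (k : σ) (e : ℕ) (m : MvPolynomial σ R) : MvPolynomial.homogeneousComponent (e+1) (X k * m) = X k * MvPolynomial.homogeneousComponent e m := by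
  classical
  ext α
  rw [MvPolynomial.coeff_homogeneousComponent, MvPolynomial.coeff_X_mul', MvPolynomial.coeff_X_mul', MvPolynomial.coeff_homogeneousComponent]
  by_cases hk : k ∈ α.support
  · simp only [hk, if_true]
    have : (α - Finsupp.single k 1).degree + 1 = α.degree := by
      have h1 : Finsupp.single k 1 ≤ α := by
        rw [Finsupp.single_le_iff]; exact Nat.one_le_iff_ne_zero.2 (Finsupp.mem_support_iff.1 hk)
      conv_rhs => rw [← tsub_add_cancel_of_le h1]
      simp [Finsupp.degree_single]
    by_cases h : α.degree = e + 1
    · rw [if_pos h, if_pos (by omega)]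
    · rw [if_neg h, if_neg (by omega)]
  · simp [hk]

theorem hc_X0 (k : σ) (m : MvPolynomial σ R) : MvPolynomial.homogeneousComponent 0 (X k * m) = 0 := by
  classical
  rw [MvPolynomial.homogeneousComponent_zero, MvPolynomial.coeff_X_mul']; simp

theorem Dv_Pj {v : κ → MvPolynomial σ R} (hv : Lin v) (e : ℕ) (z : Finset κ → MvPolynomial σ R) :
    D v (Pj e z) = Pj (e+1) (D v z) := by
  ext1 T
  simp only [D_apply, Finset.sum_apply, Pj_apply, map_sum, Pi.smul_apply, smul_eq_mul]
  refine Finset.sum_congr rfl fun j _ => ?_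
  rcases hv j with h | ⟨k, h⟩
  · simp [h]
  · rw [h, hc_X]
    congr 1
    simp only [pa_apply]
    split_ifs
    · simp
    · rw [map_zsmul, Pj_apply]

theorem Dv_Pj0 {v : κ → MvPolynomial σ R} (hv : Lin v) (z : Finset κ → MvPolynomial σ R) :
    Pj 0 (D v z) = 0 := by
  ext1 T
  simp only [D_apply, Finset.sum_apply, Pj_apply, map_sum, Pi.smul_apply, smul_eq_mul]
  refine Finset.sum_eq_zero fun j _ => ?_
  rcases hv j with h | ⟨k, h⟩
  · simp [h]
  · rw [h, hc_X0]

/-- the approximation complex in internal degree `t` -/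
def Cc (σ : Type) [Fintype σ] (x : κ → R) (l : Finset κ) (t i : ℕ) : Submodule R (Finset κ → MvPolynomial σ R) where
  carrier := {z | z ∈ Sp (MvPolynomial σ R) (MvPolynomial σ R) l ∧ z ∈ Dg (MvPolynomial σ R) (MvPolynomial σ R) i ∧ D (uC σ x) z = 0 ∧
    ∀ T α, Finsupp.degree α + i ≠ t → coeff α (z T) = 0}
  zero_mem' := ⟨zero_mem _, zero_mem _, map_zero _, fun T α _ => by simp⟩
  add_mem' := by
    rintro a b ⟨h1, h2, h3, h4⟩ ⟨g1, g2, g3, g4⟩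
    exact ⟨add_mem h1 g1, add_mem h2 g2, by rw [map_add, h3, g3, add_zero], fun T α h => by simp [h4 T α h, g4 T α h]⟩
  smul_mem' := by
    rintro c a ⟨h1, h2, h3, h4⟩
    rw [← C_smul]
    refine ⟨Submodule.smul_mem _ _ h1, Submodule.smul_mem _ _ h2, by rw [map_smul, h3, smul_zero], fun T α h => by simp [h4 T α h]⟩

theorem Cc_Pj {x : κ → R} {l : Finset κ} {t i e : ℕ} {z : Finset κ → MvPolynomial σ R} (hz : z ∈ Cc σ x l t i) (h : e + i = t) : Pj e z = z := by
  ext T α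
  rw [Pj_apply, MvPolynomial.coeff_homogeneousComponent]
  split_ifs with h1
  · rfl
  · exact (hz.2.2.2 T α (by omega)).symm

theorem Pj_Sp {l : Finset κ} {z : Finset κ → MvPolynomial σ R} (hz : z ∈ Sp (MvPolynomial σ R) (MvPolynomial σ R) l) (e : ℕ) :
    Pj e z ∈ Sp (MvPolynomial σ R) (MvPolynomial σ R) l := by
  intro T hT
  rw [Pj_apply, hz T hT, map_zero]

theorem Pj_Dg {i : ℕ} {z : Finset κ → MvPolynomial σ R} (hz : z ∈ Dg (MvPolynomial σ R) (MvPolynomial σ R) i) (e : ℕ) :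
    Pj e z ∈ Dg (MvPolynomial σ R) (MvPolynomial σ R) i := by
  intro T hT
  rw [Pj_apply, hz T hT, map_zero]

theorem Pj_Cc {x : κ → R} {l : Finset κ} {t i e : ℕ} {z : Finset κ → MvPolynomial σ R} (h1 : z ∈ Sp (MvPolynomial σ R) (MvPolynomial σ R) l)
    (h2 : z ∈ Dg (MvPolynomial σ R) (MvPolynomial σ R) i) (h3 : D (uC σ x) z = 0) (h : e + i = t) : Pj e z ∈ Cc σ x l t i := by
  refine ⟨Pj_Sp h1 e, Pj_Dg h2 e, by rw [D_Pj, h3, map_zero], fun T α hα => ?_⟩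
  rw [Pj_apply, MvPolynomial.coeff_homogeneousComponent, if_neg (by omega)]

theorem sum_Pj (z : Finset κ → MvPolynomial σ R) : ∃ n, ∑ e ∈ Finset.range n, Pj e z = z := by
  refine ⟨(Finset.univ.sup fun T => (z T).totalDegree) + 1, ?_⟩
  ext1 T
  rw [Finset.sum_apply]
  simp only [Pj_apply]
  rw [← Finset.sum_subset (s₁ := Finset.range ((z T).totalDegree + 1))]
  · exact MvPolynomial.sum_homogeneousComponent (z T)
  · intro a ha
    have := Finset.le_sup (f := fun T => (z T).totalDegree) (Finset.mem_univ T)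
    simp at ha ⊢; omega
  · intro a _ ha
    exact MvPolynomial.homogeneousComponent_eq_zero _ _ (by simp at ha; omega)

theorem Cc_deg {x : κ → R} {l : Finset κ} {t i : ℕ} (h : t < i) {z : Finset κ → MvPolynomial σ R} (hz : z ∈ Cc σ x l t i) : z = 0 := by
  ext T α
  exact hz.2.2.2 T α (by omega)

theorem Cc_D {x : κ → R} {l : Finset κ} {t i : ℕ} {v : κ → MvPolynomial σ R} (hv : Lin v) {z : Finset κ → MvPolynomial σ R} (hz : z ∈ Cc σ x l t (i+1)) :
    D v z ∈ Cc σ x l t i := by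
  by_cases h : t < i + 1
  · rw [Cc_deg h hz, map_zero]; exact zero_mem _
  obtain ⟨e, he⟩ : ∃ e, e + (i + 1) = t := ⟨t - (i+1), by omega⟩
  rw [← Cc_Pj hz he, Dv_Pj hv]
  exact Pj_Cc (D_Sp v hz.1) (D_Dg v hz.2.1) (by rw [D_D_comm, hz.2.2.1, map_zero, neg_zero]) (by omega)

/-- homogenize a preimage -/
theorem Cc_lift {x : κ → R} {l : Finset κ} {t i : ℕ} {v : κ → MvPolynomial σ R} (hv : Lin v) {z w : Finset κ → MvPolynomial σ R}
    (hz : z ∈ Cc σ x l t i) (hw : w ∈ Sp (MvPolynomial σ R) (MvPolynomial σ R) l) (hwu : D (uC σ x) w = 0) (hwv : D v w = z) :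
    ∃ w' ∈ Cc σ x l t (i+1), D v w' = z := by
  by_cases h : t < i + 1
  · refine ⟨0, zero_mem _, ?_⟩
    rw [map_zero]
    by_cases h' : t < i
    · exact (Cc_deg h' hz).symm
    · rw [← Cc_Pj hz (show 0 + i = t by omega), ← hwv, Dv_Pj0 hv]
  obtain ⟨e, he⟩ : ∃ e, e + (i + 1) = t := ⟨t - (i+1), by omega⟩
  refine ⟨Pj e (pr (MvPolynomial σ R) (i+1) w), Pj_Cc (pr_Sp hw) (pr_Dg _ _) ?_ he, ?_⟩
  · rw [← pr_D, hwu, map_zero]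
  · rw [Dv_Pj hv, ← pr_D, hwv, pr_of_Dg hz.2.1, Cc_Pj hz (by omega)]

theorem exists_degs (i t : ℕ) : ∃ A : Finset (σ →₀ ℕ), ∀ α, α ∈ A ↔ α.degree + i = t := by
  classical
  by_cases h : i ≤ t
  · refine ⟨Finset.univ.finsuppAntidiag (t-i), fun α => ?_⟩
    rw [Finset.mem_finsuppAntidiag, Finsupp.degree_eq_sum]
    simp only [Finset.subset_univ, and_true]
    have : (Finset.univ.sum fun i => α i) = Finset.univ.sum α := rfl
    omega
  · refine ⟨∅, fun α => ?_⟩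
    simp; omega

theorem Cc_emb (x : κ → R) (l : Finset κ) (t i : ℕ) : ∃ (N : ℕ) (f : Cc σ x l t i →ₗ[R] (Fin N → Zm x l i)) (g : (Fin N → Zm x l i) →ₗ[R] Cc σ x l t i),
    ∀ z, g (f z) = z := by
  obtain ⟨A, hA⟩ := exists_degs (σ := σ) i t
  let e := A.equivFin
  let f : Cc σ x l t i →ₗ[R] (Fin A.card → Zm x l i) := LinearMap.pi fun n =>
    LinearMap.restrict (cf R (e.symm n).1) (by
      rintro z ⟨h1, h2, h3, h4⟩
      refine ⟨fun T hT => ?_, fun T hT => ?_, ?_⟩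
      · rw [cf_apply, h1 T hT]; rfl
      · rw [cf_apply, h2 T hT]; rfl
      · rw [SetLike.mem_coe, LinearMap.mem_ker, D_cf, h3, map_zero])
  let g : (Fin A.card → Zm x l i) →ₗ[R] Cc σ x l t i := LinearMap.lsum R (fun _ => Zm x l i) R fun n => 
    LinearMap.restrict (mo R (e.symm n).1) (by
      rintro z ⟨h1, h2, h3⟩
      refine ⟨fun T hT => ?_, fun T hT => ?_, ?_, fun T α hα => ?_⟩
      · rw [mo_apply, h1 T hT, map_zero]
      · rw [mo_apply, h2 T hT, map_zero]
      · rw [D_mo, LinearMap.mem_ker.1 h3, map_zero]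
      · classical
        rw [mo_apply, MvPolynomial.coeff_monomial, if_neg]
        intro h
        rw [← h] at hα
        exact hα ((hA _).1 (e.symm n).2))
  refine ⟨A.card, f, g, ?_⟩
  rintro ⟨z, hz⟩
  ext1
  have : (g (f ⟨z, hz⟩) : Finset κ → MvPolynomial σ R) = ∑ n, mo R (e.symm n).1 (cf R (e.symm n).1 z) := by
    simp only [g, LinearMap.lsum_apply, LinearMap.sum_apply, LinearMap.comp_apply, LinearMap.proj_apply, Submodule.coe_sum]
    rfl
  rw [this]
  ext1 T
  rw [Finset.sum_apply]
  simp only [mo_apply, cf_apply]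
  rw [e.symm.sum_comp (fun a : A => monomial a.1 (coeff a.1 (z T))), Finset.sum_coe_sort A (fun a => monomial a (coeff a (z T)))]
  classical
  ext β
  rw [MvPolynomial.coeff_sum]
  simp only [MvPolynomial.coeff_monomial, Finset.sum_ite_eq']
  split_ifs with h
  · rfl
  · exact (hz.2.2.2 T β fun h' => h ((hA β).2 h')).symm

theorem V_Cc (p : Ideal R) [hp : p.IsPrime] (x : κ → R) (l : Finset κ) (t i k : ℕ) (h : V p (Zm x l i) k) : V p (Cc σ x l t i) k := by
  obtain ⟨N, f, g, hfg⟩ := Cc_emb (σ := σ) x l t i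
  exact V_retract p f g 1 hp.one_notMem (by simp [hfg]) (V_pi p fun _ => h)

theorem Cc_fg [IsNoetherianRing R] (x : κ → R) (l : Finset κ) (t i : ℕ) : (Cc σ x l t i).FG := by
  obtain ⟨N, f, g, hfg⟩ := Cc_emb (σ := σ) x l t i
  rw [← Module.Finite.iff_fg]
  exact Module.Finite.of_surjective g (fun z => ⟨_, hfg z⟩)

end Cl
end S9

namespace S9
open CategoryTheory
open MvPolynomial (C X coeff monomial)

section LT
variable {ι : Type} [LinearOrder ι] [Fintype ι] {R : Type u} [CommRing R]

/-- the tautological functional -/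
abbrev vX (ι : Type) (R : Type u) [CommRing R] : ι → MvPolynomial ι R := fun j => X j

/-- degree zero element -/
def vc {σ : Type} (f : MvPolynomial σ R) : Finset ι → MvPolynomial σ R := Pi.single ∅ f

theorem vc_Dg {σ : Type} (f : MvPolynomial σ R) : (vc f : Finset ι → MvPolynomial σ R) ∈ Dg (MvPolynomial σ R) (MvPolynomial σ R) 0 := by
  intro T hT
  exact Pi.single_eq_of_ne (by rintro rfl; simp at hT) _

theorem vc_Sp {σ : Type} (f : MvPolynomial σ R) (l : Finset ι) : (vc f : Finset ι → MvPolynomial σ R) ∈ Sp (MvPolynomial σ R) (MvPolynomial σ R) l :=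
  Sp_of_Dg0 (vc_Dg f) l

theorem vc_of_Dg {σ : Type} {z : Finset ι → MvPolynomial σ R} (hz : z ∈ Dg (MvPolynomial σ R) (MvPolynomial σ R) 0) : z = vc (z ∅) := by
  ext1 T
  by_cases h : T = ∅
  · subst h; simp [vc]
  · rw [hz T (by simpa using h)]; simp [vc, h]

theorem vc_empty {σ : Type} (f : MvPolynomial σ R) : (vc f : Finset ι → MvPolynomial σ R) ∅ = f := by simp [vc]
theorem vc_smul {σ : Type} (a f : MvPolynomial σ R) : (a • vc f : Finset ι → MvPolynomial σ R) = vc (a * f) := by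
  ext1 T; by_cases h : T = ∅ 
  · subst h; simp [vc]
  · simp [vc, h]
theorem vc_add {σ : Type} (a f : MvPolynomial σ R) : (vc (a + f) : Finset ι → MvPolynomial σ R) = vc a + vc f := by
  ext1 T; by_cases h : T = ∅ 
  · subst h; simp [vc]
  · simp [vc, h]

/-- partial Rees evaluation -/
def ev (x : ι → R) (l : Finset ι) : MvPolynomial ι R →ₐ[R] MvPolynomial (Option ι) R :=
  MvPolynomial.aeval fun j => if j ∈ l then C (x j) * X none else X (some j)

theorem ev_X (x : ι → R) (l : Finset ι) (j : ι) : ev x l (X j) = if j ∈ l then C (x j) * X none else X (some j) := by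
  simp [ev]
theorem ev_C (x : ι → R) (l : Finset ι) (a : R) : ev x l (C a) = C a := by
  simp [ev]

theorem D_empty {σ : Type} (v : ι → MvPolynomial σ R) (w : Finset ι → MvPolynomial σ R) : D v w ∅ = ∑ j, v j * w {j} := by
  simp [D_apply, pa_apply, sg]

theorem ev_D {x : ι → R} {l : Finset ι} {w : Finset ι → MvPolynomial ι R}
    (hw : w ∈ Sp (MvPolynomial ι R) (MvPolynomial ι R) l) (h : D (uC ι x) w = 0) : ev x l (D (vX ι R) w ∅) = 0 := by
  have h1 := congrArg (ev x l) (congrFun h ∅)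
  rw [D_empty, Pi.zero_apply, map_zero, map_sum] at h1
  rw [D_empty, map_sum]
  calc _ = ∑ j, X none * (ev x l (uC ι x j * w {j})) := by
        refine Finset.sum_congr rfl fun j _ => ?_
        by_cases hj : j ∈ l
        · rw [map_mul, map_mul, ev_X, if_pos hj, ev_C]; ring
        · rw [hw {j} (by simpa using hj)]; simp
    _ = 0 := by rw [← Finset.mul_sum, h1, mul_zero]

theorem nzd_lin {τ : Type} (b n : τ) (hbn : b ≠ n) (a : R) (g : MvPolynomial τ R) (h : (X b - C a * X n) * g = 0) : g = 0 := by
  classical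
  have key : ∀ k α, α n = k → coeff α g = 0 := by
    intro k
    induction k with
    | zero =>
      intro α hα
      have := congrArg (coeff (α + Finsupp.single b 1)) h
      rw [sub_mul, MvPolynomial.coeff_sub, mul_comm (X b), MvPolynomial.coeff_mul_X, mul_assoc, MvPolynomial.coeff_C_mul, MvPolynomial.coeff_X_mul', if_neg] at this
      · simpa using this
      · simp [hα, hbn]
    | succ k ih =>
      intro α hα
      have := congrArg (coeff (α + Finsupp.single b 1)) h
      rw [sub_mul, MvPolynomial.coeff_sub, mul_comm (X b), MvPolynomial.coeff_mul_X, mul_assoc, MvPolynomial.coeff_C_mul, MvPolynomial.coeff_X_mul', if_pos] at this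
      · rw [ih (α + Finsupp.single b 1 - Finsupp.single n 1) (by rw [Finsupp.tsub_apply, Finsupp.add_apply, hα]; simp [hbn, hbn.symm])] at this
        simpa using this
      · simp [hα]
  ext α
  exact key _ α rfl

variable (p : Ideal R) 

/-- exactness claim -/
def EX (x : ι → R) (l : Finset ι) : Prop := ∀ i, ∀ z : Finset ι → MvPolynomial ι R, z ∈ Sp (MvPolynomial ι R) (MvPolynomial ι R) l →
  z ∈ Dg (MvPolynomial ι R) (MvPolynomial ι R) (i+1) → D (uC ι x) z = 0 → D (vX ι R) z = 0 →
  ∃ s ∉ p, ∃ w ∈ Sp (MvPolynomial ι R) (MvPolynomial ι R) l, D (uC ι x) w = 0 ∧ D (vX ι R) w = (C s : MvPolynomial ι R) • z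

/-- equation claim -/
def QZ (x : ι → R) (l : Finset ι) : Prop := ∀ f, ev x l f = 0 → 
  ∃ s ∉ p, ∃ w ∈ Sp (MvPolynomial ι R) (MvPolynomial ι R) l, D (uC ι x) w = 0 ∧ D (vX ι R) w = (C s : MvPolynomial ι R) • vc f

variable [hp : p.IsPrime]

theorem mul_nmem {s t : R} (hs : s ∉ p) (ht : t ∉ p) : s * t ∉ p := fun h => (hp.mem_or_mem h).elim hs ht

theorem EX_step {x : ι → R} {l : Finset ι} {b : ι} (hb : b ∉ l) (hl : PG p x l) (hE : EX p x l) (hQ : QZ p x l) : EX p x (insert b l) := by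
  intro i z hz hzi hzu hzv
  obtain ⟨s0, hs0, c, hc, h2⟩ := hl b
  have hu : (C s0 : MvPolynomial ι R) * uC ι x b = ∑ j, uC ι x j * uC ι c j := by
    simp only [uC, ← map_mul, ← map_sum, h2]
  have hcC : ∀ j ∉ l, uC ι c j = 0 := fun j hj => by simp [uC, hc j hj]
  set g := pa (MvPolynomial ι R) b z with hg
  set f' := (C s0 : MvPolynomial ι R) • pa (MvPolynomial ι R) b (we (MvPolynomial ι R) b z) + W (uC ι c) g with hf'
  have hgS := g_Sp hz hb
  have hf'S : f' ∈ Sp (MvPolynomial ι R) (MvPolynomial ι R) l :=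
    add_mem (Submodule.smul_mem _ _ (f_Sp hz hb)) (W_Sp hcC hgS)
  have hf'D : f' ∈ Dg (MvPolynomial ι R) (MvPolynomial ι R) (i+1) :=
    add_mem (Submodule.smul_mem _ _ (pa_Dg b (we_Dg b hzi))) (W_Dg _ (pa_Dg b hzi))
  have hgu := step_g (b := b) (uC ι x) z hzu
  have hgv := step_g (b := b) (vX ι R) z hzv
  have hf'u := step_f' (b := b) (uC ι x) (uC ι c) (C s0) z hzu
  have hf'v := step_f' (b := b) (vX ι R) (uC ι c) (C s0) z hzv
  rw [hu, sub_self, zero_smul, neg_zero] at hf'u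
  set Tb : MvPolynomial ι R := C s0 * X b - ∑ j, X j * uC ι c j with hTb
  obtain ⟨s1, hs1, g', hg'S, hg'D, hg'u, hg'v⟩ : ∃ s1 ∉ p, ∃ g' ∈ Sp (MvPolynomial ι R) (MvPolynomial ι R) l,
      g' ∈ Dg (MvPolynomial ι R) (MvPolynomial ι R) (i+1) ∧ D (uC ι x) g' = 0 ∧ D (vX ι R) g' = (C s1 : MvPolynomial ι R) • g := by
    obtain ⟨s1, hs1, g', hg'S, hg'u, hg'v⟩ : ∃ s1 ∉ p, ∃ g' ∈ Sp (MvPolynomial ι R) (MvPolynomial ι R) l,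
        D (uC ι x) g' = 0 ∧ D (vX ι R) g' = (C s1 : MvPolynomial ι R) • g := by
      cases i with
      | succ i => exact hE i g hgS (pa_Dg b hzi) hgu hgv
      | zero =>
        have hg0 : g = vc (g ∅) := vc_of_Dg (pa_Dg b hzi)
        have h3 := ev_D hf'S hf'u
        rw [hf'v] at h3
        change ev x l (-(Tb * g ∅)) = 0 at h3
        have h4 : ev x l Tb = C s0 * (X (some b) - C (x b) * X none) := by
          rw [hTb, map_sub, map_mul, ev_C, ev_X, if_neg hb, mul_sub, map_sum]
          congr 1
          rw [← mul_assoc, ← map_mul, h2, map_sum, Finset.sum_mul]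
          refine Finset.sum_congr rfl fun j _ => ?_
          by_cases hj : j ∈ l
          · rw [map_mul, ev_X, if_pos hj, ev_C, map_mul]; ring
          · simp [uC, hc j hj]
        rw [map_neg, neg_eq_zero, map_mul, h4, mul_comm (C s0), mul_assoc] at h3
        have h5 := nzd_lin _ _ (by simp) _ _ h3
        obtain ⟨s, hs, w, hw, hwu, hwv⟩ := hQ (C s0 * g ∅) (by rw [map_mul, ev_C, h5])
        refine ⟨s * s0, mul_nmem p hs hs0, w, hw, hwu, ?_⟩
        rw [hwv, ← vc_smul, ← hg0, smul_smul, map_mul]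
    refine ⟨s1, hs1, pr _ (i+1) g', pr_Sp hg'S, pr_Dg _ _, by rw [← pr_D, hg'u, map_zero], ?_⟩
    rw [← pr_D, hg'v, pr_of_Dg (Submodule.smul_mem _ _ (pa_Dg b hzi))]
  obtain ⟨s2, hs2, w1, hw1S, hw1u, hw1v⟩ := hE i ((C s1 : MvPolynomial ι R) • f' + Tb • g')
    (add_mem (Submodule.smul_mem _ _ hf'S) (Submodule.smul_mem _ _ hg'S))
    (add_mem (Submodule.smul_mem _ _ hf'D) (Submodule.smul_mem _ _ hg'D))
    (by rw [map_add, map_smul, map_smul, hf'u, hg'u, smul_zero, smul_zero, add_zero])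
    (by rw [map_add, map_smul, map_smul, hf'v, hg'v, smul_neg, smul_comm, neg_add_cancel])
  have := step_id (l := l) (uC ι x) (vX ι R) (uC ι c) (C s0) hu z g' w1 0 (C s1) (C s2) hzu hzv hg'u hg'v (by rw [hw1v, zero_add]) hw1u
  refine ⟨s2 * s0 * s1, mul_nmem p (mul_nmem p hs2 hs0) hs1, _, ?_, this.1, ?_⟩
  · exact add_mem (Submodule.smul_mem _ _ (sub_mem (Sp_mono (Finset.subset_insert _ _) (W_Sp hcC hg'S)) (Submodule.smul_mem _ _ (we_Sp b hg'S)))) (Sp_mono (Finset.subset_insert _ _) hw1S)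
  · rw [this.2, sub_zero, map_mul, map_mul]

theorem QZ_step {x : ι → R} {l : Finset ι} {b : ι} (hb : b ∉ l) (hl : PG p x l) (hQ : QZ p x l) : QZ p x (insert b l) := by
  obtain ⟨s0, hs0, c, hc, h2⟩ := hl b
  set Tb : MvPolynomial ι R := C s0 * X b - ∑ j, X j * uC ι c j with hTb
  have hSum : (∑ j, X j * uC ι c j : MvPolynomial ι R) ∈ AlgHom.equalizer (ev x l) (ev x (insert b l)) := by
    refine Subalgebra.sum_mem _ fun j _ => ?_
    rw [AlgHom.mem_equalizer, map_mul, map_mul, ev_C, ev_C, ev_X, ev_X]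
    by_cases hj : j ∈ l
    · simp [hj]
    · simp [hc j hj]
  have hdiv : ∀ f : MvPolynomial ι R, ∃ (N : ℕ) (q f1 : MvPolynomial ι R), f1 ∈ AlgHom.equalizer (ev x l) (ev x (insert b l)) ∧
      C s0 ^ N * f = Tb * q + f1 := by
    intro f
    induction f using MvPolynomial.induction_on with
    | C a => exact ⟨0, 0, C a, by rw [AlgHom.mem_equalizer, ev_C, ev_C], by simp⟩
    | add f g hf hg =>
      obtain ⟨N, q, f1, h1, h2⟩ := hf
      obtain ⟨N', q', f1', h1', h2'⟩ := hg
      have hCs : ∀ n : ℕ, (C s0 ^ n : MvPolynomial ι R) ∈ AlgHom.equalizer (ev x l) (ev x (insert b l)) := fun n => by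
        rw [AlgHom.mem_equalizer, map_pow, map_pow, ev_C, ev_C]
      refine ⟨N + N', C s0 ^ N' * q + C s0 ^ N * q', C s0 ^ N' * f1 + C s0 ^ N * f1', add_mem (mul_mem (hCs _) h1) (mul_mem (hCs _) h1'), ?_⟩
      linear_combination (C s0 ^ N') * h2 + C s0 ^ N * h2'
    | mul_X f k hf =>
      obtain ⟨N, q, f1, h1, h2⟩ := hf
      by_cases hk : k = b
      · subst hk
        refine ⟨N + 1, C s0 * X k * q + f1, f1 * (∑ j, X j * uC ι c j), mul_mem h1 hSum, ?_⟩
        linear_combination (C s0 * X k) * h2 - f1 * hTb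
      · refine ⟨N, q * X k, f1 * X k, mul_mem h1 ?_, ?_⟩
        · rw [AlgHom.mem_equalizer, ev_X, ev_X]; simp [hk]
        · linear_combination (X k) * h2
  intro f hf
  obtain ⟨N, q, f1, h1, h3⟩ := hdiv f
  have hT0 : ev x (insert b l) Tb = 0 := by
    rw [hTb, map_sub, map_mul, ev_C, ev_X, if_pos (Finset.mem_insert_self _ _), ← mul_assoc, ← map_mul, h2, map_sum, map_sum, Finset.sum_mul, sub_eq_zero]
    refine Finset.sum_congr rfl fun j _ => ?_
    by_cases hj : j ∈ l
    · rw [map_mul C, map_mul (ev x (insert b l)), ev_X, if_pos (Finset.mem_insert_of_mem hj), ev_C]; ring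
    · simp [uC, hc j hj]
  have h4 := congrArg (ev x (insert b l)) h3
  rw [map_mul, hf, mul_zero, map_add, map_mul, hT0, zero_mul, zero_add, ← AlgHom.mem_equalizer _ _ _ |>.1 h1] at h4
  obtain ⟨s, hs, w, hwS, hwu, hwv⟩ := hQ f1 h4.symm
  let c' : ι → MvPolynomial ι R := fun j => (if j = b then C s0 else 0) - uC ι c j
  have hsumv : ∀ y : ι → MvPolynomial ι R, ∑ j, y j * c' j = C s0 * y b - ∑ j, y j * uC ι c j := by
    intro y
    simp [c', mul_sub, mul_comm]
  refine ⟨s * s0 ^ N, mul_nmem p hs fun h => hs0 (hp.mem_of_pow_mem _ h), w + W c' ((C s : MvPolynomial ι R) • vc q), ?_, ?_, ?_⟩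
  · refine add_mem (Sp_mono (Finset.subset_insert _ _) hwS) (W_Sp (fun j hj => ?_) (Submodule.smul_mem _ _ (vc_Sp _ _)))
    simp only [Finset.mem_insert, not_or] at hj
    simp [c', hj.1, uC, hc j hj.2]
  · rw [map_add, hwu, D_W, hsumv, map_smul, D_Dg0 _ (vc_Dg q), smul_zero, map_zero, sub_zero, zero_add]
    have : (C s0 : MvPolynomial ι R) * uC ι x b - ∑ j, uC ι x j * uC ι c j = 0 := by
      simp only [uC, ← map_mul, ← map_sum, h2, sub_self]
    rw [this, zero_smul]
  · rw [map_add, hwv, D_W, hsumv, map_smul, D_Dg0 _ (vc_Dg q), smul_zero, map_zero, sub_zero, vc_smul, vc_smul, vc_smul, vc_smul, ← vc_add]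
    congr 1
    rw [map_mul, map_pow, mul_assoc, h3]; ring

end LT
end S9

namespace S9
open CategoryTheory
open MvPolynomial (C X coeff monomial)

section LTm
variable {ι : Type} [LinearOrder ι] [Fintype ι] {R : Type u} [CommRing R]

theorem ev_hc (x : ι → R) (l : Finset ι) (e : ℕ) (f : MvPolynomial ι R) :
    MvPolynomial.homogeneousComponent e (ev x l f) = ev x l (MvPolynomial.homogeneousComponent e f) := by
  have hh : ∀ n, (ev x l (MvPolynomial.homogeneousComponent n f)).IsHomogeneous n := by
    intro n
    have := (MvPolynomial.homogeneousComponent_isHomogeneous n f).aeval (n := 1) (fun j : ι => if j ∈ l then C (x j) * X none else X (some j) : ι → MvPolynomial (Option ι) R) (by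
      intro j
      split_ifs
      · exact MvPolynomial.IsHomogeneous.C_mul (MvPolynomial.isHomogeneous_X _ _) _
      · exact MvPolynomial.isHomogeneous_X _ _)
    rw [one_mul] at this
    exact this
  conv_lhs => rw [← MvPolynomial.sum_homogeneousComponent f, map_sum, map_sum]
  have : ∀ n, MvPolynomial.homogeneousComponent e (ev x l (MvPolynomial.homogeneousComponent n f)) = if n = e then ev x l (MvPolynomial.homogeneousComponent n f) else 0 := by
    intro n
    rw [MvPolynomial.homogeneousComponent_of_mem (hh n)]
    simp [eq_comm]
  simp only [this, Finset.sum_ite_eq', Finset.mem_range]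
  split_ifs with h
  · rfl
  · rw [MvPolynomial.homogeneousComponent_eq_zero _ _ (by omega), map_zero]

theorem vX_Lin : Lin (vX ι R) := fun j => Or.inr ⟨j, rfl⟩

/-- the second differential over the base -/
abbrev dv (σ : Type) {κ : Type} [LinearOrder κ] [Fintype κ] (v : κ → MvPolynomial σ R) : (Finset κ → MvPolynomial σ R) →ₗ[R] (Finset κ → MvPolynomial σ R) :=
  (D v).restrictScalars R

variable (p : Ideal R)

/-- locally a boundary -/
def LB (x : ι → R) (l : Finset ι) (z : Finset ι → MvPolynomial ι R) : Prop :=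
  ∃ s ∉ p, ∃ w ∈ Sp (MvPolynomial ι R) (MvPolynomial ι R) l, D (uC ι x) w = 0 ∧ D (vX ι R) w = (C s : MvPolynomial ι R) • z

variable [hp : p.IsPrime]

theorem LB_sum {x : ι → R} {l : Finset ι} {A : Type} (t : Finset A) (z : A → Finset ι → MvPolynomial ι R)
    (h : ∀ a ∈ t, LB p x l (z a)) : LB p x l (∑ a ∈ t, z a) := by
  refine Finset.sum_induction z (LB p x l) ?_ ?_ h
  · rintro z z' ⟨s, hs, w, h1, h2, h3⟩ ⟨s', hs', w', h1', h2', h3'⟩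
    refine ⟨s * s', mul_nmem p hs hs', (C s' : MvPolynomial ι R) • w + (C s : MvPolynomial ι R) • w', add_mem (Submodule.smul_mem _ _ h1) (Submodule.smul_mem _ _ h1'), ?_, ?_⟩
    · rw [map_add, map_smul, map_smul, h2, h2', smul_zero, smul_zero, add_zero]
    · rw [map_add, map_smul, map_smul, h3, h3', smul_smul, smul_smul, smul_add, map_mul, mul_comm (C s')]
  · exact ⟨1, hp.one_notMem, 0, zero_mem _, map_zero _, by simp⟩

theorem EX_of_Cc {x : ι → R} {l : Finset ι} (h : ∀ t i, 1 ≤ i → ExAt (dv ι (vX ι R)) (Cc ι x l t) p i) : EX p x l := by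
  intro i z hz hzi hzu hzv
  change LB p x l z
  obtain ⟨n, hn⟩ := sum_Pj z
  rw [← hn]
  refine LB_sum p _ _ fun e _ => ?_
  obtain ⟨s, hs, w, hw, hwv⟩ := h (e + (i+1)) (i+1) (by omega) (Pj e z) (Pj_Cc hz hzi hzu rfl) (by
    change D (vX ι R) _ = 0
    rw [Dv_Pj vX_Lin, hzv, map_zero])
  exact ⟨s, hs, w, hw.1, hw.2.2.1, by rw [C_smul]; exact hwv⟩

theorem Cc_of_EX {x : ι → R} {l : Finset ι} (h : EX p x l) (t i : ℕ) (hi : 1 ≤ i) : ExAt (dv ι (vX ι R)) (Cc ι x l t) p i := by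
  intro z hz hzv
  obtain ⟨i, rfl⟩ : ∃ j, i = j + 1 := ⟨i - 1, by omega⟩
  obtain ⟨s, hs, w, h1, h2, h3⟩ := h i z hz.1 hz.2.1 hz.2.2.1 hzv
  rw [C_smul] at h3
  obtain ⟨w', hw', h4⟩ := Cc_lift vX_Lin ((Cc ι x l t (i+1)).smul_mem s hz) h1 h2 h3
  exact ⟨s, hs, w', hw', h4⟩

/-- equations in degree t -/
def Xt (x : ι → R) (l : Finset ι) (t : ℕ) : Submodule R (Finset ι → MvPolynomial ι R) :=
  Cc ι x l t 0 ⊓ LinearMap.ker ((ev x l).toLinearMap ∘ₗ (LinearMap.proj (∅ : Finset ι) : (Finset ι → MvPolynomial ι R) →ₗ[R] MvPolynomial ι R))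

theorem mem_Xt {x : ι → R} {l : Finset ι} {t : ℕ} {z} : z ∈ Xt x l t ↔ z ∈ Cc ι x l t 0 ∧ ev x l (z ∅) = 0 := Iff.rfl

theorem QZ_of_Cc {x : ι → R} {l : Finset ι} (h : ∀ t, ∀ z ∈ Xt x l t, ∃ s ∉ p, ∃ w ∈ Cc ι x l t 1, dv ι (vX ι R) w = s • z) : QZ p x l := by
  intro f hf
  change LB p x l (vc f)
  obtain ⟨n, hn⟩ := sum_Pj (vc f : Finset ι → MvPolynomial ι R)
  rw [← hn]
  refine LB_sum p _ _ fun e _ => ?_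
  obtain ⟨s, hs, w, hw, hwv⟩ := h e (Pj e (vc f)) (by
    refine ⟨Pj_Cc (vc_Sp _ _) (vc_Dg _) (D_Dg0 _ (vc_Dg _)) rfl, ?_⟩
    change ev x l (Pj e (vc f) ∅) = 0
    rw [Pj_apply, vc_empty, ← ev_hc, hf, map_zero])
  exact ⟨s, hs, w, hw.1, hw.2.2.1, by rw [C_smul]; exact hwv⟩

theorem Cc_of_QZ {x : ι → R} {l : Finset ι} (h : QZ p x l) (t : ℕ) : ∀ z ∈ Xt x l t, ∃ s ∉ p, ∃ w ∈ Cc ι x l t 1, dv ι (vX ι R) w = s • z := by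
  rintro z ⟨hz, hze⟩
  obtain ⟨s, hs, w, h1, h2, h3⟩ := h (z ∅) hze
  rw [C_smul, ← vc_of_Dg hz.2.1] at h3
  obtain ⟨w', hw', h4⟩ := Cc_lift vX_Lin ((Cc ι x l t 0).smul_mem s hz) h1 h2 h3
  exact ⟨s, hs, w', hw', h4⟩

theorem EX_base {x : ι → R} {j : ι} (hj : x j ∉ p) : EX p x {j} := by
  intro i z hz hzi hzu hzv
  refine ⟨x j, hj, 0, zero_mem _, map_zero _, ?_⟩
  rw [map_zero, C_smul]
  ext1 T
  have h0 := congrFun hzu ∅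
  rw [D_empty, Finset.sum_eq_single j] at h0
  rotate_left
  · intro b _ hb; rw [hz {b} (by simpa using hb), mul_zero]
  · simp
  by_cases hT : T = {j}
  · subst hT
    rw [Pi.smul_apply, MvPolynomial.smul_eq_C_mul]; exact h0.symm
  · rw [Pi.smul_apply]
    by_cases h : T ⊆ {j}
    · rcases Finset.subset_singleton_iff.1 h with h | h
      · rw [hzi T (by simp [h])]; simp
      · exact absurd h hT
    · rw [hz T h]; simp

theorem QZ_base {x : ι → R} {j : ι} (hj : x j ∉ p) : QZ p x {j} := by
  intro f hf
  let φ : MvPolynomial (Option ι) R →ₐ[R] MvPolynomial ι R := MvPolynomial.aeval fun k => k.elim (X j) X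
  have hφ : ∀ f α, coeff α (φ (ev x {j} f)) = x j ^ (α j) * coeff α f := by
    intro f
    induction f using MvPolynomial.induction_on with
    | C a =>
      intro α
      rw [ev_C]
      simp only [φ, MvPolynomial.algHom_C, MvPolynomial.algebraMap_eq, MvPolynomial.coeff_C]
      split_ifs with h
      · subst h; simp
      · simp
    | add f g hf hg => intro α; rw [map_add, map_add, MvPolynomial.coeff_add, hf, hg, MvPolynomial.coeff_add, mul_add]
    | mul_X f k hf =>
      intro α
      have h1 : φ (ev x {j} (X k)) = C (if k = j then x j else 1) * X k := by
        rw [ev_X]; by_cases h : k = j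
        · subst h; simp [φ]
        · simp [φ, h]
      rw [map_mul, map_mul, h1, mul_left_comm, MvPolynomial.coeff_C_mul, MvPolynomial.coeff_mul_X', MvPolynomial.coeff_mul_X']
      split_ifs with h h2 h2
      · subst h
        rw [hf, Finsupp.tsub_apply, Finsupp.single_eq_same, ← mul_assoc, ← pow_succ', Nat.sub_add_cancel (by have := Finsupp.mem_support_iff.1 h2; omega)]
      · simp
      · rw [hf, Finsupp.tsub_apply, Finsupp.single_eq_of_ne (Ne.symm h), one_mul, Nat.sub_zero]
      · simp
  refine ⟨x j ^ (f.support.sup fun α => α j), fun h => hj (hp.mem_of_pow_mem _ h), 0, zero_mem _, map_zero _, ?_⟩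
  rw [map_zero, vc_smul]
  have : C (x j ^ (f.support.sup fun α => α j)) * f = 0 := by
    ext α
    rw [MvPolynomial.coeff_C_mul, MvPolynomial.coeff_zero]
    by_cases h : α ∈ f.support
    · have h2 := hφ f α
      rw [hf, map_zero, MvPolynomial.coeff_zero] at h2
      obtain ⟨c, hc⟩ := Nat.exists_eq_add_of_le (Finset.le_sup (f := fun α : ι →₀ ℕ => α j) h)
      rw [hc, add_comm, pow_add, mul_assoc, ← h2, mul_zero]
    · rw [MvPolynomial.notMem_support_iff.1 h, mul_zero]
  rw [this]; ext1 T; simp [vc]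

/-- grow a generating set -/
theorem grow {x : ι → R} {l0 l : Finset ι} (hl0 : PG p x l0) (hs : l0 ⊆ l) (h : EX p x l0 ∧ QZ p x l0) : EX p x l ∧ QZ p x l := by
  have : ∀ t : Finset ι, EX p x (t ∪ l0) ∧ QZ p x (t ∪ l0) := by
    intro t
    induction t using Finset.induction_on with
    | empty => simpa using h
    | insert b t hb ih =>
      by_cases hb' : b ∈ t ∪ l0
      · rw [Finset.insert_union, Finset.insert_eq_of_mem hb']; exact ih
      · have hg := PG_mono p (Finset.subset_union_right (s₁ := t)) hl0
        rw [Finset.insert_union]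
        exact ⟨EX_step p hb' hg ih.1 ih.2, QZ_step p hb' hg ih.2⟩
  have h2 := this l
  rwa [Finset.union_eq_left.2 hs] at h2

theorem top_kill {σ : Type} [Fintype σ] {x : ι → R} {l : Finset ι} (hl : PG p x l) {a : R} (ha : a ∈ Ideal.span (Set.range x)) (hn : a ∈ nonZeroDivisors R) {i : ℕ} (hi : l.card ≤ i)
    {z : Finset ι → MvPolynomial σ R} (h1 : z ∈ Sp (MvPolynomial σ R) (MvPolynomial σ R) l) (h2 : z ∈ Dg (MvPolynomial σ R) (MvPolynomial σ R) i)
    (h3 : D (uC σ x) z = 0) : ∃ s ∉ p, s • z = 0 := by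
  have hj : ∀ j ∈ l, x j • z = 0 := by
    intro j hj
    have hw : we (MvPolynomial σ R) j z = 0 := by
      ext1 T
      rw [we_apply]
      split_ifs with hT
      · by_cases hsub : T.erase j ⊆ l
        · rw [h2 _ (by
            have := Finset.card_lt_card (Finset.ssubset_iff_subset_ne.2 ⟨hsub, fun h => Finset.notMem_erase j T (h ▸ hj)⟩)
            omega)]; simp
        · rw [h1 _ hsub]; simp
      · rfl
    have := D_we (uC σ x) j z
    rw [hw, h3, map_zero, map_zero, sub_zero] at this
    rw [← C_smul]; exact this.symm
  choose s hs c hc hx using hl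
  have hb : ∀ b, (s b * x b) • z = 0 := by
    intro b
    rw [hx, Finset.sum_smul]
    refine Finset.sum_eq_zero fun j _ => ?_
    by_cases h : j ∈ l
    · rw [mul_comm, mul_smul, hj j h, smul_zero]
    · rw [hc b j h, mul_zero, zero_smul]
  have hall : ∀ y ∈ Ideal.span (Set.range x), ((∏ b, s b) * y) • z = 0 := by
    intro y hy
    refine Submodule.span_induction ?_ ?_ ?_ ?_ hy
    · rintro _ ⟨b, rfl⟩
      rw [← Finset.prod_erase_mul _ _ (Finset.mem_univ b), mul_assoc, mul_smul, hb, smul_zero]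
    · simp
    · intro u v _ _ hu hv; rw [mul_add, add_smul, hu, hv, add_zero]
    · intro r u _ hu; rw [smul_eq_mul, mul_left_comm, mul_smul, hu, smul_zero]
  refine ⟨∏ b, s b, fun h => ?_, ?_⟩
  · obtain ⟨b, _, hb⟩ := hp.prod_mem_iff.1 h
    exact hs b hb
  · have := hall a ha
    ext T α
    have h4 := congrArg (coeff α) (congrFun this T)
    simp only [Pi.smul_apply, MvPolynomial.coeff_smul, Pi.zero_apply, MvPolynomial.coeff_zero, smul_eq_mul] at h4 ⊢
    rw [mul_comm _ a, mul_assoc] at h4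
    exact (mem_nonZeroDivisors_iff.1 hn).1 _ h4

theorem LT_main [IsNoetherianRing R] {x : ι → R} {a : R} (ha : a ∈ Ideal.span (Set.range x)) (hn : a ∈ nonZeroDivisors R)
    (hG : ∀ q : Ideal R, q.IsPrime → q ≤ p → Gd q) (hZ : ∀ i k, 0 < k → V p (Zm x Finset.univ i) k)
    (hg : ∀ q : Ideal R, q.IsPrime → q ≤ p → (∀ j, x j ∈ q) → ∀ l, PG q x l → ∃ l0 ⊆ l, PG q x l0 ∧ l0.card ≤ ht q)
    (l : Finset ι) (hl : PG p x l) : EX p x l ∧ QZ p x l := by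
  have : ∀ n, ∀ q : Ideal R, q.IsPrime → q ≤ p → ht q = n → ∀ l, PG q x l → EX q x l ∧ QZ q x l := by
    intro n
    induction n using Nat.strong_induction_on with
    | _ n ih =>
      intro q hq hqp hn' l hl
      by_cases hx : ∀ j, x j ∈ q
      · obtain ⟨l0, hl0, hP, hc⟩ := hg q hq hqp hx l hl
        refine grow q hP hl0 ?_
        have hm : l0.card ≠ 0 := by
          intro h0
          obtain ⟨s, hs, h⟩ := top_kill (σ := ι) q hP ha hn (i := 0) (by omega) (vc_Sp 1 l0) (vc_Dg 1) (D_Dg0 _ (vc_Dg 1))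
          have h1 := congrFun h ∅
          rw [Pi.smul_apply, vc_empty, MvPolynomial.smul_eq_C_mul, mul_one, Pi.zero_apply, MvPolynomial.C_eq_zero] at h1
          exact hs (h1 ▸ q.zero_mem)
        have hA : ∀ t i k, 0 < k → V q (Cc ι x l0 t i) k := fun t i k hk => V_Cc q x l0 t i k (V_Z_sub q x hP i k (V_mono hqp (hZ i k hk)))
        have hNN : ∀ t i, l0.card - 1 < i → ∀ z ∈ Cc ι x l0 t i, ∃ s ∉ q, s • z = 0 := fun t i hi z hz =>
          top_kill q hP ha hn (by omega) hz.1 hz.2.1 hz.2.2.1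
        have hacy : ∀ t i, 1 ≤ i → ExAt (dv ι (vX ι R)) (Cc ι x l0 t) q i := fun t =>
          acy (dv ι (vX ι R)) (Cc ι x l0 t) (fun z => D_D _ z) (fun i z hz => Cc_D vX_Lin hz) (fun i => Cc_fg x l0 t i) q (hG q hq hqp)
            (hA t) (hNN t) (by omega) (fun q' hq' hlt i hi => by
              refine Cc_of_EX q' (ih _ (by have := ht_lt hlt; omega) q' hq' (hlt.le.trans hqp) rfl l0 (PG_le q hlt.le hP)).1 t i hi)
        refine ⟨EX_of_Cc q hacy, QZ_of_Cc q fun t => ?_⟩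
        exact acy0 (dv ι (vX ι R)) (Cc ι x l0 t) (fun z => D_D _ z) (fun i z hz => Cc_D vX_Lin hz) (fun i => Cc_fg x l0 t i) q (hG q hq hqp)
            (hA t) (hNN t) (by omega) (hacy t) (Xt x l0 t) inf_le_left (fun q' hq' hlt => 
              Cc_of_QZ q' (ih _ (by have := ht_lt hlt; omega) q' hq' (hlt.le.trans hqp) rfl l0 (PG_le q hlt.le hP)).2 t)
      · push Not at hx
        obtain ⟨b, hb⟩ := hx
        obtain ⟨s, hs, c, hc, h⟩ := hl b
        obtain ⟨j, hj⟩ : ∃ j ∈ l, x j ∉ q := by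
          by_contra hcon
          push Not at hcon
          refine mul_nmem q hs hb ?_
          rw [h]
          refine sum_mem fun j _ => ?_
          by_cases hjl : j ∈ l
          · exact q.mul_mem_right _ (hcon j hjl)
          · rw [hc j hjl, mul_zero]; exact zero_mem _
        refine grow q (l0 := {j}) ?_ (by simpa using hj.1) ⟨EX_base q hj.2, QZ_base q hj.2⟩
        intro b
        refine ⟨x j, hj.2, Pi.single j (x b), fun k hk => Pi.single_eq_of_ne (by simpa using hk) _, ?_⟩
        rw [Finset.sum_eq_single j (fun k _ hk => by rw [Pi.single_eq_of_ne hk, mul_zero]) (by simp), Pi.single_eq_same]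
  exact this _ p hp le_rfl rfl l hl

end LTm
end S9

namespace S9
open CategoryTheory
open MvPolynomial (C X coeff monomial)

section RL
variable {ι : Type} [Fintype ι] {R : Type u} [CommRing R]

/-- integrality of all variables modulo the linear relations forces local equality -/
theorem red_loc (p : Ideal R) [hp : p.IsPrime] (x : ι → R) (J : Ideal R)
    (h : ∀ j, ∃ s ∉ p, ∃ N, ∃ w : ι → MvPolynomial ι R, C s * X j ^ N = ∑ k, w k * X k ∧ ∀ α, ∑ k, coeff α (w k) * x k ∈ J) :
    ∃ s ∉ p, ∀ j, s * x j ∈ J := by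
  classical
  let φ : (ι → R) →ₗ[R] R := ∑ k, x k • LinearMap.proj k
  have hφ : ∀ c, φ c = ∑ k, c k * x k := fun c => by simp [φ, mul_comm]
  let N : Submodule R (ι → R) := Submodule.comap φ J
  let M := (ι → R) ⧸ N
  have hN : ∀ c : ι → R, c ∈ N ↔ ∑ k, c k * x k ∈ J := fun c => by
    rw [← hφ]; exact Iff.rfl
  by_contra hcon
  push Not at hcon
  have hann : Module.annihilator R M ≤ p := by
    intro s hs
    by_contra hsp
    obtain ⟨j, hj⟩ := hcon s hsp
    have h1 : s • (Submodule.Quotient.mk (Pi.single j 1) : M) = 0 := Module.mem_annihilator.1 hs _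
    rw [← Submodule.Quotient.mk_smul, Submodule.Quotient.mk_eq_zero, hN] at h1
    apply hj
    simpa [Pi.single_apply] using h1
  have hsup := (Module.mem_support_iff_of_finite (R := R) (M := M) (p := ⟨p, hp⟩)).2 hann
  rw [Module.mem_support_iff_nontrivial_residueField_tensorProduct] at hsup
  let κ := p.ResidueField
  change Nontrivial (κ ⊗[R] M) at hsup
  obtain ⟨y, hy⟩ := exists_ne (0 : κ ⊗[R] M)
  obtain ⟨Φ, hΦ⟩ : ∃ Φ : Module.Dual κ (κ ⊗[R] M), Φ y ≠ 0 := by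
    by_contra hc
    push Not at hc
    exact hy ((Module.forall_dual_apply_eq_zero_iff κ y).1 hc)
  let lam : ι → κ := fun j => Φ (1 ⊗ₜ (Submodule.Quotient.mk (Pi.single j 1) : M))
  have hlam : ∀ c : ι → R, Φ (1 ⊗ₜ (Submodule.Quotient.mk c : M)) = ∑ k, algebraMap R κ (c k) * lam k := by
    intro c
    have h1 : (Submodule.Quotient.mk c : M) = ∑ k, c k • (Submodule.Quotient.mk (Pi.single k 1) : M) := by
      have : c = ∑ k, c k • (Pi.single k 1 : ι → R) := by
        ext i; simp [Finset.sum_apply, Pi.single_apply]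
      conv_lhs => rw [this]
      change N.mkQ _ = _
      rw [map_sum]; rfl
    rw [h1, TensorProduct.tmul_sum, map_sum]
    refine Finset.sum_congr rfl fun k _ => ?_
    rw [TensorProduct.tmul_smul, ← algebraMap_smul κ (c k), map_smul, smul_eq_mul]
  have hl0 : ∀ j, lam j = 0 := by
    intro j
    obtain ⟨s, hs, n, w, h1, h2⟩ := h j
    have h3 := congrArg (MvPolynomial.aeval lam) h1
    rw [map_mul, map_pow, MvPolynomial.aeval_X, MvPolynomial.aeval_C, map_sum] at h3
    have h4 : ∑ k, MvPolynomial.aeval lam (w k * X k) = 0 := by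
      let A : Finset (ι →₀ ℕ) := Finset.univ.biUnion fun k => (w k).support
      have hw : ∀ k, MvPolynomial.aeval lam (w k) = ∑ α ∈ A, algebraMap R κ (coeff α (w k)) * ∏ i, lam i ^ α i := by
        intro k
        rw [MvPolynomial.aeval_eq_eval₂Hom, MvPolynomial.coe_eval₂Hom, MvPolynomial.eval₂_eq']
        refine Finset.sum_subset (Finset.subset_biUnion_of_mem (fun k => (w k).support) (Finset.mem_univ k)) fun α _ hα => ?_
        rw [MvPolynomial.notMem_support_iff.1 hα, map_zero, zero_mul]
      calc _ = ∑ k, ∑ α ∈ A, (algebraMap R κ (coeff α (w k)) * lam k) * ∏ i, lam i ^ α i := by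
            refine Finset.sum_congr rfl fun k _ => ?_
            rw [map_mul, hw, MvPolynomial.aeval_X, Finset.sum_mul]
            exact Finset.sum_congr rfl fun α _ => by ring
        _ = ∑ α ∈ A, (∑ k, algebraMap R κ (coeff α (w k)) * lam k) * ∏ i, lam i ^ α i := by
            rw [Finset.sum_comm]
            exact Finset.sum_congr rfl fun α _ => (Finset.sum_mul _ _ _).symm
        _ = 0 := by
            refine Finset.sum_eq_zero fun α _ => ?_
            have h5 : (Submodule.Quotient.mk (fun k => coeff α (w k)) : M) = 0 := by
              rw [Submodule.Quotient.mk_eq_zero, hN]; exact h2 α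
            rw [← hlam (fun k => coeff α (w k)), h5, TensorProduct.tmul_zero, map_zero, zero_mul]
    rw [h4] at h3
    rcases mul_eq_zero.1 h3 with h5 | h5
    · exact absurd (Ideal.algebraMap_residueField_eq_zero.1 h5) hs
    · exact eq_zero_of_pow_eq_zero h5
  apply hΦ
  have hall : ∀ y : κ ⊗[R] M, Φ y = 0 := by
    intro y
    induction y using TensorProduct.induction_on with
    | zero => exact map_zero _
    | add a b ha hb => rw [map_add, ha, hb, add_zero]
    | tmul a m =>
      obtain ⟨c, rfl⟩ := Submodule.Quotient.mk_surjective N m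
      have : (a ⊗ₜ (Submodule.Quotient.mk c : M) : κ ⊗[R] M) = a • ((1 : κ) ⊗ₜ (Submodule.Quotient.mk c : M)) := by
        rw [TensorProduct.smul_tmul', smul_eq_mul, mul_one]
      rw [this, map_smul, hlam]
      simp [hl0]
  exact hall y

end RL
end S9

namespace S9
open CategoryTheory
open MvPolynomial (C X coeff monomial)

section EL
variable {κ : Type} [LinearOrder κ] [Fintype κ] {R : Type u} [CommRing R] (A : Finset κ)

/-- polynomial ring on the variables outside `A` -/
abbrev SA (R : Type u) [CommRing R] (A : Finset κ) := MvPolynomial {k : κ // k ∉ A} R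

/-- the functional vanishing on `A` -/
def vA (R : Type u) [CommRing R] (A : Finset κ) : κ → SA R A := fun k => if h : k ∉ A then X ⟨k, h⟩ else 0

theorem vA_Lin : Lin (vA R A) := fun j => by
  by_cases h : j ∉ A
  · right; exact ⟨⟨j, h⟩, by simp [vA, h]⟩
  · left; simp only [vA, dif_neg h]

theorem vA_mem {k : κ} (h : k ∈ A) : vA R A k = 0 := by simp [vA, h]
theorem vA_notMem {k : κ} (h : k ∉ A) : vA R A k = X ⟨k, h⟩ := by simp [vA, h]

theorem Dv_SpA {z : Finset κ → SA R A} (hz : z ∈ Sp (SA R A) (SA R A) A) : D (vA R A) z = 0 := by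
  rw [D_apply]
  refine Finset.sum_eq_zero fun j _ => ?_
  by_cases h : j ∈ A
  · rw [vA_mem A h, zero_smul]
  · rw [pa_zero_of h hz, smul_zero]

variable (p : Ideal R) (u : κ → R) (l : Finset κ)

/-- locally a boundary -/
def LA (z : Finset κ → SA R A) : Prop :=
  ∃ s ∉ p, ∃ w ∈ Sp (SA R A) (SA R A) l, D (uC {k : κ // k ∉ A} u) w = 0 ∧ D (vA R A) w = (C s : SA R A) • z

variable [hp : p.IsPrime] {A u l}

theorem LA_add {z z' : Finset κ → SA R A} (h : LA A p u l z) (h' : LA A p u l z') : LA A p u l (z + z') := by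
  obtain ⟨s, hs, w, h1, h2, h3⟩ := h
  obtain ⟨s', hs', w', h1', h2', h3'⟩ := h'
  refine ⟨s * s', mul_nmem p hs hs', (C s' : SA R A) • w + (C s : SA R A) • w', add_mem (Submodule.smul_mem _ _ h1) (Submodule.smul_mem _ _ h1'), ?_, ?_⟩
  · rw [map_add, map_smul, map_smul, h2, h2', smul_zero, smul_zero, add_zero]
  · rw [map_add, map_smul, map_smul, h3, h3', smul_smul, smul_smul, smul_add, map_mul, mul_comm (C s')]

theorem LA_zero : LA A p u l 0 := ⟨1, hp.one_notMem, 0, zero_mem _, map_zero _, by simp⟩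

theorem LA_sum {B : Type} (t : Finset B) (z : B → Finset κ → SA R A)
    (h : ∀ a ∈ t, LA A p u l (z a)) : LA A p u l (∑ a ∈ t, z a) :=
  Finset.sum_induction z (LA A p u l) (fun _ _ => LA_add p) (LA_zero p) h

theorem LA_X (hA : PG p u A) (hAl : A ⊆ l) {z : Finset κ → SA R A} (hz : z ∈ Sp (SA R A) (SA R A) A) (hzu : D (uC {k : κ // k ∉ A} u) z = 0)
    {k : κ} (hk : k ∉ A) (hkl : k ∈ l) : LA A p u l ((X ⟨k, hk⟩ : SA R A) • z) := by
  obtain ⟨s, hs, c, hc, h⟩ := hA k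
  refine ⟨s, hs, (C s : SA R A) • we _ k z - W (uC {k : κ // k ∉ A} c) z, sub_mem (Submodule.smul_mem _ _ (Sp_mono (Finset.insert_subset hkl hAl) (we_Sp k hz)))
    (Sp_mono hAl (W_Sp (fun j hj => by simp [uC, hc j hj]) hz)), ?_, ?_⟩
  · rw [map_sub, map_smul, D_we, D_W, hzu, map_zero, map_zero, sub_zero, sub_zero, smul_smul, sub_eq_zero]
    congr 1
    simp only [uC, ← map_mul, ← map_sum, h]
  · rw [map_sub, map_smul, D_we, D_W, Dv_SpA A hz, map_zero, map_zero, sub_zero, sub_zero, vA_notMem A hk]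
    rw [Finset.sum_eq_zero, zero_smul, sub_zero]
    intro j _
    by_cases hj : j ∈ A
    · rw [vA_mem A hj, zero_mul]
    · simp [uC, hc j hj]

theorem sum_mo {σ : Type} [Fintype σ] (z : Finset κ → MvPolynomial σ R) : ∃ B : Finset (σ →₀ ℕ), ∑ α ∈ B, mo R α (cf R α z) = z := by
  classical
  refine ⟨Finset.univ.biUnion fun T => (z T).support, ?_⟩
  ext T β
  rw [Finset.sum_apply, MvPolynomial.coeff_sum]
  simp only [mo_apply, cf_apply, MvPolynomial.coeff_monomial, Finset.sum_ite_eq']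
  split_ifs with h
  · rfl
  · by_contra hne
    exact h (Finset.mem_biUnion.2 ⟨T, Finset.mem_univ _, MvPolynomial.mem_support_iff.2 (Ne.symm hne)⟩)

theorem LA_of (hA : PG p u A) (hAl : A ⊆ l) {z : Finset κ → SA R A} (hz : z ∈ Sp (SA R A) (SA R A) A) (hzu : D (uC {k : κ // k ∉ A} u) z = 0)
    (h : ∀ α : {k : κ // k ∉ A} →₀ ℕ, (∃ k, k.1 ∈ l ∧ α k ≠ 0) ∨ ∃ s ∉ p, s • cf R α z = 0) : LA A p u l z := by
  obtain ⟨B, hB⟩ := sum_mo z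
  rw [← hB]
  refine LA_sum p _ _ fun α _ => ?_
  rcases h α with ⟨k, hkl, hk⟩ | ⟨s, hs, h⟩
  · have h1 : mo R α (cf R α z) = (X k : SA R A) • mo R (α - Finsupp.single k 1) (cf R α z) := by
      ext1 T
      rw [Pi.smul_apply, mo_apply, mo_apply, smul_eq_mul, mul_comm, MvPolynomial.X, MvPolynomial.monomial_mul, mul_one, 
        tsub_add_cancel_of_le]
      rw [Finsupp.single_le_iff]; omega
    rw [h1]
    refine LA_X p hA hAl ?_ ?_ k.2 hkl
    · intro T hT; rw [mo_apply, cf_apply, hz T hT]; simp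
    · rw [D_mo, D_cf, hzu]; simp
  · refine ⟨s, hs, 0, zero_mem _, map_zero _, ?_⟩
    rw [C_smul, ← map_smul, h]; simp

theorem claimA (hA : PG p u A) (B : Finset κ) : ∀ z ∈ Sp (SA R A) (SA R A) (B ∪ A), D (uC {k : κ // k ∉ A} u) z = 0 → D (vA R A) z = 0 →
    ∃ s ∉ p, ∃ z0 ∈ Sp (SA R A) (SA R A) A, D (uC {k : κ // k ∉ A} u) z0 = 0 ∧ ∃ w ∈ Sp (SA R A) (SA R A) (B ∪ A), D (uC {k : κ // k ∉ A} u) w = 0 ∧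
      (C s : SA R A) • z = z0 + D (vA R A) w := by
  induction B using Finset.induction_on with
  | empty =>
    intro z hz hzu hzv
    rw [Finset.empty_union] at hz
    exact ⟨1, hp.one_notMem, z, hz, hzu, 0, zero_mem _, map_zero _, by simp⟩
  | insert b B hbB ih =>
    rw [Finset.insert_union]
    by_cases hb : b ∈ B ∪ A
    · rw [Finset.insert_eq_of_mem hb]; exact ih
    set l := B ∪ A with hl
    have hAl : A ⊆ l := Finset.subset_union_right
    have hbA : b ∉ A := fun h => hb (hAl h)
    intro z hz hzu hzv
    obtain ⟨s0, hs0, c, hc, h2⟩ := hA b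
    have hu : (C s0 : SA R A) * uC {k : κ // k ∉ A} u b = ∑ j, uC {k : κ // k ∉ A} u j * uC {k : κ // k ∉ A} c j := by
      simp only [uC, ← map_mul, ← map_sum, h2]
    have hcC : ∀ j ∉ A, (uC {k : κ // k ∉ A} c j : SA R A) = 0 := fun j hj => by simp [uC, hc j hj]
    have hcl : ∀ j ∉ l, (uC {k : κ // k ∉ A} c j : SA R A) = 0 := fun j hj => hcC j fun h => hj (hAl h)
    set g := pa (SA R A) b z with hg
    set f' := (C s0 : SA R A) • pa (SA R A) b (we (SA R A) b z) + W (uC {k : κ // k ∉ A} c) g with hf'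
    have hgS := g_Sp hz hb
    have hf'S : f' ∈ Sp (SA R A) (SA R A) l := add_mem (Submodule.smul_mem _ _ (f_Sp hz hb)) (W_Sp hcl hgS)
    have hgu := step_g (b := b) (uC {k : κ // k ∉ A} u) z hzu
    have hgv := step_g (b := b) (vA R A) z hzv
    have hf'u := step_f' (b := b) (uC {k : κ // k ∉ A} u) (uC {k : κ // k ∉ A} c) (C s0) z hzu
    have hf'v := step_f' (b := b) (vA R A) (uC {k : κ // k ∉ A} c) (C s0) z hzv
    rw [hu, sub_self, zero_smul, neg_zero] at hf'u
    have hvc : ∑ j, vA R A j * uC {k : κ // k ∉ A} c j = 0 := Finset.sum_eq_zero fun j _ => by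
      by_cases hj : j ∈ A
      · rw [vA_mem A hj, zero_mul]
      · rw [hcC j hj, mul_zero]
    obtain ⟨s1, hs1, g', hg'S, hg'u, hg'v⟩ : LA A p u l g := by
      obtain ⟨s1, hs1, g0, hg0, hg0u, w, hw, hwu, hwv⟩ := ih g hgS hgu hgv
      have hL : LA A p u l g0 := by
        refine LA_of p hA hAl hg0 hg0u fun α => ?_
        by_cases hα : ∃ k, k.1 ∈ l ∧ α k ≠ 0
        · exact Or.inl hα
        right
        push Not at hα
        refine ⟨s0, hs0, ?_⟩
        -- `s0 X_b g0 = D v y`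
        have hy : (C s0 * X ⟨b, hbA⟩ : SA R A) • g0 = D (vA R A) (-((C s1 : SA R A) • f') - (C s0 * X ⟨b, hbA⟩ : SA R A) • w) := by
          rw [map_sub, map_neg, map_smul, map_smul, hf'v, hvc, sub_zero, vA_notMem A hbA, smul_neg, neg_neg, smul_comm, hwv, smul_add, add_sub_cancel_right]
        have hyS : -((C s1 : SA R A) • f') - (C s0 * X ⟨b, hbA⟩ : SA R A) • w ∈ Sp (SA R A) (SA R A) l :=
          sub_mem (neg_mem (Submodule.smul_mem _ _ hf'S)) (Submodule.smul_mem _ _ hw)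
        set y := -((C s1 : SA R A) • f') - (C s0 * X ⟨b, hbA⟩ : SA R A) • w
        ext1 T
        have h3 := congrArg (coeff (α + Finsupp.single ⟨b, hbA⟩ 1)) (congrFun hy T)
        rw [Pi.smul_apply, smul_eq_mul, mul_assoc, MvPolynomial.coeff_C_mul, mul_comm (X _), MvPolynomial.coeff_mul_X] at h3
        rw [Pi.smul_apply, cf_apply, smul_eq_mul, h3, D_apply, Finset.sum_apply, MvPolynomial.coeff_sum]
        refine Finset.sum_eq_zero fun k _ => ?_
        by_cases hkA : k ∈ A
        · rw [vA_mem A hkA]; simp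
        by_cases hkl : k ∈ l
        · rw [Pi.smul_apply, vA_notMem A hkA, smul_eq_mul, mul_comm, MvPolynomial.coeff_mul_X', if_neg]
          have : b ≠ k := fun h => hb (h ▸ hkl)
          simp [hα ⟨k, hkA⟩ hkl, Finsupp.single_apply, this]
        · rw [pa_zero_of hkl hyS]; simp
      have h5 := LA_add p hL ⟨1, hp.one_notMem, w, hw, hwu, by rw [map_one, one_smul]⟩
      rw [← hwv] at h5
      obtain ⟨s, hs, w', a1, a2, a3⟩ := h5
      exact ⟨s * s1, mul_nmem p hs hs1, w', a1, a2, by rw [a3, smul_smul, map_mul]⟩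
    set Tb : SA R A := C s0 * vA R A b - ∑ j, vA R A j * uC {k : κ // k ∉ A} c j with hTb
    obtain ⟨s2, hs2, r, hr, hru, w1, hw1S, hw1u, hw1v⟩ := ih ((C s1 : SA R A) • f' + Tb • g')
      (add_mem (Submodule.smul_mem _ _ hf'S) (Submodule.smul_mem _ _ hg'S))
      (by rw [map_add, map_smul, map_smul, hf'u, hg'u, smul_zero, smul_zero, add_zero])
      (by rw [map_add, map_smul, map_smul, hf'v, hg'v, smul_neg, smul_comm, neg_add_cancel])
    have := step_id (l := l) (uC {k : κ // k ∉ A} u) (vA R A) (uC {k : κ // k ∉ A} c) (C s0) hu z g' w1 r (C s1) (C s2) hzu hzv hg'u hg'v hw1v hw1u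
    refine ⟨s2 * s0 * s1, mul_nmem p (mul_nmem p hs2 hs0) hs1, r, hr, hru, _, ?_, this.1, ?_⟩
    · exact add_mem (Submodule.smul_mem _ _ (sub_mem (Sp_mono (Finset.subset_insert _ _) (W_Sp hcl hg'S)) (Submodule.smul_mem _ _ (we_Sp b hg'S)))) (Sp_mono (Finset.subset_insert _ _) hw1S)
    · rw [this.2, map_mul, map_mul, add_sub_cancel]

end EL
end S9

namespace S9
open CategoryTheory
open MvPolynomial (C X coeff monomial)

section ELm
variable {κ : Type} [LinearOrder κ] [Fintype κ] {R : Type u} [CommRing R] {A : Finset κ}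
variable (p : Ideal R) {u : κ → R} [hp : p.IsPrime]

theorem ExA (hA : PG p u A) {a : R} (ha : a ∈ Ideal.span (Set.range u)) (hn : a ∈ nonZeroDivisors R) (i : ℕ) :
    ∀ z ∈ Cc {k : κ // k ∉ A} u Finset.univ A.card i, D (vA R A) z = 0 → ∃ s ∉ p, ∃ w ∈ Cc {k : κ // k ∉ A} u Finset.univ A.card (i+1), D (vA R A) w = s • z := by
  intro z hz hzv
  suffices hL : LA A p u Finset.univ z by
    obtain ⟨s, hs, w, h1, h2, h3⟩ := hL
    rw [C_smul] at h3
    obtain ⟨w', hw', h4⟩ := Cc_lift (vA_Lin A) (Submodule.smul_mem _ s hz) h1 h2 h3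
    exact ⟨s, hs, w', hw', h4⟩
  by_cases hi : A.card < i
  · rw [Cc_deg hi hz]; exact LA_zero p
  obtain ⟨e, he⟩ : ∃ e, e + i = A.card := ⟨A.card - i, by omega⟩
  obtain ⟨s, hs, z0, hz0, hz0u, w, hw, hwu, hwv⟩ := claimA p hA Finset.univ z (Sp_mono Finset.subset_union_left hz.1) hz.2.2.1 hzv
  have h1 : (C s : SA R A) • z = Pj e (pr (SA R A) i z0) + Pj e (pr (SA R A) i (D (vA R A) w)) := by
    rw [← map_add, ← map_add, ← hwv, pr_of_Dg (Submodule.smul_mem _ _ hz.2.1), C_smul, map_smul, Cc_Pj hz he]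
  have hL0 : LA A p u Finset.univ (Pj e (pr (SA R A) i z0)) := by
    have hS : Pj e (pr (SA R A) i z0) ∈ Sp (SA R A) (SA R A) A := Pj_Sp (pr_Sp hz0) e
    have hu : D (uC {k : κ // k ∉ A} u) (Pj e (pr (SA R A) i z0)) = 0 := by
      rw [D_Pj]
      cases i with
      | zero => rw [D_Dg0 _ (pr_Dg _ _), map_zero]
      | succ i => rw [← pr_D, hz0u, map_zero, map_zero]
    refine LA_of p hA (Finset.subset_univ _) hS hu fun α => ?_
    by_cases hα : ∃ k, α k ≠ 0
    · obtain ⟨k, hk⟩ := hα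
      exact Or.inl ⟨k, Finset.mem_univ _, hk⟩
    · right
      push Not at hα
      have hα0 : α = 0 := by ext k; exact hα k
      by_cases he0 : e = 0
      · obtain ⟨s, hs, h⟩ := top_kill p hA ha hn (i := i) (by omega) hS (Pj_Dg (pr_Dg _ _) e) hu
        exact ⟨s, hs, by rw [← map_smul, h, map_zero]⟩
      · refine ⟨1, hp.one_notMem, ?_⟩
        ext1 T
        rw [one_smul, cf_apply, Pj_apply, MvPolynomial.coeff_homogeneousComponent, if_neg (by rw [hα0]; simp; omega), Pi.zero_apply]
  have hL1 : LA A p u Finset.univ (Pj e (pr (SA R A) i (D (vA R A) w))) := by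
    cases e with
    | zero => rw [pr_D, Dv_Pj0 (vA_Lin A)]; exact LA_zero p
    | succ e =>
      refine ⟨1, hp.one_notMem, Pj e (pr (SA R A) (i+1) w), Sp_univ _, ?_, ?_⟩
      · rw [D_Pj, ← pr_D, hwu, map_zero, map_zero]
      · rw [Dv_Pj (vA_Lin A), ← pr_D, map_one, one_smul]
  have hL := LA_add p hL0 hL1
  rw [← h1] at hL
  obtain ⟨s', hs', w', a1, a2, a3⟩ := hL
  exact ⟨s' * s, mul_nmem p hs' hs, w', a1, a2, by rw [a3, smul_smul, map_mul]⟩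

theorem PG_of_mem {κ : Type} [Fintype κ] {A : Finset κ} {u : κ → R} {s : R} (hs : s ∉ p) (h : ∀ j, s * u j ∈ Ideal.span (u '' A)) : PG p u A := by
  classical
  intro b
  refine ⟨s, hs, ?_⟩
  have hb := h b
  obtain ⟨c, hc⟩ := (Submodule.mem_span_image_finset_iff_exists_fun R).1 hb
  refine ⟨fun k => if h : k ∈ A then c ⟨k, h⟩ else 0, fun j hj => dif_neg hj, ?_⟩
  rw [← hc]
  rw [← Finset.sum_subset (Finset.subset_univ A) (fun k _ hk => by simp [hk]), ← Finset.sum_coe_sort A]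
  refine Finset.sum_congr rfl fun k _ => ?_
  simp [mul_comm]

/-- the E-lemma -/
theorem E_lemma [IsNoetherianRing R] {a : R} (ha : a ∈ Ideal.span (Set.range u)) (hn : a ∈ nonZeroDivisors R)
    (hG : ∀ q : Ideal R, q.IsPrime → q ≤ p → Gd q) (hZ : ∀ i k, 0 < k → V p (Zm u Finset.univ i) k)
    (hlow : ∀ q : Ideal R, q.IsPrime → q ≤ p → ht q ≤ A.card → PG q u A) : PG p u A := by
  have : ∀ n, ∀ q : Ideal R, q.IsPrime → q ≤ p → ht q = n → PG q u A := by
    intro n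
    induction n using Nat.strong_induction_on with
    | _ n ih =>
      intro q hq hqp hn'
      by_cases hx : ht q ≤ A.card
      · exact hlow q hq hqp hx
      have ih' : ∀ q' : Ideal R, q'.IsPrime → q' < q → PG q' u A := fun q' hq' hlt =>
        ih _ (by have := ht_lt hlt; omega) q' hq' (hlt.le.trans hqp) rfl
      have hA : ∀ i k, 0 < k → V q (Cc {k : κ // k ∉ A} u Finset.univ A.card i) k := fun i k hk => V_Cc q u Finset.univ A.card i k (V_mono hqp (hZ i k hk))
      have hNN : ∀ i, A.card < i → ∀ z ∈ Cc {k : κ // k ∉ A} u Finset.univ A.card i, ∃ s ∉ q, s • z = 0 := fun i hi z hz =>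
        ⟨1, hq.one_notMem, by rw [Cc_deg hi hz, smul_zero]⟩
      have hacy : ∀ i, 1 ≤ i → ExAt (dv {k : κ // k ∉ A} (vA R A)) (Cc {k : κ // k ∉ A} u Finset.univ A.card) q i := 
        acy (dv _ (vA R A)) (Cc {k : κ // k ∉ A} u Finset.univ A.card) (fun z => D_D _ z) (fun i z hz => Cc_D (vA_Lin A) hz) (fun i => Cc_fg u _ _ i) q (hG q hq hqp)
          hA hNN (by omega) (fun q' hq' hlt i hi => ExA q' (ih' q' hq' hlt) ha hn i)
      have h0 := acy0 (dv _ (vA R A)) (Cc {k : κ // k ∉ A} u Finset.univ A.card) (fun z => D_D _ z) (fun i z hz => Cc_D (vA_Lin A) hz) (fun i => Cc_fg u _ _ i) q (hG q hq hqp)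
          hA hNN (by omega) hacy (Cc {k : κ // k ∉ A} u Finset.univ A.card 0) le_rfl (fun q' hq' hlt z hz => ExA q' (ih' q' hq' hlt) ha hn 0 z hz (D_Dg0 _ hz.2.1))
      obtain ⟨s, hs, hsJ⟩ := red_loc q (fun k : {k : κ // k ∉ A} => u k) (Ideal.span (u '' A)) (by
        intro j
        obtain ⟨s, hs, w, hw, hwv⟩ := h0 (vc (X j ^ A.card)) ⟨vc_Sp _ _, vc_Dg _, D_Dg0 _ (vc_Dg _), fun T α hα => by
          by_cases hT : T = ∅
          · subst hT
            rw [vc_empty, MvPolynomial.coeff_X_pow, if_neg]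
            rintro rfl; simp at hα
          · rw [vc, Pi.single_eq_of_ne hT, MvPolynomial.coeff_zero]⟩
        refine ⟨s, hs, A.card, fun k => w {k.1}, ?_, fun α => ?_⟩
        · have h1 := congrFun hwv ∅
          rw [Pi.smul_apply, vc_empty, MvPolynomial.smul_eq_C_mul] at h1
          rw [← h1]
          change D (vA R A) w ∅ = _
          rw [D_empty, ← Finset.sum_add_sum_compl A, Finset.sum_eq_zero (fun k hk => by rw [vA_mem A hk]; simp), zero_add,
            Finset.sum_subtype Aᶜ (p := fun k => k ∉ A) (fun k => by simp)]
          refine Finset.sum_congr rfl fun k _ => ?_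
          rw [vA_notMem A k.2, mul_comm]
        · have h1 := congrArg (coeff α) (congrFun hw.2.2.1 ∅)
          rw [D_empty, MvPolynomial.coeff_sum, Pi.zero_apply, MvPolynomial.coeff_zero] at h1
          simp only [uC, MvPolynomial.coeff_C_mul] at h1
          rw [← Finset.sum_add_sum_compl A, Finset.sum_subtype Aᶜ (p := fun k => k ∉ A) (fun k => by simp)] at h1
          have h2 := eq_neg_of_add_eq_zero_right h1
          simp only [mul_comm (coeff _ _)]
          rw [h2]
          exact neg_mem (Ideal.sum_mem _ fun k hk => Ideal.mul_mem_right _ _ (Ideal.subset_span ⟨k, hk, rfl⟩)))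
      refine PG_of_mem q hs fun j => ?_
      by_cases hj : j ∈ A
      · exact Ideal.mul_mem_left _ _ (Ideal.subset_span ⟨j, hj, rfl⟩)
      · exact hsJ ⟨j, hj⟩
  exact this _ p hp le_rfl rfl

end ELm
end S9

namespace S9
open CategoryTheory
open MvPolynomial (C X coeff monomial)

section Cons
variable {ι : Type} [LinearOrder ι] [Fintype ι] {R : Type u} [CommRing R]

theorem wt_one (α : ι →₀ ℕ) : Finsupp.degree α = Finsupp.weight 1 α := by
  rw [Finsupp.degree_eq_weight_one]; rfl

theorem ev_hom (x : ι → R) {f : MvPolynomial ι R} {t : ℕ} (hf : f.IsHomogeneous t) :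
    ev x Finset.univ f = C (MvPolynomial.eval x f) * X none ^ t := by
  conv_lhs => rw [f.as_sum]
  rw [MvPolynomial.eval_eq', map_sum, map_sum, Finset.sum_mul]
  refine Finset.sum_congr rfl fun α hα => ?_
  have hα' := hf (MvPolynomial.mem_support_iff.1 hα)
  rw [MvPolynomial.monomial_eq, map_mul, ev_C, Finsupp.prod_fintype _ _ (fun i => by simp), map_prod, map_mul, map_prod, mul_assoc]
  congr 1
  simp only [map_pow, ev_X, Finset.mem_univ, if_true, mul_pow]
  rw [Finset.prod_mul_distrib, Finset.prod_pow_eq_pow_sum]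
  congr 2
  rw [← hα', ← wt_one, Finsupp.degree_eq_sum]

variable [IsLocalRing R] [IsNoetherianRing R]

theorem unit_of_notMem {s : R} (h : s ∉ IsLocalRing.maximalIdeal R) : IsUnit s := by
  by_contra h'; exact h ((IsLocalRing.mem_maximalIdeal s).2 h')

theorem LT_lin {x : ι → R} (h : QZ (IsLocalRing.maximalIdeal R) x Finset.univ) (f : MvPolynomial ι R) (hf : ev x Finset.univ f = 0) :
    ∃ w : ι → MvPolynomial ι R, f = ∑ j, X j * w j ∧ ∑ j, C (x j) * w j = 0 := by
  obtain ⟨s, hs, w, h1, h2, h3⟩ := h f hf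
  obtain ⟨s', hs'⟩ := (unit_of_notMem hs).exists_left_inv
  refine ⟨fun j => C s' * w {j}, ?_, ?_⟩
  · have := congrFun h3 ∅
    rw [D_empty, Pi.smul_apply, vc_empty, smul_eq_mul] at this
    have h4 : f = C s' * (C s * f) := by rw [← mul_assoc, ← map_mul, hs', map_one, one_mul]
    rw [h4, ← this, Finset.mul_sum]
    exact Finset.sum_congr rfl fun j _ => by simp [vX]; ring
  · have := congrFun h2 ∅
    rw [D_empty, Pi.zero_apply] at this
    calc _ = C s' * ∑ j, uC ι x j * w {j} := by
          rw [Finset.mul_sum]; exact Finset.sum_congr rfl fun j _ => by simp [uC]; ring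
      _ = 0 := by rw [this, mul_zero]

theorem LT_pow {x : ι → R} (h0 : EX (IsLocalRing.maximalIdeal R) x Finset.univ) (h : QZ (IsLocalRing.maximalIdeal R) x Finset.univ)
    (hZ : ∀ i k, 0 < k → V (IsLocalRing.maximalIdeal R) (Zm x Finset.univ i) k) (t k : ℕ) (hk : t < k) :
    V (IsLocalRing.maximalIdeal R) (↥(Ideal.span (Set.range x) ^ t)) k := by
  set m := IsLocalRing.maximalIdeal R
  have hV : V m (Qc (dv ι (vX ι R)) (Cc ι x Finset.univ t) 0) k :=
    acy_V (dv ι (vX ι R)) (Cc ι x Finset.univ t) (fun z => D_D _ z) (fun i z hz => Cc_D vX_Lin hz) (fun i => Cc_fg x _ _ i) m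
      (fun i k hk => V_Cc m x Finset.univ t i k (hZ i k hk)) (N := t) (fun i hi z hz => ⟨1, (inferInstance : m.IsPrime).one_notMem, by rw [Cc_deg hi hz, smul_zero]⟩)
      (t+1) 0 (by omega) (fun i hi => Cc_of_EX m h0 t i (by omega)) k (by omega) (by omega)
  have hhom : ∀ z ∈ Cc ι x Finset.univ t 0, (z ∅).IsHomogeneous t := by
    intro z hz α hα
    by_contra hne
    rw [← wt_one] at hne
    exact hα (hz.2.2.2 ∅ α (by simpa using hne))
  let π : ↥(Cc ι x Finset.univ t 0) →ₗ[R] ↥(Ideal.span (Set.range x) ^ t) := 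
    { toFun := fun z => ⟨MvPolynomial.eval x (z.1 ∅), (Ideal.mem_span_pow_iff_exists_isHomogeneous _ _).2 ⟨_, hhom z.1 z.2, rfl⟩⟩
      map_add' := fun a b => Subtype.ext (by simp)
      map_smul' := fun r a => Subtype.ext (by simp [MvPolynomial.smul_eval]) }
  have hπ : Function.Surjective π := by
    rintro ⟨y, hy⟩
    obtain ⟨f, hf, hfy⟩ := (Ideal.mem_span_pow_iff_exists_isHomogeneous _ _).1 hy
    refine ⟨⟨vc f, vc_Sp _ _, vc_Dg _, D_Dg0 _ (vc_Dg _), fun T α hα => ?_⟩, Subtype.ext ?_⟩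
    · by_cases hT : T = ∅
      · subst hT
        rw [vc_empty]
        by_contra hne
        have := hf hne
        rw [← wt_one] at this
        exact hα (by simpa using this)
      · rw [vc, Pi.single_eq_of_ne hT, MvPolynomial.coeff_zero]
    · change MvPolynomial.eval x (vc f ∅) = y
      rw [vc_empty]; exact hfy
  have hker : LinearMap.ker π = Submodule.comap (Cc ι x Finset.univ t 0).subtype ((Cc ι x Finset.univ t (0+1)).map (dv ι (vX ι R))) := by
    ext ⟨z, hz⟩
    rw [LinearMap.mem_ker, Submodule.mem_comap, Submodule.mem_map]
    constructor
    · intro hz0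
      have hz0' : MvPolynomial.eval x (z ∅) = 0 := congrArg Subtype.val hz0
      obtain ⟨s, hs, w, hw, hws⟩ := Cc_of_QZ m h t z ⟨hz, by
        change ev x _ (z ∅) = 0
        rw [ev_hom x (hhom z hz), hz0', map_zero, zero_mul]⟩
      obtain ⟨s', hs'⟩ := (unit_of_notMem hs).exists_left_inv
      exact ⟨s' • w, Submodule.smul_mem _ _ hw, by rw [map_smul, hws, smul_smul, hs', one_smul]; rfl⟩
    · rintro ⟨w, hw, hwz⟩
      refine Subtype.ext ?_
      change MvPolynomial.eval x (z ∅) = 0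
      have h1 := ev_D hw.1 hw.2.2.1
      have h2 : D (vX ι R) w = z := hwz
      rw [h2, ev_hom x (hhom z hz)] at h1
      have h3 := congrArg (coeff (Finsupp.single none t)) h1
      simpa [MvPolynomial.coeff_C_mul, MvPolynomial.coeff_X_pow] using h3
  exact V_equiv m ((Submodule.quotEquivOfEq _ _ hker).symm.trans (π.quotKerEquivOfSurjective hπ)).symm hV

end Cons
end S9

namespace S9
open CategoryTheory

section Rees
variable {R : Type u} [CommRing R] {E : Type u} [AddCommGroup E] [Module R E]

/-- torsion-freeness of an algebra -/
def TF (R : Type*) [CommRing R] (B : Type*) [CommRing B] [Algebra R B] : Prop := ∀ r ∈ nonZeroDivisors R, ∀ b : B, r • b = 0 → b = 0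

def symι (R : Type u) [CommRing R] (E : Type u) [AddCommGroup E] [Module R E] : E →ₗ[R] SymModAlg R E where
  toFun x := Ideal.Quotient.mk _ (MvPolynomial.X x)
  map_add' x y := by
    rw [← map_add, Ideal.Quotient.eq]
    refine Ideal.subset_span (Or.inl ⟨x, y, by ring⟩)
  map_smul' r x := by
    change _ = Ideal.Quotient.mk _ (r • MvPolynomial.X x)
    rw [MvPolynomial.smul_eq_C_mul, Ideal.Quotient.eq]
    exact Ideal.subset_span (Or.inr ⟨r, x, rfl⟩)

def reesL (R : Type u) [CommRing R] (E : Type u) [AddCommGroup E] [Module R E] : E →ₗ[R] ReesModAlg R E where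
  toFun := reesι R E
  map_add' x y := by
    change Ideal.Quotient.mk _ (symι R E (x + y)) = Ideal.Quotient.mk _ (symι R E x) + Ideal.Quotient.mk _ (symι R E y)
    rw [map_add, map_add]
  map_smul' r x := by
    change Ideal.Quotient.mk _ (symι R E (r • x)) = r • Ideal.Quotient.mk _ (symι R E x)
    rw [map_smul]; rfl

theorem reesL_apply (x : E) : reesL R E x = reesι R E x := rfl

variable {B : Type*} [CommRing B] [Algebra R B]

def symLift (θ : E →ₗ[R] B) : SymModAlg R E →ₐ[R] B :=
  Ideal.Quotient.liftₐ _ (MvPolynomial.aeval θ) (by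
    intro a ha
    change a ∈ RingHom.ker (MvPolynomial.aeval (R := R) θ : MvPolynomial E R →ₐ[R] B)
    revert a
    change Ideal.span (symRels R E) ≤ _
    rw [Ideal.span_le]
    rintro f (⟨x, y, rfl⟩ | ⟨r, x, rfl⟩)
    · simp [RingHom.mem_ker]
    · simp [RingHom.mem_ker, Algebra.smul_def])

theorem symLift_ι (θ : E →ₗ[R] B) (x : E) : symLift θ (symι R E x) = θ x := by
  change MvPolynomial.aeval (R := R) θ (MvPolynomial.X x) = _
  simp

def reesLift (hB : TF R B) (θ : E →ₗ[R] B) : ReesModAlg R E →ₐ[R] B :=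
  Ideal.Quotient.liftₐ _ (symLift θ) (by
    rintro a ⟨r, hr, h⟩
    refine hB r hr _ ?_
    rw [← map_smul, h, map_zero])

theorem reesLift_ι (hB : TF R B) (θ : E →ₗ[R] B) (x : E) : reesLift hB θ (reesι R E x) = θ x := symLift_ι θ x

theorem rees_TF : TF R (ReesModAlg R E) := by
  intro r hr b hb
  obtain ⟨b, rfl⟩ := Ideal.Quotient.mk_surjective b
  have h1 : r • b ∈ torsionIdeal R (SymModAlg R E) := Ideal.Quotient.eq_zero_iff_mem.1 hb
  obtain ⟨s, hs, h2⟩ := h1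
  exact Ideal.Quotient.eq_zero_iff_mem.2 ⟨s * r, mul_mem hs hr, by rw [mul_smul, h2]⟩

theorem sym_ind {P : SymModAlg R E → Prop} (hC : ∀ r : R, P (algebraMap R _ r)) (ha : ∀ a b, P a → P b → P (a + b))
    (hm : ∀ a x, P a → P (a * symι R E x)) (a : SymModAlg R E) : P a := by
  obtain ⟨a, rfl⟩ := Ideal.Quotient.mk_surjective a
  induction a using MvPolynomial.induction_on with
  | C r => exact hC r
  | add p q h1 h2 => rw [map_add]; exact ha _ _ h1 h2
  | mul_X p x h => rw [map_mul]; exact hm _ _ h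

theorem rees_ind {P : ReesModAlg R E → Prop} (hC : ∀ r : R, P (algebraMap R _ r)) (ha : ∀ a b, P a → P b → P (a + b))
    (hm : ∀ a x, P a → P (a * reesι R E x)) (a : ReesModAlg R E) : P a := by
  obtain ⟨a, rfl⟩ := Ideal.Quotient.mk_surjective a
  induction a using sym_ind with
  | hC r => exact hC r
  | ha p q h1 h2 => rw [map_add]; exact ha _ _ h1 h2
  | hm p x h => rw [map_mul]; exact hm _ _ h

theorem rees_ext {f g : ReesModAlg R E →ₐ[R] B} (h : ∀ x, f (reesι R E x) = g (reesι R E x)) : f = g := by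
  ext a
  induction a using rees_ind with
  | hC r => rw [AlgHom.commutes, AlgHom.commutes]
  | ha p q h1 h2 => rw [map_add, map_add, h1, h2]
  | hm p x h' => rw [map_mul, map_mul, h', h]

theorem TF_mv {σ : Type*} (h : TF R B) : TF R (MvPolynomial σ B) := by
  intro r hr b hb
  ext α
  refine h r hr _ ?_
  rw [← MvPolynomial.coeff_smul, hb, MvPolynomial.coeff_zero]

theorem TF_self : TF R R := fun r hr b hb => by
  rw [smul_eq_mul] at hb
  exact (mul_left_mem_nonZeroDivisors_eq_zero_iff hr).1 hb

theorem reesι_zero : reesι R E 0 = 0 := (reesL R E).map_zero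

/-- functoriality and the polynomial description -/
theorem rees_poly {N : Type u} [AddCommGroup N] [Module R N] {m : ℕ} (e : E ≃ₗ[R] (N × (Fin m → R))) :
    Nonempty (ReesModAlg R E ≃ₐ[R] MvPolynomial (Fin m) (ReesModAlg R N)) := by
  let θ : E →ₗ[R] MvPolynomial (Fin m) (ReesModAlg R N) := 
    ((((Algebra.linearMap (ReesModAlg R N) (MvPolynomial (Fin m) (ReesModAlg R N))).restrictScalars R ∘ₗ reesL R N).coprod 
      (∑ i, (LinearMap.toSpanSingleton R _ (MvPolynomial.X i)) ∘ₗ LinearMap.proj i)) ∘ₗ e.toLinearMap)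
  have hθ : ∀ y v, θ (e.symm (y, v)) = MvPolynomial.C (reesι R N y) + ∑ i, v i • MvPolynomial.X i := by
    intro y v
    simp [θ, reesL_apply, MvPolynomial.algebraMap_eq]
  let f := reesLift (TF_mv rees_TF) θ
  let g0 : ReesModAlg R N →ₐ[R] ReesModAlg R E := reesLift rees_TF (reesL R E ∘ₗ e.symm.toLinearMap ∘ₗ LinearMap.inl R N (Fin m → R))
  have hg0 : ∀ y, g0 (reesι R N y) = reesι R E (e.symm (y, 0)) := fun y => reesLift_ι _ _ y
  let g : MvPolynomial (Fin m) (ReesModAlg R N) →ₐ[R] ReesModAlg R E := 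
    { MvPolynomial.eval₂Hom (g0 : ReesModAlg R N →+* ReesModAlg R E) (fun i => reesι R E (e.symm (0, Pi.single i 1))) with
      commutes' := fun r => by
        change MvPolynomial.eval₂Hom (g0 : ReesModAlg R N →+* ReesModAlg R E) _ (MvPolynomial.C (algebraMap R _ r)) = _
        rw [MvPolynomial.eval₂Hom_C]; exact g0.commutes r }
  have hgC : ∀ a, g (MvPolynomial.C a) = g0 a := fun a => MvPolynomial.eval₂Hom_C _ _ a
  have hgX : ∀ i, g (MvPolynomial.X i) = reesι R E (e.symm (0, Pi.single i 1)) := fun i => MvPolynomial.eval₂Hom_X' _ _ i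
  have hgf : ∀ a, g (f a) = a := by
    have : g.comp f = AlgHom.id R _ := by
      apply rees_ext
      intro x
      obtain ⟨⟨y, v⟩, rfl⟩ := e.symm.surjective x
      rw [AlgHom.comp_apply, reesLift_ι, hθ, map_add, hgC, hg0, map_sum, AlgHom.id_apply]
      simp only [map_smul, hgX, ← reesL_apply]
      simp only [← map_smul, ← map_sum, ← map_add]
      congr 2
      ext i
      · simp [Prod.fst_sum]
      · simp [Prod.snd_sum, Finset.sum_apply, Pi.single_apply]
    exact fun a => DFunLike.congr_fun this a
  have hfg : ∀ a, f (g a) = a := by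
    have h0 : ∀ b, f (g0 b) = MvPolynomial.C b := by
      have : f.comp g0 = (Algebra.ofId (ReesModAlg R N) (MvPolynomial (Fin m) (ReesModAlg R N))).restrictScalars R := by
        apply rees_ext
        intro y
        rw [AlgHom.comp_apply, hg0, reesLift_ι, hθ]
        simp [Algebra.ofId_apply, MvPolynomial.algebraMap_eq]
      exact fun b => DFunLike.congr_fun this b
    intro a
    induction a using MvPolynomial.induction_on with
    | C b => rw [hgC, h0]
    | add p q h1 h2 => rw [map_add, map_add, h1, h2]
    | mul_X p i h => 
      rw [map_mul, map_mul, h, hgX, reesLift_ι, hθ, reesι_zero]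
      simp [Pi.single_apply]
  exact ⟨AlgEquiv.ofAlgHom f g (AlgHom.ext hfg) (AlgHom.ext hgf)⟩

end Rees
end S9

namespace S9
open CategoryTheory

section Rees2
variable {R : Type u} [CommRing R] {N : Type u} [AddCommGroup N] [Module R N] {ι : Type}

def presS (x : ι → N) : MvPolynomial ι R →ₐ[R] SymModAlg R N := MvPolynomial.aeval fun j => symι R N (x j)
def presR (x : ι → N) : MvPolynomial ι R →ₐ[R] ReesModAlg R N := MvPolynomial.aeval fun j => reesι R N (x j)

theorem presS_surj {x : ι → N} (hx : Submodule.span R (Set.range x) = ⊤) : Function.Surjective (presS (R := R) x) := by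
  have h1 : ∀ y, symι R N y ∈ (presS (R := R) x).range := by
    intro y
    have hy : y ∈ Submodule.span R (Set.range x) := hx ▸ Submodule.mem_top
    induction hy using Submodule.span_induction with
    | mem y hy => obtain ⟨j, rfl⟩ := hy; exact ⟨MvPolynomial.X j, MvPolynomial.aeval_X _ _⟩
    | zero => rw [map_zero]; exact zero_mem _
    | add a b _ _ h1 h2 => rw [map_add]; exact add_mem h1 h2
    | smul r a _ h => rw [map_smul]; exact Subalgebra.smul_mem _ h r
  intro b
  change b ∈ (presS (R := R) x).range
  induction b using sym_ind with
  | hC r => exact Subalgebra.algebraMap_mem _ r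
  | ha a b h1 h2 => exact add_mem h1 h2
  | hm a y h => exact mul_mem h (h1 y)

theorem presR_eq (x : ι → N) (f) : presR (R := R) x f = Ideal.Quotient.mk _ (presS x f) := by
  have : presR (R := R) x = (Ideal.Quotient.mkₐ R _).comp (presS x) := by
    ext j
    simp only [presR, presS, MvPolynomial.aeval_X, AlgHom.comp_apply]
    rfl
  exact DFunLike.congr_fun this f

theorem presR_surj {x : ι → N} (hx : Submodule.span R (Set.range x) = ⊤) : Function.Surjective (presR (R := R) x) := by
  intro b
  obtain ⟨b, rfl⟩ := Ideal.Quotient.mk_surjective b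
  obtain ⟨f, rfl⟩ := presS_surj hx b
  exact ⟨f, presR_eq x f⟩

theorem rees_noeth [IsNoetherianRing R] [Module.Finite R N] : IsNoetherianRing (ReesModAlg R N) := by
  obtain ⟨n, x, hx⟩ := Module.Finite.exists_fin (R := R) (M := N)
  exact isNoetherianRing_of_surjective _ _ (presR x).toRingHom (presR_surj hx)

theorem dimq {B B' : Type u} [CommRing B] [CommRing B'] [Algebra R B] [Algebra R B'] [IsNoetherianRing B] {m : ℕ}
    (Φ : B' ≃ₐ[R] MvPolynomial (Fin m) B) (I : Ideal R) : ringKrullDim (B' ⧸ I.map (algebraMap R B')) = ringKrullDim (B ⧸ I.map (algebraMap R B)) + m := by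
  have h1 : (I.map (algebraMap R B)).map (MvPolynomial.C : _ →+* MvPolynomial (Fin m) B) = (I.map (algebraMap R B')).map (Φ.toRingEquiv : B' →+* MvPolynomial (Fin m) B) := by
    rw [Ideal.map_map, Ideal.map_map]
    congr 1
    ext1 r
    exact (Φ.commutes r).symm
  have e1 := Ideal.quotientEquiv _ _ Φ.toRingEquiv h1
  have e2 := MvPolynomial.quotientEquivQuotientMvPolynomial (σ := Fin m) (I.map (algebraMap R B))
  rw [ringKrullDim_eq_of_ringEquiv e1, ← ringKrullDim_eq_of_ringEquiv e2.toRingEquiv, MvPolynomial.ringKrullDim_of_isNoetherianRing]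
  simp

theorem spread_add [IsLocalRing R] [IsNoetherianRing R] {E : Type u} [AddCommGroup E] [Module R E] [Module.Finite R N] {m : ℕ} 
    (e : E ≃ₗ[R] (N × (Fin m → R))) : analyticSpread R E = analyticSpread R N + m := by
  obtain ⟨Φ⟩ := rees_poly e
  have : IsNoetherianRing (ReesModAlg R N) := rees_noeth
  exact dimq Φ _

end Rees2
end S9

namespace S9
open CategoryTheory
open MvPolynomial (homogeneousComponent)

section Rees3
variable {R : Type u} [CommRing R] {ι : Type} {I : Ideal R} 

def evP (x : ι → R) : MvPolynomial ι R →ₐ[R] Polynomial R := MvPolynomial.aeval fun j => Polynomial.C (x j) * Polynomial.X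

theorem evP_hom [Fintype ι] (x : ι → R) {f : MvPolynomial ι R} {t : ℕ} (hf : f.IsHomogeneous t) :
    evP x f = Polynomial.C (MvPolynomial.eval x f) * Polynomial.X ^ t := by
  conv_lhs => rw [f.as_sum]
  rw [MvPolynomial.eval_eq', map_sum, map_sum, Finset.sum_mul]
  refine Finset.sum_congr rfl fun α hα => ?_
  have hα' := hf (MvPolynomial.mem_support_iff.1 hα)
  rw [MvPolynomial.monomial_eq, map_mul, evP, MvPolynomial.aeval_C, Finsupp.prod_fintype _ _ (fun i => by simp), map_prod, map_mul, map_prod, mul_assoc]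
  congr 1
  simp only [map_pow, MvPolynomial.aeval_X, mul_pow]
  rw [Finset.prod_mul_distrib, Finset.prod_pow_eq_pow_sum]
  congr 2
  rw [← hα']
  simp [Finsupp.weight_apply, Finsupp.sum_fintype]

theorem evP_coeff [Fintype ι] (x : ι → R) (f : MvPolynomial ι R) (D : ℕ) :
    (evP x f).coeff D = MvPolynomial.eval x (homogeneousComponent D f) := by
  conv_lhs => rw [← MvPolynomial.sum_homogeneousComponent f]
  rw [map_sum, Polynomial.finsetSum_coeff]
  have : ∀ i, (evP x (homogeneousComponent i f)).coeff D = if i = D then MvPolynomial.eval x (homogeneousComponent D f) else 0 := by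
    intro i
    rw [evP_hom x (MvPolynomial.homogeneousComponent_isHomogeneous i f), Polynomial.coeff_C_mul_X_pow]
    split_ifs with h1 h2 h2
    · rw [h1]
    · exact absurd h1.symm h2
    · exact absurd h2.symm h1
    · rfl
  simp only [this]
  rw [Finset.sum_ite_eq']
  split_ifs with h
  · rfl
  · rw [MvPolynomial.homogeneousComponent_eq_zero _ _ (by simpa using h), map_zero]

theorem ev_of_evP [LinearOrder ι] [Fintype ι] (x : ι → R) (f : MvPolynomial ι R) (h : evP x f = 0) : ev x Finset.univ f = 0 := by
  rw [← MvPolynomial.sum_homogeneousComponent f, map_sum]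
  refine Finset.sum_eq_zero fun i _ => ?_
  rw [ev_hom x (MvPolynomial.homogeneousComponent_isHomogeneous i f), ← evP_coeff, h]
  simp

def θI (I : Ideal R) : ↥I →ₗ[R] Polynomial R := (Polynomial.monomial 1) ∘ₗ I.subtype

theorem TF_poly : TF R (Polynomial R) := by
  intro r hr b hb
  ext n
  refine TF_self r hr _ ?_
  rw [smul_eq_mul, ← smul_eq_mul, ← Polynomial.coeff_smul, hb, Polynomial.coeff_zero]

def ψI (I : Ideal R) : ReesModAlg R ↥I →ₐ[R] Polynomial R := reesLift TF_poly (θI I)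

theorem θI_apply (y : I) : θI I y = Polynomial.C y.1 * Polynomial.X := by
  rw [θI, Polynomial.C_mul_X_eq_monomial]; rfl

theorem ψI_pres (x : ι → ↥I) (f) : ψI I (presR x f) = evP (fun j => (x j).1) f := by
  have : (ψI I).comp (presR x) = evP (fun j => (x j).1) := by
    ext1 j
    rw [AlgHom.comp_apply, presR, MvPolynomial.aeval_X, ψI, reesLift_ι, evP, MvPolynomial.aeval_X, θI_apply]
  exact DFunLike.congr_fun this f

theorem ψS_pres (x : ι → ↥I) (f) : symLift (θI I) (presS x f) = evP (fun j => (x j).1) f := by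
  have : (symLift (θI I)).comp (presS x) = evP (fun j => (x j).1) := by
    ext1 j
    rw [AlgHom.comp_apply, presS, MvPolynomial.aeval_X, symLift_ι, evP, MvPolynomial.aeval_X, θI_apply]
  exact DFunLike.congr_fun this f

theorem span_sub {x : ι → ↥I} (hx : Ideal.span (Set.range fun j => (x j).1) = I) : Submodule.span R (Set.range x) = ⊤ := by
  have h : (Submodule.span R (Set.range x)).map I.subtype = I := by
    rw [Submodule.map_span, ← Set.range_comp]; exact hx
  rw [eq_top_iff]
  rintro ⟨y, hy⟩ -
  rw [← h] at hy
  obtain ⟨z, hz, hzy⟩ := hy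
  have : z = ⟨y, h ▸ ⟨z, hz, hzy⟩⟩ := Subtype.ext hzy
  rw [← this]; exact hz

theorem linType_of [Fintype ι] [LinearOrder ι] {x : ι → ↥I} (hx : Ideal.span (Set.range fun j => (x j).1) = I)
    (h : ∀ f : MvPolynomial ι R, ev (fun j => (x j).1) Finset.univ f = 0 → ∃ w : ι → MvPolynomial ι R, f = ∑ j, MvPolynomial.X j * w j ∧ ∑ j, MvPolynomial.C (x j).1 * w j = 0) :
    IsLinearType R ↥I := by
  unfold IsLinearType
  rw [eq_bot_iff]
  rintro b ⟨r, hr, hb⟩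
  obtain ⟨f, rfl⟩ := presS_surj (span_sub hx) b
  have h1 : evP (fun j => (x j).1) f = 0 := by
    refine TF_poly r hr _ ?_
    rw [← ψS_pres, ← map_smul, hb, map_zero]
  obtain ⟨w, hw1, hw2⟩ := h f (ev_of_evP _ _ h1)
  rw [Ideal.mem_bot, hw1, map_sum]
  have hw3 : ∀ j, w j = ∑ α ∈ Finset.univ.biUnion (fun j => (w j).support), MvPolynomial.monomial α ((w j).coeff α) := by
    intro j
    conv_lhs => rw [(w j).as_sum]
    refine Finset.sum_subset (Finset.subset_biUnion_of_mem (fun j => (w j).support) (Finset.mem_univ j)) fun α _ hα => ?_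
    rw [MvPolynomial.notMem_support_iff.1 hα, MvPolynomial.monomial_zero]
  have hw4 : ∀ j, presS x (MvPolynomial.X j * w j) = ∑ α ∈ Finset.univ.biUnion (fun j => (w j).support), presS x (MvPolynomial.monomial α 1) * symι R I ((w j).coeff α • x j) := by
    intro j
    conv_lhs => rw [hw3 j]
    rw [map_mul, map_sum, Finset.mul_sum]
    refine Finset.sum_congr rfl fun α _ => ?_
    have hm : MvPolynomial.monomial α ((w j).coeff α) = (w j).coeff α • (MvPolynomial.monomial α 1 : MvPolynomial ι R) := by
      rw [MvPolynomial.smul_monomial, smul_eq_mul, mul_one]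
    have hX : presS x (MvPolynomial.X j) = symι R I (x j) := by rw [presS, MvPolynomial.aeval_X]
    rw [hm, map_smul, map_smul, hX, mul_smul_comm, mul_smul_comm, mul_comm]
  simp only [hw4]
  rw [Finset.sum_comm]
  refine Finset.sum_eq_zero fun α _ => ?_
  rw [← Finset.mul_sum, ← map_sum]
  have : ∑ j, (w j).coeff α • x j = 0 := by
    apply Subtype.ext
    have h5 := congrArg (MvPolynomial.coeff α) hw2
    rw [MvPolynomial.coeff_sum, MvPolynomial.coeff_zero] at h5
    simp only [MvPolynomial.coeff_C_mul] at h5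
    simpa [mul_comm] using h5
  rw [this, map_zero, mul_zero]

theorem ψI_mem (b : ReesModAlg R ↥I) : ψI I b ∈ reesAlgebra I := by
  induction b using rees_ind with
  | hC r => rw [AlgHom.commutes]; exact Subalgebra.algebraMap_mem _ r
  | ha a b h1 h2 => rw [map_add]; exact add_mem h1 h2
  | hm a x h => 
    rw [map_mul, ψI, reesLift_ι, θI_apply, Polynomial.C_mul_X_eq_monomial]
    refine mul_mem h (reesAlgebra.monomial_mem.2 ?_)
    rw [pow_one]; exact x.2

theorem fiber_coeff [IsLocalRing R] {b : ReesModAlg R ↥I} (hb : b ∈ fiberIdeal R ↥I) (D : ℕ) :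
    (ψI I b).coeff D ∈ IsLocalRing.maximalIdeal R * I ^ D := by
  unfold fiberIdeal Ideal.map at hb
  induction hb using Submodule.span_induction generalizing D with
  | mem b hb => 
    obtain ⟨r, hr, rfl⟩ := hb
    rw [AlgHom.commutes, Polynomial.algebraMap_eq, Polynomial.coeff_C]
    split_ifs with h
    · rw [h, pow_zero]; simpa using hr
    · exact zero_mem _
  | zero => simp
  | add a b _ _ h1 h2 => rw [map_add, Polynomial.coeff_add]; exact add_mem (h1 D) (h2 D)
  | smul a b _ h =>
    rw [smul_eq_mul, map_mul, Polynomial.coeff_mul]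
    refine Ideal.sum_mem _ fun ij hij => ?_
    rw [← Finset.HasAntidiagonal.mem_antidiagonal.1 hij, pow_add, ← mul_assoc, mul_comm _ (I ^ ij.1), mul_assoc]
    exact Ideal.mul_mem_mul (ψI_mem a ij.1) (h ij.2)

end Rees3
end S9

namespace S9
open CategoryTheory

section Rees4
variable {R : Type u} [CommRing R] {κ : Type} [Fintype κ] [DecidableEq κ]

theorem reesPower_eq (E : Type u) [AddCommGroup E] [Module R E] (j : ℕ) :
    reesPower R E j = LinearMap.range (reesL R E) ^ j := by
  rw [← Submodule.span_eq (LinearMap.range (reesL R E)), Submodule.span_pow]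
  unfold reesPower
  congr 1
  ext a
  rw [Set.mem_pow]
  constructor
  · rintro ⟨f, rfl⟩
    refine ⟨fun i => ⟨reesι R E (f i), ⟨f i, rfl⟩⟩, ?_⟩
    rw [List.prod_ofFn]
  · rintro ⟨f, rfl⟩
    have : ∀ i, ∃ y, reesι R E y = (f i : ReesModAlg R E) := fun i => (f i).2
    choose g hg using this
    refine ⟨g, ?_⟩
    rw [List.prod_ofFn]
    exact Finset.prod_congr rfl fun i _ => (hg i).symm

/-- the linear form attached to a vector -/
def lf (κ : Type) [Fintype κ] (R : Type u) [CommRing R] : (κ → R) →ₗ[R] MvPolynomial κ R :=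
  ∑ i, (MvPolynomial.monomial (Finsupp.single i 1)) ∘ₗ LinearMap.proj i

theorem lf_apply (v : κ → R) : lf κ R v = ∑ i, MvPolynomial.monomial (Finsupp.single i 1) (v i) := by
  simp [lf]

theorem lf_single (i : κ) (c : R) : lf κ R (Pi.single i c) = MvPolynomial.monomial (Finsupp.single i 1) c := by
  rw [lf_apply, Finset.sum_eq_single i]
  · simp
  · intro j _ hj; rw [Pi.single_eq_of_ne hj, map_zero]
  · simp

def PI (I : κ → Ideal R) (α : κ →₀ ℕ) : Ideal R := ∏ i, I i ^ α i

theorem PI_add (I : κ → Ideal R) (α β : κ →₀ ℕ) : PI I (α + β) = PI I α * PI I β := by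
  simp [PI, pow_add, Finset.prod_mul_distrib]

theorem PI_zero (I : κ → Ideal R) : PI I 0 = ⊤ := by
  simp [PI]

theorem PI_single (I : κ → Ideal R) (i : κ) : PI I (Finsupp.single i 1) = I i := by
  unfold PI
  rw [Finset.prod_eq_single i]
  · simp
  · intro j _ hj; rw [Finsupp.single_eq_of_ne hj, pow_zero]
  · simp

/-- homogeneous polynomials with coefficients in products of the ideals -/
def WI (I : κ → Ideal R) (j : ℕ) : Submodule R (MvPolynomial κ R) where
  carrier := {G | ∀ α, G.coeff α ∈ PI I α ∧ (∑ i, α i ≠ j → G.coeff α = 0)}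
  zero_mem' := fun α => by simp
  add_mem' := by
    intro a b ha hb α
    rw [MvPolynomial.coeff_add]
    exact ⟨add_mem (ha α).1 (hb α).1, fun h => by rw [(ha α).2 h, (hb α).2 h, add_zero]⟩
  smul_mem' := by
    intro c a ha α
    rw [MvPolynomial.coeff_smul]
    exact ⟨Submodule.smul_mem _ c (ha α).1, fun h => by rw [(ha α).2 h, smul_zero]⟩

theorem WI_mul (I : κ → Ideal R) (i j : ℕ) : WI I i * WI I j ≤ WI I (i + j) := by
  rw [Submodule.mul_le]
  intro a ha b hb α
  rw [MvPolynomial.coeff_mul]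
  constructor
  · refine Ideal.sum_mem _ fun p hp => ?_
    rw [← Finset.HasAntidiagonal.mem_antidiagonal.1 hp, PI_add]
    exact Ideal.mul_mem_mul (ha _).1 (hb _).1
  · intro h
    refine Finset.sum_eq_zero fun p hp => ?_
    rw [← Finset.HasAntidiagonal.mem_antidiagonal.1 hp] at h
    simp only [Finsupp.add_apply, Finset.sum_add_distrib] at h
    by_cases h1 : ∑ k, p.1 k = i
    · rw [(hb _).2 (by omega), mul_zero]
    · rw [(ha _).2 h1, zero_mul]

theorem WI_mono {I : κ → Ideal R} {α : κ →₀ ℕ} {c : R} (hc : c ∈ PI I α) {j : ℕ} (h : ∑ i, α i = j) :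
    MvPolynomial.monomial α c ∈ WI I j := by
  intro β
  rw [MvPolynomial.coeff_monomial]
  constructor
  · split_ifs with h1
    · rw [← h1]; exact hc
    · exact zero_mem _
  · intro hb; rw [if_neg]; rintro rfl; exact hb h

variable {E : Type u} [AddCommGroup E] [Module R E]

theorem range_pow_le {I : κ → Ideal R} {φ : E →ₗ[R] (κ → R)} (hφ : ∀ v, (∃ y, φ y = v) ↔ ∀ i, v i ∈ I i) (j : ℕ) :
    LinearMap.range (lf κ R ∘ₗ φ) ^ j ≤ WI I j := by
  induction j with
  | zero =>
    rw [pow_zero, Submodule.one_le]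
    exact WI_mono (α := 0) (by rw [PI_zero]; trivial) (by simp)
  | succ j ih =>
    rw [pow_succ]
    refine (mul_le_mul' ih ?_).trans (WI_mul I j 1)
    rintro _ ⟨y, rfl⟩
    rw [LinearMap.comp_apply, lf_apply]
    refine sum_mem fun i _ => WI_mono ?_ ?_
    · rw [PI_single]; exact (hφ _).1 ⟨y, rfl⟩ i
    · simp [Finsupp.single_apply]

theorem le_range_pow {I : κ → Ideal R} {φ : E →ₗ[R] (κ → R)} (hφ : ∀ v, (∃ y, φ y = v) ↔ ∀ i, v i ∈ I i) (α : κ →₀ ℕ) :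
    PI I α ≤ (LinearMap.range (lf κ R ∘ₗ φ) ^ (∑ i, α i)).comap (MvPolynomial.monomial α) := by
  have hadd : ∀ α β : κ →₀ ℕ, PI I α ≤ (LinearMap.range (lf κ R ∘ₗ φ) ^ (∑ i, α i)).comap (MvPolynomial.monomial α) →
      PI I β ≤ (LinearMap.range (lf κ R ∘ₗ φ) ^ (∑ i, β i)).comap (MvPolynomial.monomial β) →
      PI I (α + β) ≤ (LinearMap.range (lf κ R ∘ₗ φ) ^ (∑ i, (α + β) i)).comap (MvPolynomial.monomial (α + β)) := by
    intro α β ha hb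
    rw [PI_add, Ideal.mul_le]
    intro r hr s hs
    rw [Submodule.mem_comap]
    have : MvPolynomial.monomial (α + β) (r * s) = MvPolynomial.monomial α r * MvPolynomial.monomial β s := by
      rw [MvPolynomial.monomial_mul]
    rw [this]
    simp only [Finsupp.add_apply, Finset.sum_add_distrib, pow_add]
    exact Submodule.mul_mem_mul (ha hr) (hb hs)
  have h0 : PI I 0 ≤ (LinearMap.range (lf κ R ∘ₗ φ) ^ (∑ i, (0 : κ →₀ ℕ) i)).comap (MvPolynomial.monomial 0) := by
    intro r _
    simp only [Finsupp.coe_zero, Pi.zero_apply, Finset.sum_const_zero, pow_zero, Submodule.mem_comap]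
    exact ⟨r, by rw [LinearMap.toSpanSingleton_apply, ← MvPolynomial.C_apply, MvPolynomial.smul_eq_C_mul, mul_one]⟩
  induction α using Finsupp.induction_linear with
  | zero => exact h0
  | add f g hf hg => exact hadd f g hf hg
  | single i n =>
    induction n with
    | zero => rw [Finsupp.single_zero]; exact h0
    | succ n ih =>
      rw [Finsupp.single_add]
      refine hadd _ _ ih ?_
      rw [PI_single]
      intro c hc
      have : ∑ k, (Finsupp.single i 1 : κ →₀ ℕ) k = 1 := by simp [Finsupp.single_apply]
      rw [this, pow_one, Submodule.mem_comap]
      obtain ⟨y, hy⟩ := (hφ (Pi.single i c)).2 (by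
        intro k
        by_cases h : k = i
        · subst h; rwa [Pi.single_eq_same]
        · rw [Pi.single_eq_of_ne h]; exact zero_mem _)
      exact ⟨y, by rw [LinearMap.comp_apply, hy, lf_single]⟩

theorem range_pow_eq {I : κ → Ideal R} {φ : E →ₗ[R] (κ → R)} (hφ : ∀ v, (∃ y, φ y = v) ↔ ∀ i, v i ∈ I i) (j : ℕ) :
    LinearMap.range (lf κ R ∘ₗ φ) ^ j = WI I j := by
  refine le_antisymm (range_pow_le hφ j) fun G hG => ?_
  rw [G.as_sum]
  refine sum_mem fun α hα => ?_
  have h : ∑ i, α i = j := by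
    by_contra h
    exact MvPolynomial.mem_support_iff.1 hα ((hG α).2 h)
  have := le_range_pow hφ α (hG α).1
  rwa [h] at this

theorem rees_inj {I : κ → Ideal R} {φ : E →ₗ[R] (κ → R)} (hφ : ∀ v, (∃ y, φ y = v) ↔ ∀ i, v i ∈ I i)
    (hinj : Function.Injective φ) {a : R} (ha : a ∈ nonZeroDivisors R) (haI : ∀ i, a ∈ I i) :
    Function.Injective (reesLift (TF_mv TF_self) (lf κ R ∘ₗ φ)) := by
  have hz : ∀ i, ∃ z, φ z = Pi.single i a := fun i => (hφ _).2 (by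
        intro k
        by_cases h : k = i
        · subst h; rw [Pi.single_eq_same]; exact haI _
        · rw [Pi.single_eq_of_ne h]; exact zero_mem _)
  choose z hz using hz
  have key : ∀ b : ReesModAlg R E, ∃ N : ℕ, ∃ G : MvPolynomial κ R, a ^ N • b = presR z G := by
    intro b
    induction b using rees_ind with
    | hC r => exact ⟨0, MvPolynomial.C r, by rw [pow_zero, one_smul, presR, MvPolynomial.aeval_C]⟩
    | ha b c hb hc =>
      obtain ⟨N, G, h1⟩ := hb
      obtain ⟨M, H, h2⟩ := hc
      refine ⟨N + M, a ^ M • G + a ^ N • H, ?_⟩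
      rw [map_add, map_smul, map_smul, ← h1, ← h2, smul_smul, smul_smul, smul_add, pow_add, mul_comm (a ^ M)]
    | hm b x hb =>
      obtain ⟨N, G, h1⟩ := hb
      refine ⟨N + 1, G * ∑ i, φ x i • MvPolynomial.X i, ?_⟩
      have h2 : a • x = ∑ i, φ x i • z i := by
        apply hinj
        rw [map_smul, map_sum]
        simp only [map_smul, hz]
        ext k
        simp [Pi.single_apply, mul_comm]
      have h3 : a • reesι R E x = presR z (∑ i, φ x i • MvPolynomial.X i) := by
        rw [← reesL_apply, ← map_smul, h2, map_sum, map_sum]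
        refine Finset.sum_congr rfl fun i _ => ?_
        rw [map_smul, map_smul, presR, MvPolynomial.aeval_X, reesL_apply]
      rw [map_mul, ← h1, ← h3, pow_succ, smul_mul_smul_comm]
  rw [injective_iff_map_eq_zero]
  intro b hb
  obtain ⟨N, G, h1⟩ := key b
  have h2 : reesLift (TF_mv TF_self) (lf κ R ∘ₗ φ) (presR z G) = 0 := by
    rw [← h1, map_smul, hb, smul_zero]
  have h3 : (reesLift (TF_mv TF_self) (lf κ R ∘ₗ φ)).comp (presR z) = MvPolynomial.aeval fun i => MvPolynomial.monomial (Finsupp.single i 1) a := by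
    ext1 i
    rw [AlgHom.comp_apply, presR, MvPolynomial.aeval_X, reesLift_ι, LinearMap.comp_apply, hz, lf_single, MvPolynomial.aeval_X]
  have h4 : ∀ G : MvPolynomial κ R, ∀ α, (MvPolynomial.aeval (fun i => (MvPolynomial.monomial (Finsupp.single i 1) a : MvPolynomial κ R)) G).coeff α = a ^ (∑ i, α i) * G.coeff α := by
    intro G α
    induction G using MvPolynomial.induction_on' with
    | add p q hp hq => rw [map_add, MvPolynomial.coeff_add, hp, hq, MvPolynomial.coeff_add, mul_add]
    | monomial β c =>
      rw [MvPolynomial.aeval_monomial, Finsupp.prod_fintype _ _ (fun i => by simp)]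
      have : ∏ i, (MvPolynomial.monomial (Finsupp.single i 1) a : MvPolynomial κ R) ^ β i = MvPolynomial.monomial β (a ^ ∑ i, β i) := by
        simp only [MvPolynomial.monomial_pow]
        rw [← MvPolynomial.monomial_sum_prod, Finset.prod_pow_eq_pow_sum]
        congr 1
        ext k
        simp [Finsupp.single_apply]
      rw [this, MvPolynomial.algebraMap_eq, MvPolynomial.C_mul_monomial, MvPolynomial.coeff_monomial, MvPolynomial.coeff_monomial]
      split_ifs with h
      · rw [h, mul_comm]
      · rw [mul_zero]
  have h5 : G = 0 := by
    ext α
    have := DFunLike.congr_fun h3 G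
    rw [AlgHom.comp_apply, h2] at this
    have h6 := h4 G α
    rw [← this, MvPolynomial.coeff_zero] at h6
    rw [MvPolynomial.coeff_zero]
    exact TF_self (R := R) _ (pow_mem ha _) _ h6.symm
  rw [h5, map_zero] at h1
  exact rees_TF _ (pow_mem ha N) _ h1

def Ad (κ : Type) [Fintype κ] (j : ℕ) := {α : κ →₀ ℕ // ∑ i, α i = j}

instance (j : ℕ) : Finite (Ad κ j) := by
  classical
  refine Finite.of_injective (β := ↥(Finset.finsuppAntidiag (Finset.univ : Finset κ) j)) (fun α => ⟨α.1, by rw [Finset.mem_finsuppAntidiag]; exact ⟨α.2, Finset.subset_univ _⟩⟩) ?_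
  intro a b h
  exact Subtype.ext (congrArg (fun t => t.1) h)

instance (j : ℕ) : Fintype (Ad κ j) := Fintype.ofFinite _
instance (j : ℕ) : DecidableEq (Ad κ j) := Classical.decEq _

def WIe (I : κ → Ideal R) (j : ℕ) : WI I j ≃ₗ[R] (Π α : Ad κ j, ↥(PI I α.1)) where
  toFun G := fun α => ⟨G.1.coeff α.1, (G.2 α.1).1⟩
  map_add' G H := by ext; simp
  map_smul' c H := by ext; simp
  invFun g := ⟨∑ α : Ad κ j, MvPolynomial.monomial α.1 (g α).1, sum_mem fun α _ => WI_mono (g α).2 α.2⟩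
  left_inv G := by
    apply Subtype.ext
    ext β
    simp only [MvPolynomial.coeff_sum, MvPolynomial.coeff_monomial]
    by_cases h : ∑ i, β i = j
    · rw [Finset.sum_eq_single ⟨β, h⟩]
      · simp
      · intro b _ hb; rw [if_neg]; intro h'; exact hb (Subtype.ext h')
      · intro h'; exact absurd (Finset.mem_univ _) h'
    · rw [(G.2 β).2 h]
      refine Finset.sum_eq_zero fun a _ => ?_
      rw [if_neg]; rintro rfl; exact h a.2
  right_inv g := by
    ext α
    simp only [MvPolynomial.coeff_sum, MvPolynomial.coeff_monomial]
    rw [Finset.sum_eq_single α]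
    · simp
    · intro b _ hb; rw [if_neg]; intro h'; exact hb (Subtype.ext h')
    · simp

theorem reesPower_equiv {I : κ → Ideal R} {φ : E →ₗ[R] (κ → R)} (hφ : ∀ v, (∃ y, φ y = v) ↔ ∀ i, v i ∈ I i)
    (hinj : Function.Injective φ) {a : R} (ha : a ∈ nonZeroDivisors R) (haI : ∀ i, a ∈ I i) (j : ℕ) :
    Nonempty (reesPower R E j ≃ₗ[R] (Π α : Ad κ j, ↥(PI I α.1))) := by
  have h := rees_inj hφ hinj ha haI
  have h2 : (reesPower R E j).map (reesLift (TF_mv TF_self) (lf κ R ∘ₗ φ)).toLinearMap = WI I j := by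
    rw [reesPower_eq, Submodule.map_pow, ← range_pow_eq hφ]
    congr 1
    rw [← LinearMap.range_comp]
    congr 1
    ext1 y
    rw [LinearMap.comp_apply, reesL_apply]
    exact reesLift_ι (TF_mv TF_self) _ _
  exact ⟨(Submodule.equivMapOfInjective _ h (reesPower R E j)).trans ((LinearEquiv.ofEq _ _ h2).trans (WIe I j))⟩

end Rees4
end S9

namespace S9
open CategoryTheory

section Rees5
variable {R : Type u} [CommRing R] 

theorem reesPower_F (m d : ℕ) : Nonempty (reesPower R (Fin m → R) d ≃ₗ[R] (Ad (Fin m) d → R)) := by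
  obtain ⟨f⟩ := reesPower_equiv (R := R) (κ := Fin m) (I := fun _ => ⊤) (φ := LinearMap.id) (by simp) (fun _ _ h => h) (one_mem _) (by simp) d
  have h : ∀ α : Ad (Fin m) d, PI (fun _ => (⊤ : Ideal R)) α.1 = ⊤ := fun α => by
    unfold PI
    simp [← Ideal.one_eq_top]
  exact ⟨f.trans (LinearEquiv.piCongrRight fun α => (LinearEquiv.ofEq _ _ (h α)).trans Submodule.topEquiv)⟩

variable {E : Type u} [AddCommGroup E] [Module R E] {I : Ideal R}

theorem reesPower_E {m : ℕ} (e : E ≃ₗ[R] (↥I × (Fin m → R))) {a : R} (ha : a ∈ nonZeroDivisors R) (haI : a ∈ I) (j : ℕ) :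
    Nonempty (reesPower R E j ≃ₗ[R] (Π α : Ad (Option (Fin m)) j, ↥(I ^ α.1 none))) := by
  let φ : E →ₗ[R] (Option (Fin m) → R) := LinearMap.pi fun o => o.elim (I.subtype ∘ₗ LinearMap.fst R _ _ ∘ₗ e.toLinearMap) fun k => LinearMap.proj k ∘ₗ LinearMap.snd R _ _ ∘ₗ e.toLinearMap
  have h1 : ∀ y, φ y none = (e y).1.1 := fun y => rfl
  have h2 : ∀ y k, φ y (some k) = (e y).2 k := fun y k => rfl
  obtain ⟨f⟩ := reesPower_equiv (R := R) (κ := Option (Fin m)) (I := fun o => o.elim I fun _ => ⊤) (φ := φ) (by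
      intro v
      constructor
      · rintro ⟨y, rfl⟩ (_ | k)
        · rw [h1]; exact (e y).1.2
        · trivial
      · intro h
        refine ⟨e.symm (⟨v none, h none⟩, fun k => v (some k)), ?_⟩
        ext (_ | k)
        · rw [h1, e.apply_symm_apply]
        · rw [h2, e.apply_symm_apply]) (by
      intro y z h
      apply e.injective
      refine Prod.ext (Subtype.ext ?_) ?_
      · rw [← h1, h, h1]
      · ext k; rw [← h2, h, h2]) ha (by
      rintro (_ | k)
      · exact haI
      · trivial) j
  have h : ∀ α : Ad (Option (Fin m)) j, PI (fun o : Option (Fin m) => o.elim I fun _ => ⊤) α.1 = I ^ α.1 none := fun α => by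
    unfold PI
    rw [Fintype.prod_option, Finset.prod_eq_one, mul_one]
    · rfl
    · intro i _; simp [← Ideal.one_eq_top]
  exact ⟨f.trans (LinearEquiv.piCongrRight fun α => LinearEquiv.ofEq _ _ (h α))⟩

def AdE (m j : ℕ) (x : Σ i : Fin (j + 1), Ad (Fin m) (j - i)) : Ad (Option (Fin m)) j :=
  ⟨x.2.1.optionElim x.1.1, by
    rw [Fintype.sum_option]
    simp only [Finsupp.optionElim_apply_none, Finsupp.optionElim_apply_some]
    rw [x.2.2]; omega⟩

theorem AdE_bij (m j : ℕ) : Function.Bijective (AdE m j) := by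
  constructor
  · rintro ⟨i, β, hβ⟩ ⟨i', β', hβ'⟩ h
    have h' : β.optionElim i.1 = β'.optionElim i'.1 := congrArg Subtype.val h
    have h1 := DFunLike.congr_fun h' none
    rw [Finsupp.optionElim_apply_none, Finsupp.optionElim_apply_none] at h1
    have h2 : i = i' := Fin.ext h1
    subst h2
    congr 2
    ext k
    have h1 := DFunLike.congr_fun h' (some k)
    rwa [Finsupp.optionElim_apply_some, Finsupp.optionElim_apply_some] at h1
  · rintro ⟨α, hα⟩
    rw [Fintype.sum_option] at hα
    refine ⟨⟨⟨α none, by omega⟩, α.some, ?_⟩, ?_⟩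
    · simp only [Finsupp.some_apply]; omega
    · apply Subtype.ext
      ext (_ | k)
      · exact Finsupp.optionElim_apply_none _ _
      · exact Finsupp.optionElim_apply_some _ _ _

theorem rees_iso {m : ℕ} (e : E ≃ₗ[R] (↥I × (Fin m → R))) {a : R} (ha : a ∈ nonZeroDivisors R) (haI : a ∈ I) (j : ℕ) :
    Nonempty (reesPower R E j ≃ₗ[R] Π i : Fin (j + 1), (↥(I ^ (i : ℕ)) ⊗[R] ↥(reesPower R (Fin m → R) (j - i)))) := by
  obtain ⟨f⟩ := reesPower_E e ha haI j
  let b := Equiv.ofBijective _ (AdE_bij m j)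
  let g1 := (LinearEquiv.piCongrLeft R (fun α : Ad (Option (Fin m)) j => ↥(I ^ α.1 none)) b).symm
  have h : ∀ x : Σ i : Fin (j + 1), Ad (Fin m) (j - i), I ^ (b x).1 none = I ^ (x.1 : ℕ) := fun x => by
    congr 1
    exact Finsupp.optionElim_apply_none _ _
  let g2 := LinearEquiv.piCongrRight (R := R) fun x => LinearEquiv.ofEq _ _ (h x)
  let g3 := LinearEquiv.piCurry R (fun (i : Fin (j + 1)) (β : Ad (Fin m) (j - i)) => ↥(I ^ (i : ℕ)))
  let g4 := LinearEquiv.piCongrRight (R := R) fun i : Fin (j + 1) => 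
    (TensorProduct.piScalarRight R R ↥(I ^ (i : ℕ)) (Ad (Fin m) (j - i))).symm.trans 
      (TensorProduct.congr (LinearEquiv.refl R _) (reesPower_F (R := R) m (j - i)).some.symm)
  exact ⟨f.trans (g1.trans (g2.trans (g3.trans g4)))⟩

theorem rees_V {m : ℕ} (p : Ideal R) [hp : p.IsPrime] (e : E ≃ₗ[R] (↥I × (Fin m → R))) {a : R} (ha : a ∈ nonZeroDivisors R) (haI : a ∈ I) (j k : ℕ)
   (h : ∀ t ≤ j, V p ↥(I ^ t) k) : V p (reesPower R E j) k := by
  obtain ⟨f⟩ := reesPower_E e ha haI j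
  refine V_equiv p (f.trans (LinearEquiv.piCongrLeft' R (fun α : Ad (Option (Fin m)) j => ↥(I ^ α.1 none)) (Fintype.equivFin _))) (V_pi p fun i => h _ ?_)
  have := ((Fintype.equivFin (Ad (Option (Fin m)) j)).symm i).2
  rw [Fintype.sum_option] at this
  omega

end Rees5
end S9

namespace S9
open CategoryTheory

section DimGe

theorem dim_int {A C : Type*} [CommRing A] [CommRing C] [Algebra A C] [Algebra.IsIntegral A C]
    (hinj : Function.Injective (algebraMap A C)) : ringKrullDim A ≤ ringKrullDim C := by
  refine iSup_le fun l => ?_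
  obtain ⟨Q, -, hQ, hQ'⟩ := Ideal.exists_ideal_over_prime_of_isIntegral (S := C) (RelSeries.head l).asIdeal ⊥ (by
    rw [← RingHom.ker_eq_comap_bot, (RingHom.injective_iff_ker_eq_bot _).1 hinj]; exact bot_le)
  have : Q.LiesOver (RelSeries.head l).asIdeal := ⟨hQ'.symm⟩
  obtain ⟨L, hL, -⟩ := Ideal.exists_ltSeries_of_hasGoingUp l Q
  rw [← hL]
  exact le_iSup (fun p : LTSeries (PrimeSpectrum C) => ((p.length : ℕ) : WithBot ℕ∞)) L

theorem dim_ge {k : Type u} [Field k] {B : Type u} [CommRing B] [Algebra k B] [Algebra.FiniteType k B] {n : ℕ}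
    (f : MvPolynomial (Fin n) k →ₐ[k] B) (hf : Function.Injective f) : (n : WithBot ℕ∞) ≤ ringKrullDim B := by
  obtain ⟨Q, hQ, hQ'⟩ := Ideal.exists_comap_eq_of_mem_minimalPrimes_of_injective (f := f.toRingHom) hf ⊥ (by
    rw [IsDomain.minimalPrimes_eq_singleton_bot]; rfl)
  refine le_trans ?_ (ringKrullDim_quotient_le Q)
  let g : MvPolynomial (Fin n) k →ₐ[k] B ⧸ Q := (Ideal.Quotient.mkₐ k Q).comp f
  have hg : Function.Injective g := by
    rw [injective_iff_map_eq_zero]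
    intro a ha
    have : a ∈ Q.comap f.toRingHom := Ideal.mem_comap.2 (Ideal.Quotient.eq_zero_iff_mem.1 (show Ideal.Quotient.mk Q (f a) = 0 from ha))
    rw [hQ'] at this
    exact this
  obtain ⟨s, h, hh, hi⟩ := exists_integral_inj_algHom_of_fg k (B ⧸ Q)
  have h1 : n ≤ s := by
    have e1 : AlgebraicIndependent k fun i => g (MvPolynomial.X i) := by
      have : MvPolynomial.aeval (fun i => g (MvPolynomial.X i)) = g := by ext; simp
      unfold AlgebraicIndependent
      rw [this]; exact hg
    have e2 := e1.lift_cardinalMk_le_trdeg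
    let S : Set (B ⧸ Q) := Set.range fun i => h (MvPolynomial.X i)
    have : Algebra.IsAlgebraic (Algebra.adjoin k S) (B ⧸ Q) := by
      have : Algebra.IsIntegral (Algebra.adjoin k S) (B ⧸ Q) := by
        constructor
        intro b
        have hb := hi b
        have hr : ∀ y, h y ∈ Algebra.adjoin k S := by
          intro y
          have : Algebra.adjoin k S = h.range := by
            have : MvPolynomial.aeval (fun i => h (MvPolynomial.X i)) = h := by ext; simp
            rw [Algebra.adjoin_range_eq_range_aeval, this]
          rw [this]; exact ⟨y, rfl⟩
        obtain ⟨p, hp1, hp2⟩ := hb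
        let h' : MvPolynomial (Fin s) k →ₐ[k] Algebra.adjoin k S := h.codRestrict _ hr
        refine ⟨p.map h'.toRingHom, hp1.map _, ?_⟩
        rw [Polynomial.eval₂_map]
        exact hp2
      exact Algebra.IsIntegral.isAlgebraic
    have e3 := Algebra.IsAlgebraic.trdeg_le_cardinalMk k (A := B ⧸ Q) S
    have e4 : Cardinal.mk S ≤ s := by
      refine Cardinal.mk_range_le_lift (f := fun i => h (MvPolynomial.X i)) |> fun t => ?_
      have t' : Cardinal.lift.{0} (Cardinal.mk S) ≤ Cardinal.lift.{u} (Cardinal.mk (Fin s)) := t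
      simpa using t'
    have e5 := e3.trans e4
    simp only [Cardinal.mk_fin, Cardinal.lift_natCast, Cardinal.lift_uzero] at e2
    have e6 : (n : Cardinal.{u}) ≤ (s : Cardinal.{u}) := e2.trans (by simpa using e5)
    exact_mod_cast e6
  have h2 : (s : WithBot ℕ∞) ≤ ringKrullDim (B ⧸ Q) := by
    let : Algebra (MvPolynomial (Fin s) k) (B ⧸ Q) := h.toRingHom.toAlgebra
    have : Algebra.IsIntegral (MvPolynomial (Fin s) k) (B ⧸ Q) := ⟨hi⟩
    have h3 := dim_int (A := MvPolynomial (Fin s) k) (C := B ⧸ Q) hh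
    rw [MvPolynomial.ringKrullDim_of_isNoetherianRing, ringKrullDim_eq_zero_of_field, zero_add] at h3
    simpa using h3
  exact le_trans (by exact_mod_cast h1) h2

end DimGe
end S9

namespace S9
open CategoryTheory
open MvPolynomial (homogeneousComponent)

section Red
variable {A : Type*} [CommRing A] {ι : Type} [Fintype ι]

theorem hom_scale {σ : Type*} {B : Type*} [CommRing B] [Algebra A B] {P : MvPolynomial σ A} {D : ℕ} (hP : P.IsHomogeneous D) (t : B) (y : σ → B) :
    MvPolynomial.aeval (fun i => t * y i) P = t ^ D * MvPolynomial.aeval y P := by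
  rw [MvPolynomial.aeval_def, MvPolynomial.aeval_def, MvPolynomial.eval₂_eq, MvPolynomial.eval₂_eq, Finset.mul_sum]
  refine Finset.sum_congr rfl fun α hα => ?_
  have h := hP (MvPolynomial.mem_support_iff.1 hα)
  simp only [mul_pow]
  rw [Finset.prod_mul_distrib, Finset.prod_pow_eq_pow_sum]
  have h' : ∑ i ∈ α.support, α i = D := by
    rw [← h, Finsupp.weight_apply]; simp [Finsupp.sum]
  rw [h']; ring

theorem evP_mem (x : ι → A) (f : MvPolynomial ι A) (D : ℕ) : (evP x f).coeff D ∈ Ideal.span (Set.range x) ^ D := by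
  rw [evP_coeff, Ideal.mem_span_pow_iff_exists_isHomogeneous]
  exact ⟨_, MvPolynomial.homogeneousComponent_isHomogeneous D f, rfl⟩

def LL (M : Ideal A) (x : ι → A) : Ideal (MvPolynomial ι A) where
  carrier := {f | ∀ D, (evP x f).coeff D ∈ M * Ideal.span (Set.range x) ^ D}
  zero_mem' := fun D => by simp
  add_mem' := fun ha hb D => by rw [map_add, Polynomial.coeff_add]; exact add_mem (ha D) (hb D)
  smul_mem' := by
    intro c a ha D
    rw [smul_eq_mul, map_mul, Polynomial.coeff_mul]
    refine Ideal.sum_mem _ fun ij hij => ?_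
    rw [← Finset.HasAntidiagonal.mem_antidiagonal.1 hij, pow_add, ← mul_assoc, mul_comm _ (_ ^ ij.1), mul_assoc]
    exact Ideal.mul_mem_mul (evP_mem x c ij.1) (ha ij.2)

theorem LL_comp {M : Ideal A} {x : ι → A} {f : MvPolynomial ι A} (hf : f ∈ LL M x) (D : ℕ) : homogeneousComponent D f ∈ LL M x := by
  intro D'
  rw [evP_hom x (MvPolynomial.homogeneousComponent_isHomogeneous D f), Polynomial.coeff_C_mul_X_pow]
  split_ifs with h
  · rw [h, ← evP_coeff]; exact hf D
  · exact zero_mem _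

def Red (M : Ideal A) (x : ι → A) {r : ℕ} (Y : Fin r → MvPolynomial ι A) : Prop :=
  ∀ Q : Ideal (MvPolynomial ι A), Q.IsPrime → LL M x ≤ Q → Q.comap MvPolynomial.C ≤ M → (∀ i, Y i ∈ Q) → ∀ j, MvPolynomial.X j ∈ Q

theorem red_step (M : Ideal A) [hM : M.IsPrime] [Infinite (A ⧸ M)] {x : ι → A} {r D : ℕ} {Y : Fin (r + 1) → MvPolynomial ι A}
    (hY : ∀ i, (Y i).IsHomogeneous 1) (hr : Red M x Y) {P : MvPolynomial (Fin (r + 1)) A} (hP : P.IsHomogeneous D)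
    (hP' : ∃ α, P.coeff α ∉ M) (hPL : MvPolynomial.aeval Y P ∈ LL M x) :
    ∃ Y' : Fin r → MvPolynomial ι A, (∀ i, (Y' i).IsHomogeneous 1) ∧ Red M x Y' := by
  have h1 : ∃ c : Fin (r + 1) → A, c (Fin.last r) ∉ M ∧ MvPolynomial.eval c P ∉ M := by
    have h2 : MvPolynomial.map (Ideal.Quotient.mk M) P * MvPolynomial.X (Fin.last r) ≠ 0 := by
      refine mul_ne_zero ?_ (MvPolynomial.X_ne_zero _)
      obtain ⟨α, hα⟩ := hP'
      intro h
      apply hα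
      rw [← Ideal.Quotient.eq_zero_iff_mem, ← MvPolynomial.coeff_map, h, MvPolynomial.coeff_zero]
    have h3 : ∃ c, MvPolynomial.eval c (MvPolynomial.map (Ideal.Quotient.mk M) P * MvPolynomial.X (Fin.last r)) ≠ 0 := by
      by_contra h
      push Not at h
      exact h2 (MvPolynomial.funext fun c => by rw [h c, map_zero])
    obtain ⟨c, hc⟩ := h3
    obtain ⟨c', rfl⟩ : ∃ c' : Fin (r + 1) → A, (fun i => Ideal.Quotient.mk M (c' i)) = c := by
      choose g hg using fun i => Ideal.Quotient.mk_surjective (I := M) (c i)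
      exact ⟨g, funext hg⟩
    rw [map_mul, MvPolynomial.eval_X] at hc
    refine ⟨c', fun h => ?_, fun h => ?_⟩
    · exact hc (by rw [Ideal.Quotient.eq_zero_iff_mem.2 h, mul_zero])
    · apply hc
      rw [MvPolynomial.eval_map, ← Function.comp_def, ← MvPolynomial.eval₂_comp]
      rw [Ideal.Quotient.eq_zero_iff_mem.2 h, zero_mul]
  obtain ⟨c, hc1, hc2⟩ := h1
  refine ⟨fun i => MvPolynomial.C (c (Fin.last r)) * Y i.castSucc - MvPolynomial.C (c i.castSucc) * Y (Fin.last r), fun i => ?_, ?_⟩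
  · exact (((MvPolynomial.isHomogeneous_C _ _).mul (hY _)).sub ((MvPolynomial.isHomogeneous_C _ _).mul (hY _)))  |> fun h => by simpa using h
  · intro Q hQ hLQ hQM hYQ
    refine hr Q hQ hLQ hQM ?_
    have hcQ : ∀ a : A, a ∉ M → Ideal.Quotient.mk Q (MvPolynomial.C a) ≠ 0 := fun a ha h => ha (hQM (Ideal.mem_comap.2 (Ideal.Quotient.eq_zero_iff_mem.1 h)))
    let q := Ideal.Quotient.mk Q
    have h4 : ∀ i, q (MvPolynomial.C (c (Fin.last r))) * q (Y i) = q (Y (Fin.last r)) * q (MvPolynomial.C (c i)) := by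
      intro i
      induction i using Fin.lastCases with
      | last => rw [mul_comm]
      | cast i =>
        have := Ideal.Quotient.eq_zero_iff_mem.2 (hYQ i)
        rw [map_sub, sub_eq_zero, map_mul, map_mul] at this
        rw [this, mul_comm]
    have h5 := hom_scale hP (q (MvPolynomial.C (c (Fin.last r)))) (fun i => q (Y i))
    have h6 := hom_scale hP (q (Y (Fin.last r))) (fun i => q (MvPolynomial.C (c i)))
    simp only [h4] at h5
    rw [h6] at h5
    have h7 : MvPolynomial.aeval (fun i => q (Y i)) P = q (MvPolynomial.aeval Y P) := by
      have := MvPolynomial.map_aeval Y (Ideal.Quotient.mkₐ A Q).toRingHom P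
      rw [MvPolynomial.aeval_def]
      exact this.symm
    have h8 : MvPolynomial.aeval (fun i => q (MvPolynomial.C (c i))) P = q (MvPolynomial.C (MvPolynomial.eval c P)) := by
      have := MvPolynomial.map_aeval c (q.comp MvPolynomial.C) P
      rw [MvPolynomial.aeval_def]
      rw [MvPolynomial.aeval_eq_eval] at this
      exact this.symm
    rw [h7, Ideal.Quotient.eq_zero_iff_mem.2 (hLQ hPL), mul_zero, h8] at h5
    have h9 : q (Y (Fin.last r)) = 0 := by
      rcases mul_eq_zero.1 h5 with h | h
      · exact eq_zero_of_pow_eq_zero h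
      · exact absurd h (hcQ _ hc2)
    intro i
    have := h4 i
    rw [h9, zero_mul] at this
    exact Ideal.Quotient.eq_zero_iff_mem.1 ((mul_eq_zero.1 this).resolve_left (hcQ _ hc1))

theorem red_exists (M : Ideal A) [hM : M.IsPrime] [Infinite (A ⧸ M)] {x : ι → A} {ℓ : ℕ}
    (hdep : ∀ r > ℓ, ∀ Y : Fin r → MvPolynomial ι A, (∀ i, (Y i).IsHomogeneous 1) → ∃ D, ∃ P : MvPolynomial (Fin r) A, 
      P.IsHomogeneous D ∧ (∃ α, P.coeff α ∉ M) ∧ MvPolynomial.aeval Y P ∈ LL M x) :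
    ∃ r ≤ ℓ, ∃ Y : Fin r → MvPolynomial ι A, (∀ i, (Y i).IsHomogeneous 1) ∧ Red M x Y := by
  have key : ∀ r, ∀ Y : Fin r → MvPolynomial ι A, (∀ i, (Y i).IsHomogeneous 1) → Red M x Y → 
      ∃ r ≤ ℓ, ∃ Y : Fin r → MvPolynomial ι A, (∀ i, (Y i).IsHomogeneous 1) ∧ Red M x Y := by
    intro r
    induction r with
    | zero => exact fun Y h1 h2 => ⟨0, by omega, Y, h1, h2⟩
    | succ r ih =>
      intro Y h1 h2
      by_cases h : r + 1 ≤ ℓ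
      · exact ⟨r + 1, h, Y, h1, h2⟩
      · obtain ⟨D, P, hP1, hP2, hP3⟩ := hdep (r + 1) (by omega) Y h1
        obtain ⟨Y', h3, h4⟩ := red_step M h1 h2 hP1 hP2 hP3
        exact ih Y' h3 h4
  refine key (Fintype.card ι) (fun i => MvPolynomial.X ((Fintype.equivFin ι).symm i)) (fun i => MvPolynomial.isHomogeneous_X _ _) ?_
  intro Q _ _ _ h j
  simpa using h (Fintype.equivFin ι j)

theorem nak_loc (M : Ideal A) [hM : M.IsPrime] {N N' : Ideal A} (hN : N.FG) {s : A} (hs : s ∉ M)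
    (h : ∀ u ∈ N, s * u ∈ M * N ⊔ N') : ∃ s' ∉ M, ∀ u ∈ N, s' * u ∈ N' := by
  let W : Submodule A ↥N := Submodule.comap N.subtype N'
  have hfin : Module.Finite A ↥N := Module.Finite.iff_fg.2 hN
  let f : Module.End A (↥N ⧸ W) := s • LinearMap.id
  have hmul : ∀ v ∈ M * N, ∀ hv : v ∈ N, W.mkQ ⟨v, hv⟩ ∈ M • (⊤ : Submodule A (↥N ⧸ W)) := by
    intro v hv
    induction hv using Submodule.mul_induction_on' with
    | mem_mul_mem a ha b hb =>
      intro hv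
      have : W.mkQ ⟨a * b, hv⟩ = a • W.mkQ ⟨b, hb⟩ := by rw [← map_smul]; rfl
      rw [this]
      exact Submodule.smul_mem_smul ha trivial
    | add a ha b hb h1 h2 =>
      intro hv
      have : W.mkQ ⟨a + b, hv⟩ = W.mkQ ⟨a, Ideal.mul_le_right ha⟩ + W.mkQ ⟨b, Ideal.mul_le_right hb⟩ := by
        rw [← map_add]; rfl
      rw [this]
      exact add_mem (h1 _) (h2 _)
  have hr : LinearMap.range f ≤ M • ⊤ := by
    rintro _ ⟨y, rfl⟩
    obtain ⟨⟨u, hu⟩, rfl⟩ := W.mkQ_surjective y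
    obtain ⟨v, hv, w, hw, hvw⟩ := Submodule.mem_sup.1 (h u hu)
    have : f (W.mkQ ⟨u, hu⟩) = W.mkQ ⟨v, Ideal.mul_le_right hv⟩ := by
      show s • W.mkQ ⟨u, hu⟩ = _
      rw [← map_smul, ← sub_eq_zero, ← map_sub, ← LinearMap.mem_ker, Submodule.ker_mkQ]
      show s * u - v ∈ N'
      rw [← hvw]; simpa using hw
    rw [this]
    exact hmul v hv _
  obtain ⟨p, hp1, -, hp2, hp3⟩ := LinearMap.exists_monic_and_natDegree_eq_and_coeff_mem_pow_and_aeval_eq_zero A f M hr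
  have h5 : ∀ q : Polynomial A, Polynomial.aeval f q = (q.eval s) • LinearMap.id := by
    intro q
    have : f = algebraMap A (Module.End A (↥N ⧸ W)) s := by rw [Algebra.algebraMap_eq_smul_one]; rfl
    rw [this, Polynomial.aeval_algebraMap_apply, Polynomial.coe_aeval_eq_eval, Algebra.algebraMap_eq_smul_one]; rfl
  refine ⟨p.eval s, ?_, fun u hu => ?_⟩
  · rw [Polynomial.eval_eq_sum_range, Finset.sum_range_succ, hp1.coeff_natDegree, one_mul]
    intro h
    have h6 : ∑ i ∈ Finset.range p.natDegree, p.coeff i * s ^ i ∈ M := by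
      refine Ideal.sum_mem _ fun i hi => Ideal.mul_mem_right _ _ ?_
      exact Ideal.pow_le_self (by have := Finset.mem_range.1 hi; omega) (hp2 i)
    exact hs (hM.mem_of_pow_mem _ ((Ideal.add_mem_iff_right _ h6).1 h))
  · rw [h5] at hp3
    have := LinearMap.congr_fun hp3 (W.mkQ ⟨u, hu⟩)
    rw [LinearMap.smul_apply, LinearMap.id_apply, ← map_smul, LinearMap.zero_apply, ← LinearMap.mem_ker, Submodule.ker_mkQ] at this
    exact this

theorem red_final [IsNoetherianRing A] (M : Ideal A) [hM : M.IsPrime] {x : ι → A} {r : ℕ} {Y : Fin r → MvPolynomial ι A}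
    (hY : ∀ i, (Y i).IsHomogeneous 1) (hr : Red M x Y) :
    ∃ s ∉ M, ∃ N : ℕ, ∀ u ∈ Ideal.span (Set.range x) ^ (N + 1), 
      s * u ∈ Ideal.span (Set.range fun i => MvPolynomial.eval x (Y i)) * Ideal.span (Set.range x) ^ N := by
  let K := LL M x ⊔ Ideal.span (Set.range Y)
  have h1 : ∀ j, ∃ s ∉ M, ∃ N : ℕ, MvPolynomial.C s * MvPolynomial.X j ^ N ∈ K := by
    intro j
    by_contra hcon
    push Not at hcon
    let T : Submonoid (MvPolynomial ι A) := 
      { carrier := {f | ∃ s ∉ M, ∃ N : ℕ, f = MvPolynomial.C s * MvPolynomial.X j ^ N}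
        one_mem' := ⟨1, hM.one_notMem, 0, by simp⟩
        mul_mem' := by
          rintro _ _ ⟨s, hs, N, rfl⟩ ⟨t, ht, L, rfl⟩
          exact ⟨s * t, mul_nmem M hs ht, N + L, by rw [map_mul, pow_add]; ring⟩ }
    obtain ⟨Q, hQ, hKQ, hd⟩ := Ideal.exists_le_prime_disjoint K T (by
      rw [Set.disjoint_left]
      rintro f hf ⟨s, hs, N, rfl⟩
      exact hcon s hs N hf)
    rw [Set.disjoint_left] at hd
    have := hr Q hQ (le_sup_left.trans hKQ) (by
      intro a ha
      by_contra h
      exact hd (a := MvPolynomial.C a) ha ⟨a, h, 0, by simp⟩) (fun i => hKQ (Ideal.mem_sup_right (Ideal.subset_span ⟨i, rfl⟩))) j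
    exact hd this ⟨1, hM.one_notMem, 1, by simp⟩
  choose s hs N hN using h1
  let s0 := ∏ j, s j
  have hs0 : s0 ∉ M := by
    intro h
    obtain ⟨j, -, hj⟩ := (hM.prod_mem_iff).1 h
    exact hs j hj
  let K' : Ideal (MvPolynomial ι A) := 
    { carrier := {f | MvPolynomial.C s0 * f ∈ K}
      zero_mem' := by simp
      add_mem' := fun ha hb => by
        simp only [Set.mem_ofPred_eq] at *
        rw [mul_add]; exact add_mem ha hb
      smul_mem' := fun c f hf => by
        simp only [Set.mem_ofPred_eq] at *
        rw [smul_eq_mul, mul_left_comm]; exact Ideal.mul_mem_left _ _ hf }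
  have h2 : MvPolynomial.idealOfVars ι A ≤ K'.radical := by
    classical
    unfold MvPolynomial.idealOfVars
    rw [Ideal.span_le]
    rintro _ ⟨j, rfl⟩
    refine ⟨N j, ?_⟩
    show MvPolynomial.C (∏ j, s j) * _ ∈ K
    rw [← Finset.prod_erase_mul _ _ (Finset.mem_univ j), map_mul, mul_assoc]
    exact Ideal.mul_mem_left _ _ (hN j)
  obtain ⟨n, hn⟩ := Ideal.exists_pow_le_of_le_radical_of_fg h2 (MvPolynomial.idealOfVars_fg ι A)
  have h3 : ∀ u ∈ Ideal.span (Set.range x) ^ (n + 1), 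
      s0 * u ∈ M * Ideal.span (Set.range x) ^ (n + 1) ⊔ Ideal.span (Set.range fun i => MvPolynomial.eval x (Y i)) * Ideal.span (Set.range x) ^ n := by
    intro u hu
    obtain ⟨g, hg, rfl⟩ := (Ideal.mem_span_pow_iff_exists_isHomogeneous x u).1 hu
    have hgK : MvPolynomial.C s0 * g ∈ K := by
      refine hn ((MvPolynomial.mem_pow_idealOfVars_iff n g).2 fun α hα => ?_)
      have := hg (MvPolynomial.mem_support_iff.1 hα)
      have h' : α.degree = n + 1 := by rw [Finsupp.degree_eq_weight_one]; exact this
      omega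
    obtain ⟨l, hl, y, hy, hly⟩ := Submodule.mem_sup.1 hgK
    rw [Ideal.span, Submodule.mem_span_range_iff_exists_fun] at hy
    obtain ⟨b, hb⟩ := hy
    have h4 : MvPolynomial.eval x g = (evP x g).coeff (n + 1) := by
      rw [evP_hom x hg, Polynomial.coeff_C_mul_X_pow, if_pos rfl]
    have h5 : s0 * MvPolynomial.eval x g = (evP x (MvPolynomial.C s0 * g)).coeff (n + 1) := by
      rw [h4, map_mul, evP, MvPolynomial.aeval_C, Polynomial.algebraMap_eq, Polynomial.coeff_C_mul]
    rw [h5, ← hly, map_add, Polynomial.coeff_add]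
    refine add_mem (Ideal.mem_sup_left (hl _)) (Ideal.mem_sup_right ?_)
    rw [← hb, map_sum, Polynomial.finsetSum_coeff]
    refine Ideal.sum_mem _ fun i _ => ?_
    have h6 : ∀ e : A, evP x (b i) * (Polynomial.C e * Polynomial.X) = Polynomial.C e * (evP x (b i) * Polynomial.X) := fun e => by ring
    rw [smul_eq_mul, map_mul, evP_hom x (hY i), pow_one, h6, Polynomial.coeff_C_mul, Polynomial.coeff_mul_X]
    exact Ideal.mul_mem_mul (Ideal.subset_span ⟨i, rfl⟩) (evP_mem x _ n)
  obtain ⟨s', hs', h'⟩ := nak_loc M (IsNoetherian.noetherian _) hs0 h3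
  exact ⟨s', hs', n, h'⟩

end Red
end S9

namespace S9
open CategoryTheory
open MvPolynomial (homogeneousComponent)

section Dep
variable {R : Type u} [CommRing R] [IsLocalRing R] {ι : Type} [Fintype ι] {I : Ideal R}

abbrev M0 (R : Type u) [CommRing R] [IsLocalRing R] : Ideal (Polynomial R) := (IsLocalRing.maximalIdeal R).map Polynomial.C

instance M0_prime : (M0 R).IsPrime := Ideal.isPrime_map_C_of_isPrime

theorem M0_inf : Infinite (Polynomial R ⧸ M0 R) := by
  have e := (Ideal.polynomialQuotientEquivQuotientPolynomial (IsLocalRing.maximalIdeal R))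
  exact Infinite.of_injective e e.injective

theorem span_C {ι : Type*} (x : ι → R) : Ideal.span (Set.range fun j => (Polynomial.C (x j) : Polynomial R)) = (Ideal.span (Set.range x)).map Polynomial.C := by
  rw [Ideal.map_span, ← Set.range_comp]; rfl

abbrev Fb (I : Ideal R) := ReesModAlg R ↥I ⧸ fiberIdeal R ↥I

def tau0 (x : ι → ↥I) : MvPolynomial ι (Polynomial R) →+* Polynomial (ReesModAlg R ↥I) :=
  MvPolynomial.eval₂Hom (Polynomial.mapRingHom (algebraMap R (ReesModAlg R ↥I))) fun j => Polynomial.C (reesι R ↥I (x j))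

theorem swap_coeff (p : Polynomial (Polynomial R)) (a b : ℕ) : 
    ((Polynomial.Bivariate.swap p).coeff a).coeff b = (p.coeff b).coeff a := by
  induction p using Polynomial.induction_on' with
  | add p q hp hq => rw [map_add, Polynomial.coeff_add, Polynomial.coeff_add, hp, hq, Polynomial.coeff_add, Polynomial.coeff_add]
  | monomial n f =>
    induction f using Polynomial.induction_on' with
    | add p q hp hq => rw [map_add, map_add, Polynomial.coeff_add, Polynomial.coeff_add, hp, hq, Polynomial.coeff_add, Polynomial.coeff_add]
    | monomial m r =>
      rw [Polynomial.Bivariate.swap_monomial_monomial]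
      simp only [Polynomial.coeff_monomial]
      by_cases h1 : m = a <;> by_cases h2 : n = b <;> simp [h1, h2, Polynomial.coeff_monomial]

theorem tau0_swap (x : ι → ↥I) (f : MvPolynomial ι (Polynomial R)) :
    Polynomial.Bivariate.swap ((tau0 x f).map (ψI I).toRingHom) = evP (fun j => Polynomial.C (x j).1) f := by
  have : ((Polynomial.Bivariate.swap (R := R)).toRingEquiv.toRingHom.comp (Polynomial.mapRingHom (ψI I).toRingHom)).comp (tau0 x) = (evP (fun j => Polynomial.C (x j).1)).toRingHom := by
    apply MvPolynomial.ringHom_ext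
    · intro a
      have h1 : ((ψI I).toRingHom).comp (algebraMap R (ReesModAlg R ↥I)) = Polynomial.C := by
        ext r; simp
      simp [tau0, evP, Polynomial.map_map, h1, Polynomial.Bivariate.swap_map_C]
    · intro j
      have h1 : ψI I (reesι R ↥I (x j)) = Polynomial.C (x j).1 * Polynomial.X := by
        rw [ψI, reesLift_ι, θI_apply]
      simp [tau0, evP, h1, Polynomial.Bivariate.swap_C]
  exact RingHom.congr_fun this f

def tau (x : ι → ↥I) : MvPolynomial ι (Polynomial R) →+* Polynomial (Fb I) :=
  (Polynomial.mapRingHom (Ideal.Quotient.mk _)).comp (tau0 x)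

theorem LL_of_tau {x : ι → ↥I} (hx : Ideal.span (Set.range fun j => (x j).1) = I) {f : MvPolynomial ι (Polynomial R)} (h : tau x f = 0) :
    f ∈ LL (M0 R) (fun j => Polynomial.C (x j).1) := by
  intro D
  have h1 : Ideal.span (Set.range fun j => (Polynomial.C (x j).1 : Polynomial R)) = I.map Polynomial.C := by
    rw [span_C, hx]
  rw [h1, ← Ideal.map_pow, ← Ideal.map_mul, Ideal.mem_map_C_iff]
  intro n
  rw [← tau0_swap, swap_coeff, Polynomial.coeff_map]
  apply fiber_coeff
  have := congrArg (fun p => Polynomial.coeff p n) h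
  simp only [tau, RingHom.comp_apply, Polynomial.coe_mapRingHom, Polynomial.coeff_map, Polynomial.coeff_zero] at this
  exact Ideal.Quotient.eq_zero_iff_mem.1 this

theorem comp_aeval {σ A : Type*} [CommRing A] {Y : σ → MvPolynomial ι A} (hY : ∀ i, (Y i).IsHomogeneous 1) (P : MvPolynomial σ A) (D : ℕ) :
    homogeneousComponent D (MvPolynomial.aeval Y P) = MvPolynomial.aeval Y (homogeneousComponent D P) := by
  have hh : ∀ i, (MvPolynomial.aeval Y (homogeneousComponent i P)).IsHomogeneous i := fun i => by
    have := (MvPolynomial.homogeneousComponent_isHomogeneous i P).aeval Y hY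
    simpa using this
  conv_lhs => rw [← MvPolynomial.sum_homogeneousComponent P, map_sum, map_sum]
  rw [Finset.sum_congr rfl fun i _ => MvPolynomial.homogeneousComponent_of_mem (hh i)]
  rw [Finset.sum_ite_eq]
  split_ifs with h
  · rfl
  · rw [MvPolynomial.homogeneousComponent_eq_zero D P (by simpa using h), map_zero]

theorem dep_lemma [IsNoetherianRing R] {ℓ : ℕ} (hl : analyticSpread R ↥I = (ℓ : WithBot ℕ∞)) {x : ι → ↥I}
    (hx : Ideal.span (Set.range fun j => (x j).1) = I) (r : ℕ) (hr : ℓ < r) (Y : Fin r → MvPolynomial ι (Polynomial R))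
    (hY : ∀ i, (Y i).IsHomogeneous 1) : ∃ D, ∃ P : MvPolynomial (Fin r) (Polynomial R), 
      P.IsHomogeneous D ∧ (∃ α, P.coeff α ∉ M0 R) ∧ MvPolynomial.aeval Y P ∈ LL (M0 R) (fun j => Polynomial.C (x j).1) := by
  let k0 := IsLocalRing.ResidueField R
  let φ : k0 →+* Fb I := Ideal.Quotient.lift _ (algebraMap R (Fb I)) (fun a ha => by
    show Ideal.Quotient.mk _ (algebraMap R _ a) = 0
    exact Ideal.Quotient.eq_zero_iff_mem.2 (Ideal.mem_map_of_mem _ ha))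
  letI : Algebra k0 (Fb I) := φ.toAlgebra
  haveI : IsScalarTower R k0 (Fb I) := IsScalarTower.of_algebraMap_eq' (by ext r; rfl)
  have hft : Algebra.FiniteType R (Fb I) := 
    Algebra.FiniteType.of_surjective ((Ideal.Quotient.mkₐ R _).comp (presR x)) (by
      intro b
      obtain ⟨b, rfl⟩ := Ideal.Quotient.mk_surjective b
      obtain ⟨f, rfl⟩ := presR_surj (span_sub hx) b
      exact ⟨f, rfl⟩)
  haveI : Algebra.FiniteType k0 (Fb I) := Algebra.FiniteType.of_restrictScalars_finiteType R k0 _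
  haveI : IsNoetherianRing (Fb I) := Algebra.FiniteType.isNoetherianRing k0 _
  haveI : Algebra.FiniteType k0 (Polynomial (Fb I)) := Algebra.FiniteType.trans (S := Fb I) inferInstance inferInstance
  let h0 : MvPolynomial (Fin r) (Polynomial k0) →+* Polynomial (Fb I) :=
    MvPolynomial.eval₂Hom (Polynomial.mapRingHom (algebraMap k0 (Fb I))) (fun i => tau x (Y i))
  let h : MvPolynomial (Fin r) (Polynomial k0) →ₐ[k0] Polynomial (Fb I) :=
    { h0 with commutes' := fun c => by {
        show h0 (MvPolynomial.C (Polynomial.C c)) = _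
        simp only [h0, MvPolynomial.coe_eval₂Hom, MvPolynomial.eval₂_C, Polynomial.coe_mapRingHom, Polynomial.map_C]; rfl } }
  let ee : MvPolynomial (Fin (r + 1)) k0 ≃ₐ[k0] MvPolynomial (Fin r) (Polynomial k0) :=
    (MvPolynomial.renameEquiv k0 (finSuccEquiv r)).trans (MvPolynomial.optionEquivRight k0 (Fin r))
  have hni : ¬ Function.Injective h := by
    intro hinj
    have h1 := dim_ge (k := k0) (B := Polynomial (Fb I)) (n := r + 1) (h.comp (ee : MvPolynomial (Fin (r + 1)) k0 →ₐ[k0] MvPolynomial (Fin r) (Polynomial k0))) (by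
      intro a b hab; exact ee.injective (hinj hab))
    rw [Polynomial.ringKrullDim_of_isNoetherianRing] at h1
    have h2 : ringKrullDim (Fb I) = ℓ := hl
    rw [h2] at h1
    norm_cast at h1
    omega
  rw [injective_iff_map_eq_zero] at hni
  push Not at hni
  obtain ⟨pb, hp0, hpne⟩ := hni
  obtain ⟨P, rfl⟩ := MvPolynomial.map_surjective (Polynomial.mapRingHom (IsLocalRing.residue R)) (Polynomial.map_surjective _ IsLocalRing.residue_surjective) pb
  have h3 : tau x (MvPolynomial.aeval Y P) = 0 := by
    have hc : (tau x).comp (MvPolynomial.aeval Y : MvPolynomial (Fin r) (Polynomial R) →ₐ[Polynomial R] _).toRingHom = h0.comp (MvPolynomial.map (Polynomial.mapRingHom (IsLocalRing.residue R))) := by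
      apply MvPolynomial.ringHom_ext
      · intro a
        have hq : (algebraMap k0 (Fb I)).comp (IsLocalRing.residue R) = (Ideal.Quotient.mk (fiberIdeal R ↥I)).comp (algebraMap R (ReesModAlg R ↥I)) := by
          ext r; rfl
        simp [tau, tau0, h0, Polynomial.map_map, hq]
      · intro i
        simp [h0]
    exact (RingHom.congr_fun hc P).trans hp0
  have h4 := LL_of_tau hx h3
  obtain ⟨α, hα⟩ := MvPolynomial.ne_zero_iff.1 hpne
  refine ⟨α.degree, homogeneousComponent α.degree P, MvPolynomial.homogeneousComponent_isHomogeneous _ _, ⟨α, ?_⟩, ?_⟩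
  · rw [MvPolynomial.coeff_homogeneousComponent, if_pos rfl]
    intro hm
    apply hα
    rw [MvPolynomial.coeff_map]
    ext n
    rw [Polynomial.coe_mapRingHom, Polynomial.coeff_map, Polynomial.coeff_zero, IsLocalRing.residue_eq_zero_iff]
    exact Ideal.mem_map_C_iff.1 hm n
  · rw [← comp_aeval hY]
    exact LL_comp h4 _

theorem red_main [IsNoetherianRing R] {ℓ : ℕ} (hl : analyticSpread R ↥I = (ℓ : WithBot ℕ∞)) {x : ι → ↥I}
    (hx : Ideal.span (Set.range fun j => (x j).1) = I) :
    ∃ r ≤ ℓ, ∃ Y : Fin r → MvPolynomial ι (Polynomial R), (∀ i, (Y i).IsHomogeneous 1) ∧ 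
    ∃ s ∉ M0 R, ∃ N : ℕ, ∀ u ∈ I.map Polynomial.C ^ (N + 1), 
      s * u ∈ Ideal.span (Set.range fun i => MvPolynomial.eval (fun j => Polynomial.C (x j).1) (Y i)) * I.map Polynomial.C ^ N := by
  haveI := M0_inf (R := R)
  obtain ⟨r, hr, Y, hY, hR⟩ := red_exists (M0 R) (x := fun j => Polynomial.C (x j).1) (dep_lemma hl hx)
  have := red_final (M0 R) hY hR
  have h1 : Ideal.span (Set.range fun j => (Polynomial.C (x j).1 : Polynomial R)) = I.map Polynomial.C := by
    rw [span_C, hx]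
  rw [h1] at this
  exact ⟨r, hr, Y, hY, this⟩

end Dep
end S9

namespace S9
open CategoryTheory

section BC
variable {R : Type u} [CommRing R] [IsNoetherianRing R]

theorem bc_one {A B C : Type u} [AddCommGroup A] [AddCommGroup B] [AddCommGroup C] [Module R A] [Module R B] [Module R C] [Module.Finite R A]
    [Module.Free R B]
    (p : Ideal R) [hp : p.IsPrime] (P : Ideal (Polynomial R)) [hP : P.IsPrime] (hPp : P.comap Polynomial.C ≤ p)
    (f : A →ₗ[R] B) (g : B →ₗ[R] C) (hf : Function.Injective f) (hfg : Function.Exact f g) (hg : Function.Surjective g)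
    (h : V p C 1) : V P (Polynomial R ⊗[R] C) 1 := by
  obtain ⟨s, hs, hS⟩ := (V_one_iff p f g hf hfg hg).1 h
  rw [V_one_iff P (f.baseChange (Polynomial R)) (g.baseChange (Polynomial R)) (Module.Flat.lTensor_preserves_injective_linearMap f hf)
    (Module.Flat.lTensor_exact _ hfg) (LinearMap.lTensor_surjective _ hg)]
  refine ⟨Polynomial.C s, fun h => hs (hPp h), fun φ => ?_⟩
  choose ψ hψ using fun n => hS ((Polynomial.lcoeff R n) ∘ₗ (φ.restrictScalars R) ∘ₗ (TensorProduct.mk R (Polynomial R) A 1))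
  obtain ⟨m, a, ha⟩ := Module.Finite.exists_fin (R := R) (M := A)
  let N := Finset.univ.sup (fun i : Fin m => (φ (1 ⊗ₜ a i)).natDegree) + 1
  let ψ' : B →ₗ[R] Polynomial R := ∑ n ∈ Finset.range N, (Polynomial.monomial n) ∘ₗ ψ n
  refine ⟨LinearMap.liftBaseChange (Polynomial R) ψ', ?_⟩
  have key : (Polynomial.C s • φ).restrictScalars R ∘ₗ (TensorProduct.mk R (Polynomial R) A 1) = ψ' ∘ₗ f := by
    apply LinearMap.ext_on_range ha
    intro i
    have h1 : (φ (1 ⊗ₜ a i)).natDegree < N := Nat.lt_succ_of_le (Finset.le_sup (f := fun i : Fin m => (φ (1 ⊗ₜ a i)).natDegree) (Finset.mem_univ i))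
    show Polynomial.C s * φ (1 ⊗ₜ a i) = ψ' (f (a i))
    conv_lhs => rw [Polynomial.as_sum_range' _ N h1, Finset.mul_sum]
    simp only [ψ', LinearMap.sum_apply, LinearMap.comp_apply]
    refine Finset.sum_congr rfl fun n _ => ?_
    rw [Polynomial.C_mul_monomial]
    congr 1
    exact LinearMap.congr_fun (hψ n) (a i)
  ext a : 3
  have := LinearMap.congr_fun key a
  simpa using this

theorem bc_main (p : Ideal R) [hp : p.IsPrime] (P : Ideal (Polynomial R)) [hP : P.IsPrime] (hPp : P.comap Polynomial.C ≤ p) (k : ℕ) :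
    ∀ (C : Type u) [AddCommGroup C] [Module R C] [Module.Finite R C], V p C (k + 1) → V P (Polynomial R ⊗[R] C) (k + 1) := by
  induction k with
  | zero =>
    intro C _ _ _ h
    obtain ⟨n, g, hg⟩ := Module.Finite.exists_fin' R C
    exact bc_one p P hPp (LinearMap.ker g).subtype g (Submodule.injective_subtype _) (LinearMap.exact_subtype_ker_map g) hg h
  | succ k ih =>
    intro C _ _ _ h
    obtain ⟨n, g, hg⟩ := Module.Finite.exists_fin' R C
    have h1 := V_left p (LinearMap.ker g).subtype g (Submodule.injective_subtype _) (LinearMap.exact_subtype_ker_map g) hg (V_free p k) h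
    have h2 := ih _ h1
    exact V_right P ((LinearMap.ker g).subtype.baseChange (Polynomial R)) (g.baseChange (Polynomial R)) 
      (Module.Flat.lTensor_preserves_injective_linearMap _ (Submodule.injective_subtype _))
      (Module.Flat.lTensor_exact _ (LinearMap.exact_subtype_ker_map g)) (LinearMap.lTensor_surjective _ hg) h2 (V_free P _)

theorem bc_ker {σ τ : Type} [Fintype σ] [DecidableEq σ] (p : Ideal R) [hp : p.IsPrime] (P : Ideal (Polynomial R)) [hP : P.IsPrime] (hPp : P.comap Polynomial.C ≤ p)
    (K : Submodule R (σ → R)) (K' : Submodule (Polynomial R) (σ → Polynomial R)) (hK : ∀ v, v ∈ K' ↔ ∀ n, (fun i => (v i).coeff n) ∈ K)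
    (k : ℕ) (h : V p K (k + 1)) : V P K' (k + 1) := by
  let j0 : K →ₗ[R] K' := 
    { toFun := fun v => ⟨fun i => Polynomial.C (v.1 i), (hK _).2 fun n => by
        simp only [Polynomial.coeff_C]
        split_ifs
        · exact v.2
        · exact zero_mem _⟩
      map_add' := fun a b => by ext; simp
      map_smul' := fun c a => by ext; simp }
  let j := LinearMap.liftBaseChange (Polynomial R) j0
  have hcomp : ∀ z, (j z).1 = TensorProduct.piScalarRight R (Polynomial R) (Polynomial R) σ (K.subtype.baseChange (Polynomial R) z) := by
    intro z
    induction z using TensorProduct.induction_on with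
    | zero => simp
    | add a b ha hb => rw [map_add, map_add, map_add, ← ha, ← hb]; rfl
    | tmul a b =>
      ext i : 1
      simp [j, j0, Polynomial.smul_eq_C_mul, mul_comm]
  have hinj : Function.Injective j := by
    intro a b hab
    apply Module.Flat.lTensor_preserves_injective_linearMap (M := Polynomial R) K.subtype K.injective_subtype
    apply (TensorProduct.piScalarRight R (Polynomial R) (Polynomial R) σ).injective
    exact (hcomp a).symm.trans ((congrArg Subtype.val hab).trans (hcomp b))
  have hsurj : Function.Surjective j := by
    rintro ⟨v, hv⟩
    have hv' := (hK v).1 hv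
    let N := Finset.univ.sup (fun i => (v i).natDegree) + 1
    refine ⟨∑ n ∈ Finset.range N, (Polynomial.X ^ n) ⊗ₜ ⟨_, hv' n⟩, ?_⟩
    apply Subtype.ext
    rw [map_sum, AddSubmonoidClass.coe_finsetSum]
    ext i : 1
    have h1 : (v i).natDegree < N := Nat.lt_succ_of_le (Finset.le_sup (f := fun i => (v i).natDegree) (Finset.mem_univ i))
    refine Eq.trans ?_ (Polynomial.as_sum_range' _ N h1).symm
    rw [Finset.sum_apply]
    refine Finset.sum_congr rfl fun n _ => ?_
    simp [j, j0]
    rw [← Polynomial.C_mul_X_pow_eq_monomial, mul_comm]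
  exact V_equiv P (LinearEquiv.ofBijective j ⟨hinj, hsurj⟩).symm (bc_main p P hPp k K h)

theorem bc_Z {ι : Type} [LinearOrder ι] [Fintype ι] (x : ι → R) (p : Ideal R) [hp : p.IsPrime] (P : Ideal (Polynomial R)) [hP : P.IsPrime] (hPp : P.comap Polynomial.C ≤ p)
    (i k : ℕ) (h : V p (Zm x Finset.univ i) (k + 1)) : V P (Zm (fun j => Polynomial.C (x j)) Finset.univ i) (k + 1) := by
  refine bc_ker (τ := ι) p P hPp _ _ (fun v => ?_) k h
  simp only [Zm, Submodule.mem_inf, LinearMap.mem_ker]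
  have h1 : ∀ n, D x (fun T => (v T).coeff n) = fun T => ((D (fun j => Polynomial.C (x j)) v) T).coeff n := by
    intro n
    ext T
    rw [D_apply, D_apply, Finset.sum_apply, Finset.sum_apply, Polynomial.finsetSum_coeff]
    refine Finset.sum_congr rfl fun j _ => ?_
    simp only [Pi.smul_apply, pa_apply, smul_eq_mul]
    split_ifs
    · simp
    · rw [Polynomial.coeff_C_mul, zsmul_eq_mul, zsmul_eq_mul]
      rw [← Polynomial.C_eq_intCast, Polynomial.coeff_C_mul]
  constructor
  · rintro ⟨h2, h3, h4⟩ n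
    refine ⟨Sp_univ _, fun T hT => by simp [h3 T hT], ?_⟩
    rw [h1, h4]; ext; simp
  · intro h
    refine ⟨Sp_univ _, fun T hT => Polynomial.ext fun n => (h n).2.1 T hT, ?_⟩
    ext T n
    have := congrFun ((h1 n).symm.trans (h n).2.2) T
    simpa using this

theorem bc_ht (P : Ideal (Polynomial R)) [hP : P.IsPrime] : ht (P.comap Polynomial.C) ≤ ht P := by
  haveI : P.LiesOver (P.comap (Polynomial.C : R →+* _)) := ⟨rfl⟩
  have h := Ideal.height_eq_height_add_of_liesOver_of_hasGoingDown (P.comap (Polynomial.C : R →+* _)) P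
  rw [← coe_ht, ← coe_ht (P.comap _)] at h
  have h2 : (ht (P.comap Polynomial.C) : ℕ∞) ≤ ht P := by rw [h]; exact le_self_add
  exact_mod_cast h2

theorem bc_Gd (P : Ideal (Polynomial R)) [hP : P.IsPrime] (hG : Gd (P.comap Polynomial.C)) : Gd P := by
  let q := P.comap (Polynomial.C : R →+* _)
  haveI hq : q.IsPrime := inferInstance
  let Q := q.map (Polynomial.C : R →+* _)
  haveI hQ : Q.IsPrime := Ideal.isPrime_map_C_of_isPrime
  have hQP : Q ≤ P := Ideal.map_comap_le
  have h1 : ∀ k, ht q < k → V P (Polynomial R ⧸ Q) k := by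
    intro k hk
    obtain ⟨k, rfl⟩ : ∃ k', k = k' + 1 := ⟨k - 1, by omega⟩
    have := bc_main q P le_rfl k (R ⧸ q) (hG _ hk)
    exact V_equiv P (Algebra.TensorProduct.quotIdealMapEquivTensorQuot (Polynomial R) q).toLinearEquiv this
  have hQq : Q.comap Polynomial.C = q := by
    apply le_antisymm (Ideal.comap_mono hQP) Ideal.le_comap_map
  rcases hQP.eq_or_lt with heq | hlt
  · have h3 := bc_ht P
    intro k hk
    have := h1 k (lt_of_le_of_lt h3 hk)
    rwa [heq] at this
  · have h3 : ht q < ht P := lt_of_le_of_lt (by have := bc_ht Q; rwa [hQq] at this) (ht_lt hlt)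
    -- minimal degree element
    classical
    have hex : ∃ n, ∃ f ∈ P, f ∉ Q ∧ f.natDegree = n := by
      obtain ⟨f, hf, hfQ⟩ := Set.exists_of_ssubset hlt
      exact ⟨_, f, hf, hfQ, rfl⟩
    obtain ⟨f, hfP, hfQ, hfn⟩ := Nat.find_spec hex
    have hmin : ∀ g ∈ P, g ∉ Q → f.natDegree ≤ g.natDegree := fun g hg hgQ => hfn ▸ Nat.find_min' hex ⟨g, hg, hgQ, rfl⟩
    have hmem : ∀ g, (∀ n, g.coeff n ∈ q) → g ∈ Q := fun g hg => Ideal.mem_map_C_iff.2 hg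
    let a := f.leadingCoeff
    have ha : a ∉ q := by
      intro ha
      have h5 : Polynomial.C a * Polynomial.X ^ f.natDegree ∈ Q := Ideal.mul_mem_right _ _ (Ideal.mem_map_of_mem _ ha)
      have h6 := Polynomial.eraseLead_add_C_mul_X_pow f
      have h7 : f.eraseLead ∈ P := by
        rw [← h6] at hfP
        exact (Ideal.add_mem_iff_left _ (hQP h5)).1 hfP
      have h8 : f.eraseLead ∉ Q := fun h => hfQ (by rw [← h6]; exact add_mem h h5)
      rcases Polynomial.eraseLead_natDegree_lt_or_eraseLead_eq_zero f with h | h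
      · exact absurd (hmin _ h7 h8) (by omega)
      · exact h8 (by rw [h]; exact zero_mem _)
    have haP : Polynomial.C a ∉ P := ha
    have hdiv : ∀ (N : ℕ) (g : Polynomial R), g ∈ P → (∀ m ≥ N, g.coeff m = 0) → ∃ m, Polynomial.C a ^ m * g ∈ Q ⊔ Ideal.span {f} := by
      intro N
      induction N with
      | zero =>
        intro g hg h0
        have : g = 0 := Polynomial.ext fun m => by simpa using h0 m (Nat.zero_le _)
        exact ⟨0, by rw [this, mul_zero]; exact zero_mem _⟩
      | succ N ih =>
        intro g hg h0
        by_cases hN : N < f.natDegree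
        · refine ⟨0, Ideal.mem_sup_left ?_⟩
          rw [pow_zero, one_mul]
          by_contra hgQ
          have h5 := hmin g hg hgQ
          have h6 : g.natDegree ≤ N := Polynomial.natDegree_le_iff_coeff_eq_zero.2 fun m hm => h0 m hm
          omega
        · push Not at hN
          obtain ⟨m, hm⟩ := ih (Polynomial.C a * g - Polynomial.C (g.coeff N) * f * Polynomial.X ^ (N - f.natDegree))
            (sub_mem (Ideal.mul_mem_left _ _ hg) (Ideal.mul_mem_right _ _ (Ideal.mul_mem_left _ _ hfP))) (fun m hm => by
              rw [Polynomial.coeff_sub, Polynomial.coeff_C_mul, Polynomial.coeff_mul_X_pow', if_pos (by omega), Polynomial.coeff_C_mul]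
              rcases hm.eq_or_lt with rfl | hm
              · rw [Nat.sub_sub_self hN]
                show f.leadingCoeff * _ - _ * f.leadingCoeff = 0
                ring
              · rw [h0 m hm, Polynomial.coeff_eq_zero_of_natDegree_lt (p := f) (by omega)]; ring)
          refine ⟨m + 1, ?_⟩
          have : Polynomial.C a ^ (m + 1) * g = Polynomial.C a ^ m * (Polynomial.C a * g - Polynomial.C (g.coeff N) * f * Polynomial.X ^ (N - f.natDegree))
            + (Polynomial.C a ^ m * Polynomial.C (g.coeff N) * Polynomial.X ^ (N - f.natDegree)) * f := by ring
          rw [this]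
          exact add_mem hm (Ideal.mul_mem_left _ _ (Ideal.mem_sup_right (Ideal.mem_span_singleton_self f)))
    let M := Polynomial R ⧸ Q
    have hreg : RingTheory.Sequence.IsWeaklyRegular M [f] := by
      rw [RingTheory.Sequence.isWeaklyRegular_singleton_iff]
      intro y z hyz
      obtain ⟨y, rfl⟩ := Ideal.Quotient.mk_surjective y
      obtain ⟨z, rfl⟩ := Ideal.Quotient.mk_surjective z
      have h5 : f * y - f * z ∈ Q := Ideal.Quotient.eq.1 hyz
      rw [← mul_sub] at h5
      exact Ideal.Quotient.eq.2 ((hQ.mem_or_mem h5).resolve_left hfQ)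
    have h5 := V_quot_reg P [f] M (ht q) h1 hreg
    let W : Submodule (Polynomial R) M := Ideal.ofList [f] • ⊤
    let π0 : M →ₗ[Polynomial R] (Polynomial R ⧸ P) := Submodule.mapQ Q P LinearMap.id hQP
    let π : (M ⧸ W) →ₗ[Polynomial R] (Polynomial R ⧸ P) := W.liftQ π0 (by
      show Ideal.ofList [f] • ⊤ ≤ _
      rw [Ideal.ofList_singleton, Submodule.ideal_span_singleton_smul]
      rintro _ ⟨y, -, rfl⟩
      obtain ⟨y, rfl⟩ := Ideal.Quotient.mk_surjective y
      show Ideal.Quotient.mk P (f * y) = 0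
      exact Ideal.Quotient.eq_zero_iff_mem.2 (Ideal.mul_mem_right _ _ hfP))
    have hπ : Function.Surjective π := by
      intro y
      obtain ⟨y, rfl⟩ := Ideal.Quotient.mk_surjective y
      exact ⟨W.mkQ (Ideal.Quotient.mk Q y), rfl⟩
    have hker : ∀ y : LinearMap.ker π, ∃ s ∉ P, s • y = 0 := by
      rintro ⟨y, hy⟩
      obtain ⟨y, rfl⟩ := W.mkQ_surjective y
      obtain ⟨y, rfl⟩ := Ideal.Quotient.mk_surjective y
      have hyP : y ∈ P := Ideal.Quotient.eq_zero_iff_mem.1 (show Ideal.Quotient.mk P y = 0 from hy)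
      obtain ⟨m, hm⟩ := hdiv (y.natDegree + 1) y hyP (fun m hm => Polynomial.coeff_eq_zero_of_natDegree_lt (by omega))
      refine ⟨Polynomial.C a ^ m, fun h => haP (hP.mem_of_pow_mem _ h), Subtype.ext ?_⟩
      obtain ⟨u, hu, v, hv, huv⟩ := Submodule.mem_sup.1 hm
      obtain ⟨c, rfl⟩ := Ideal.mem_span_singleton'.1 hv
      show W.mkQ (Ideal.Quotient.mk Q (Polynomial.C a ^ m * y)) = 0
      rw [← huv, map_add, Ideal.Quotient.eq_zero_iff_mem.2 hu, zero_add, ← LinearMap.mem_ker, Submodule.ker_mkQ]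
      show _ ∈ Ideal.ofList [f] • (⊤ : Submodule (Polynomial R) M)
      rw [Ideal.ofList_singleton, mul_comm]
      exact Submodule.smul_mem_smul (Ideal.mem_span_singleton_self f) (n := Ideal.Quotient.mk Q c) trivial
    have hfin : ∃ s ∉ P, ∀ y : LinearMap.ker π, s • y = 0 := by
      obtain ⟨s, hs, h⟩ := uniform_kill P (⊤ : Submodule (Polynomial R) (LinearMap.ker π)) (Module.Finite.fg_top) (fun y _ => hker y)
      exact ⟨s, hs, fun y => h y trivial⟩
    obtain ⟨s, hs, hs'⟩ := hfin
    intro k hk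
    obtain ⟨k, rfl⟩ : ∃ k', k = k' + 1 := ⟨k - 1, by omega⟩
    exact V_right P (LinearMap.ker π).subtype π (Submodule.injective_subtype _) (LinearMap.exact_subtype_ker_map π) hπ
      (V_kill P s hs hs' k) (h5 _ (by simp; omega))
end BC
end S9

namespace S9
open CategoryTheory

section Exch

theorem ex_local {B N : Type u} [CommRing B] [IsLocalRing B] [AddCommGroup N] [Module B N] [Module.Finite B N] {ι : Type} {v : ι → N} {l : Finset ι}
    (hl : Submodule.span B (v '' l) = ⊤) {r : ℕ} {w : Fin r → N} (hw : Submodule.span B (Set.range w) = ⊤) :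
    ∃ l0 ⊆ l, l0.card ≤ r ∧ Submodule.span B (v '' l0) = ⊤ := by
  classical
  let k := IsLocalRing.ResidueField B
  let g : N →ₗ[B] k ⊗[B] N := TensorProduct.mk B k N 1
  have key : ∀ s : Set N, Submodule.span B s = ⊤ ↔ Submodule.span k (g '' s) = ⊤ := by
    intro s
    rw [← IsLocalRing.map_tensorProduct_mk_eq_top, Submodule.map_span]
    have hs : (Submodule.span k (g '' s)).restrictScalars B = Submodule.span B (g '' s) := 
      Submodule.restrictScalars_span B k IsLocalRing.residue_surjective _
    rw [← Submodule.restrictScalars_eq_top_iff B k, hs]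
  obtain ⟨κ, a, ha, hsp, hli⟩ := exists_linearIndependent' k (fun j : ↥l => g (v j))
  haveI : Finite κ := Finite.of_injective a ha
  haveI := Fintype.ofFinite κ
  refine ⟨Finset.univ.image fun i : κ => (a i).1, ?_, ?_, ?_⟩
  · intro j hj
    obtain ⟨i, -, rfl⟩ := Finset.mem_image.1 hj
    exact (a i).2
  · refine Finset.card_image_le.trans ?_
    have h1 := hli.fintype_card_le_finrank
    have h2 : Module.finrank k (k ⊗[B] N) ≤ r := by
      have h3 := (key _).1 hw
      rw [← Set.range_comp] at h3
      have h4 := finrank_range_le_card (R := k) (g ∘ w)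
      rw [Set.finrank, h3, finrank_top, Fintype.card_fin] at h4
      exact h4
    exact h1.trans h2
  · rw [key]
    rw [key] at hl
    rw [eq_top_iff, ← hl]
    have e1 : g '' (v '' l) = Set.range (fun j : ↥l => g (v j)) := by
      ext y; simp
    rw [e1, ← hsp]
    apply Submodule.span_mono
    rintro _ ⟨i, rfl⟩
    exact ⟨v (a i), ⟨a i, by simp, rfl⟩, rfl⟩

theorem span_loc {A M : Type u} [CommRing A] [AddCommGroup M] [Module A M] (p : Ideal A) [hp : p.IsPrime] (s : Set M) :
    Submodule.span (Localization p.primeCompl) (LocalizedModule.mkLinearMap p.primeCompl M '' s) = ⊤ ↔ 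
    ∀ m : M, ∃ t ∉ p, t • m ∈ Submodule.span A s := by
  rw [← Submodule.localized'_span (Localization p.primeCompl) p.primeCompl (LocalizedModule.mkLinearMap p.primeCompl M)]
  constructor
  · intro h m
    have hm : LocalizedModule.mkLinearMap p.primeCompl M m ∈ (⊤ : Submodule (Localization p.primeCompl) (LocalizedModule p.primeCompl M)) := trivial
    rw [← h, Submodule.mem_localized'] at hm
    obtain ⟨m', hm', t, ht⟩ := hm
    rw [IsLocalizedModule.mk'_eq_iff, Submonoid.smul_def, ← map_smul] at ht
    obtain ⟨c, hc⟩ := IsLocalizedModule.exists_of_eq (S := p.primeCompl) ht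
    refine ⟨c * t, (c * t).2, ?_⟩
    rw [mul_smul, ← Submonoid.smul_def c, ← hc]
    exact Submodule.smul_mem _ _ hm'
  · intro h
    rw [eq_top_iff]
    rintro z -
    obtain ⟨⟨m, t⟩, rfl⟩ := IsLocalizedModule.mk'_surjective p.primeCompl (LocalizedModule.mkLinearMap p.primeCompl M) z
    obtain ⟨c, hc, hm⟩ := h m
    rw [Submodule.mem_localized']
    refine ⟨c • m, hm, ⟨c, hc⟩ * t, ?_⟩
    exact IsLocalizedModule.mk'_cancel_left _ _ (⟨c, hc⟩ : p.primeCompl) t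

theorem exch {A M : Type u} [CommRing A] [AddCommGroup M] [Module A M] [Module.Finite A M] (p : Ideal A) [hp : p.IsPrime] {ι : Type} {v : ι → M} {l : Finset ι}
    (hl : ∀ m : M, ∃ t ∉ p, t • m ∈ Submodule.span A (v '' l)) {r : ℕ} {w : Fin r → LocalizedModule p.primeCompl M}
    (hw : Submodule.span (Localization p.primeCompl) (Set.range w) = ⊤) :
    ∃ l0 ⊆ l, l0.card ≤ r ∧ ∀ m : M, ∃ t ∉ p, t • m ∈ Submodule.span A (v '' l0) := by
  haveI : IsLocalRing (Localization p.primeCompl) := inferInstanceAs (IsLocalRing (Localization.AtPrime p))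
  haveI : Module.Finite (Localization p.primeCompl) (LocalizedModule p.primeCompl M) := inferInstance
  obtain ⟨l0, h1, h2, h3⟩ := ex_local (v := fun j => LocalizedModule.mkLinearMap p.primeCompl M (v j)) (l := l) (by
    have := (span_loc p _).2 hl
    rwa [Set.image_image] at this) hw
  refine ⟨l0, h1, h2, (span_loc p _).1 ?_⟩
  rwa [Set.image_image]

theorem PG_iff {A : Type u} [CommRing A] (p : Ideal A) [hp : p.IsPrime] {ι : Type} [LinearOrder ι] [Fintype ι] (x : ι → A) (l : Finset ι) :
    PG p x l ↔ ∀ b, ∃ s ∉ p, s * x b ∈ Ideal.span (x '' l) := by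
  classical
  constructor
  · intro h b
    obtain ⟨s, hs, c, hc, h⟩ := h b
    refine ⟨s, hs, ?_⟩
    rw [h]
    refine Ideal.sum_mem _ fun j _ => ?_
    by_cases hj : j ∈ l
    · exact Ideal.mul_mem_right _ _ (Ideal.subset_span ⟨j, hj, rfl⟩)
    · rw [hc j hj, mul_zero]; exact zero_mem _
  · intro h
    choose s hs h using h
    refine PG_of_mem p (s := ∏ b, s b) (fun h => ?_) fun j => ?_
    · obtain ⟨j, -, hj⟩ := (hp.prod_mem_iff).1 h
      exact hs j hj
    · rw [← Finset.prod_erase_mul _ _ (Finset.mem_univ j), mul_assoc]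
      exact Ideal.mul_mem_left _ _ (h j)

/-- generators of the ideal locally as a module statement -/
theorem PG_iff' {A : Type u} [CommRing A] (p : Ideal A) [hp : p.IsPrime] {ι : Type} [LinearOrder ι] [Fintype ι] {I : Ideal A} (x : ι → ↥I)
    (hx : Ideal.span (Set.range fun j => (x j).1) = I) (l : Finset ι) :
    PG p (fun j => (x j).1) l ↔ ∀ m : ↥I, ∃ t ∉ p, t • m ∈ Submodule.span A (x '' l) := by
  rw [PG_iff]
  have h1 : ∀ m : ↥I, m ∈ Submodule.span A (x '' l) ↔ m.1 ∈ Ideal.span ((fun j => (x j).1) '' l) := by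
    intro m
    have : Ideal.span ((fun j => (x j).1) '' l) = (Submodule.span A (x '' l)).map I.subtype := by
      rw [Submodule.map_span, Set.image_image]; rfl
    rw [this, Submodule.mem_map]
    constructor
    · intro h; exact ⟨m, h, rfl⟩
    · rintro ⟨y, hy, h⟩
      rwa [← Subtype.ext h]
  constructor
  · intro h
    have : ∀ m ∈ Submodule.span A (Set.range x), ∃ t ∉ p, t • m ∈ Submodule.span A (x '' l) := by
      intro m hm
      induction hm using Submodule.span_induction with
      | mem m hm =>
        obtain ⟨j, rfl⟩ := hm
        obtain ⟨s, hs, h⟩ := h j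
        exact ⟨s, hs, (h1 _).2 h⟩
      | zero => exact ⟨1, hp.one_notMem, by simp⟩
      | add a b _ _ ha hb =>
        obtain ⟨s, hs, ha⟩ := ha
        obtain ⟨t, ht, hb⟩ := hb
        refine ⟨s * t, mul_nmem p hs ht, ?_⟩
        rw [smul_add]
        refine add_mem ?_ ?_
        · rw [mul_comm, mul_smul]; exact Submodule.smul_mem _ _ ha
        · rw [mul_smul]; exact Submodule.smul_mem _ _ hb
      | smul c a _ ha =>
        obtain ⟨s, hs, ha⟩ := ha
        exact ⟨s, hs, by rw [smul_comm]; exact Submodule.smul_mem _ _ ha⟩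
    intro m
    exact this m (by rw [span_sub hx]; trivial)
  · intro h b
    obtain ⟨s, hs, h⟩ := h (x b)
    exact ⟨s, hs, (h1 _).1 h⟩

theorem PG_exch {A : Type u} [CommRing A] [IsNoetherianRing A] (p : Ideal A) [hp : p.IsPrime] {ι : Type} [LinearOrder ι] [Fintype ι] {x : ι → A} {l l' : Finset ι}
    (hl : PG p x l) (hl' : PG p x l') : ∃ l0 ⊆ l, PG p x l0 ∧ l0.card ≤ l'.card := by
  let I := Ideal.span (Set.range x)
  let x' : ι → ↥I := fun j => ⟨x j, Ideal.subset_span ⟨j, rfl⟩⟩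
  have h1 := (PG_iff' p x' rfl l).1 hl
  have h2 := (span_loc p _).2 ((PG_iff' p x' rfl l').1 hl')
  let e := l'.equivFin
  have h3 : Submodule.span (Localization p.primeCompl) (Set.range fun i : Fin l'.card => LocalizedModule.mkLinearMap p.primeCompl I (x' (e.symm i))) = ⊤ := by
    rw [eq_top_iff, ← h2]
    apply Submodule.span_mono
    rintro _ ⟨_, ⟨j, hj, rfl⟩, rfl⟩
    exact ⟨e ⟨j, hj⟩, by simp⟩
  obtain ⟨l0, h4, h5, h6⟩ := exch p h1 h3
  exact ⟨l0, h4, (PG_iff' p x' rfl l0).2 h6, h5⟩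

theorem loc_dim {A : Type u} [CommRing A] [IsNoetherianRing A] (p : Ideal A) (hp : p.IsPrime) : localDimAt A p hp = (ht p : WithBot ℕ∞) := by
  have : localDimAt A p hp = p.height := IsLocalization.AtPrime.ringKrullDim_eq_height p (Localization.AtPrime p)
  rw [this, ← coe_ht p]; rfl

theorem minGens_spec {B N : Type u} [CommRing B] [AddCommGroup N] [Module B N] [Module.Finite B N] : 
    ∃ w : Fin (minGens B N) → N, Submodule.span B (Set.range w) = ⊤ := by
  have : (minGens B N) ∈ {n | ∃ f : Fin n → N, Submodule.span B (Set.range f) = ⊤} := Nat.sInf_mem (Module.Finite.exists_fin)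
  exact this

theorem Gcond_PG {A : Type u} [CommRing A] [IsNoetherianRing A] {ι : Type} [LinearOrder ι] [Fintype ι] {I : Ideal A} {x : ι → ↥I}
    (hx : Ideal.span (Set.range fun j => (x j).1) = I) {ℓ : ℕ} (hG : GcondIdeal A I (ℓ + 1)) (p : Ideal A) [hp : p.IsPrime] (hIp : I ≤ p) (hh : ht p ≤ ℓ) :
    ∃ l, PG p (fun j => (x j).1) l ∧ l.card ≤ ht p := by
  have h1 := hG p hp hIp (by rw [loc_dim]; exact_mod_cast Nat.succ_le_succ hh)
  rw [loc_dim] at h1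
  have h2 : minGens (Localization p.primeCompl) (LocalizedModule p.primeCompl ↥I) ≤ ht p := by exact_mod_cast h1
  obtain ⟨w, hw⟩ := minGens_spec (B := Localization p.primeCompl) (N := LocalizedModule p.primeCompl ↥I)
  obtain ⟨l0, -, h4, h5⟩ := exch p (v := x) (l := Finset.univ) (fun m => ⟨1, hp.one_notMem, by
    rw [Finset.coe_univ, Set.image_univ, span_sub hx]; trivial⟩) hw
  exact ⟨l0, (PG_iff' p x hx l0).2 h5, h4.trans h2⟩
end Exch
end S9

namespace S9
open CategoryTheory
section RedF
open MvPolynomial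

variable {A : Type u} [CommRing A] {ι : Type} [LinearOrder ι] [Fintype ι]

theorem lin_form {Y : MvPolynomial ι A} (hY : Y.IsHomogeneous 1) : ∃ c : ι → A, Y = ∑ k, C (c k) * X k := by
  have : Y ∈ homogeneousSubmodule ι A 1 := hY
  rw [homogeneousSubmodule_one_eq_span_X, Submodule.mem_span_range_iff_exists_fun] at this
  obtain ⟨c, hc⟩ := this
  exact ⟨c, by rw [← hc]; simp [MvPolynomial.smul_eq_C_mul]⟩

theorem mem_span_mul {r : ℕ} (y : Fin r → A) (K : Ideal A) (z : A) (h : z ∈ Ideal.span (Set.range y) * K) :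
    ∃ g : Fin r → A, (∀ i, g i ∈ K) ∧ z = ∑ i, y i * g i := by
  have h' : z ∈ K • Submodule.span A (Set.range y) := by rw [smul_eq_mul, mul_comm]; exact h
  rw [Submodule.mem_ideal_smul_span_iff_exists_sum] at h'
  obtain ⟨g, hg, rfl⟩ := h'
  refine ⟨g, hg, ?_⟩
  rw [Finsupp.sum_fintype _ _ (by simp)]
  exact Finset.sum_congr rfl fun i _ => by rw [smul_eq_mul, mul_comm]

theorem red_QZ (P : Ideal A) [hP : P.IsPrime] {x : ι → A} (h : QZ P x Finset.univ) {r : ℕ} {Y : Fin r → MvPolynomial ι A}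
    (hY : ∀ i, (Y i).IsHomogeneous 1) {s : A} (hs : s ∉ P) {N : ℕ}
    (hN : ∀ u ∈ Ideal.span (Set.range x) ^ (N + 1), s * u ∈ Ideal.span (Set.range fun i => eval x (Y i)) * Ideal.span (Set.range x) ^ N) :
    ∃ s ∉ P, ∀ j, s * x j ∈ Ideal.span (Set.range fun i => eval x (Y i)) := by
  refine red_loc P x _ fun j => ?_
  obtain ⟨g, hg, hsum⟩ := mem_span_mul _ _ _ (hN (x j ^ (N+1)) (Ideal.pow_mem_pow (Ideal.subset_span (Set.mem_range_self j)) _))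
  choose H hH hHg using fun i => (Ideal.mem_span_pow_iff_exists_isHomogeneous _ _).1 (hg i)
  choose c hc using fun i => lin_form (hY i)
  have hf : (C s * X j ^ (N+1) - ∑ i, Y i * H i : MvPolynomial ι A).IsHomogeneous (N + 1) := by
    refine IsHomogeneous.sub ?_ (IsHomogeneous.sum _ _ _ fun i _ => ?_)
    · have := (isHomogeneous_C ι s).mul ((isHomogeneous_X A j).pow (N+1))
      simpa using this
    · rw [add_comm]; exact (hY i).mul (hH i)
  have hev := ev_hom x hf
  have h0 : eval x (C s * X j ^ (N+1) - ∑ i, Y i * H i : MvPolynomial ι A) = 0 := by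
    simp only [map_sub, map_mul, map_pow, eval_C, eval_X, map_sum, hHg, hsum, sub_self]
  rw [h0, map_zero, zero_mul] at hev
  obtain ⟨t, ht, w, -, h2, h3⟩ := h _ hev
  have e3 := congrFun h3 ∅
  have e2 := congrFun h2 ∅
  rw [D_empty, Pi.smul_apply, vc_empty, smul_eq_mul] at e3
  rw [D_empty, Pi.zero_apply] at e2
  refine ⟨t * s, mul_nmem P ht hs, N + 1, fun k => w {k} + C t * ∑ i, C (c i k) * H i, ?_, fun α => ?_⟩
  · have e4 : (C t * (C s * X j ^ (N+1)) : MvPolynomial ι A) = C t * (C s * X j ^ (N+1) - ∑ i, Y i * H i) + C t * ∑ i, Y i * H i := by ring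
    rw [map_mul, mul_assoc, e4, ← e3]
    simp only [add_mul, Finset.sum_add_distrib]
    congr 1
    · exact Finset.sum_congr rfl fun k _ => by simp [vX]; ring
    · simp only [mul_assoc, ← Finset.mul_sum, Finset.sum_mul]
      rw [Finset.sum_comm]
      congr 1
      refine Finset.sum_congr rfl fun i _ => ?_
      rw [hc i, Finset.sum_mul]
      exact Finset.sum_congr rfl fun k _ => by ring
  · have e5 : ∑ k, coeff α (w {k} + C t * ∑ i, C (c i k) * H i) * x k = 
        coeff α (∑ k, C (x k) * w {k}) + ∑ i, eval x (Y i) * (t * coeff α (H i)) := by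
      simp only [coeff_add, add_mul, Finset.sum_add_distrib, coeff_sum, coeff_C_mul]
      congr 1
      · exact Finset.sum_congr rfl fun k _ => by ring
      · simp only [Finset.mul_sum, Finset.sum_mul]
        rw [Finset.sum_comm]
        refine Finset.sum_congr rfl fun i _ => ?_
        conv_rhs => rw [hc i]
        simp only [map_sum, map_mul, eval_C, eval_X, Finset.sum_mul]
        exact Finset.sum_congr rfl fun k _ => by ring
    have e6 : ∑ k, C (x k) * w {k} = 0 := e2
    rw [e5, e6, coeff_zero, zero_add]
    exact Ideal.sum_mem _ fun i _ => Ideal.mul_mem_right _ _ (Ideal.subset_span ⟨i, rfl⟩)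

theorem Z_ext (P : Ideal A) [hP : P.IsPrime] {κ : Type} [LinearOrder κ] [Fintype κ] (φ : ι ↪o κ) (u : κ → A)
    (hu : ∀ b, u b ∈ Ideal.span (Set.range (u ∘ φ))) (k : ℕ) (h : ∀ i, V P (Zm (u ∘ φ) Finset.univ i) k) (i : ℕ) :
    V P (Zm u Finset.univ i) k := by
  classical
  have key : ∀ T : Finset κ, ∀ i, V P (Zm u (Finset.univ.map φ.toEmbedding ∪ T) i) k := by
    intro T
    induction T using Finset.induction_on with
    | empty => intro i; rw [Finset.union_empty]; exact V_Z_emb P φ u k i (h i)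
    | insert b T hb ih =>
      by_cases hb' : b ∈ Finset.univ.map φ.toEmbedding ∪ T
      · rw [Finset.union_insert, Finset.insert_eq_of_mem hb']; exact ih
      · rw [Finset.union_insert]
        obtain ⟨c, hc⟩ := (Submodule.mem_span_range_iff_exists_fun A).1 (hu b)
        refine V_Z_up P u hb' (Function.extend φ c 0) (fun j hj => ?_) ?_ k ih
        · rw [Function.extend_apply']; rfl
          rintro ⟨a, rfl⟩
          exact hj (Finset.mem_union_left _ (Finset.mem_map.2 ⟨a, Finset.mem_univ _, rfl⟩))
        · rw [← hc]
          rw [← Finset.sum_subset (Finset.subset_univ (Finset.univ.map φ.toEmbedding))]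
          · rw [Finset.sum_map]
            refine Finset.sum_congr rfl fun a _ => ?_
            have : Function.extend φ c 0 (φ.toEmbedding a) = c a := φ.injective.extend_apply c 0 a
            rw [this, smul_eq_mul, mul_comm]; rfl
          · intro j _ hj
            rw [Function.extend_apply', Pi.zero_apply, mul_zero]
            rintro ⟨a, rfl⟩
            exact hj (Finset.mem_map.2 ⟨a, Finset.mem_univ _, rfl⟩)
  have := key Finset.univ i
  rwa [Finset.union_eq_right.2 (Finset.subset_univ _)] at this
end RedF
end S9

namespace S9
open CategoryTheory
section RedG
open MvPolynomial

variable {R : Type u} [CommRing R] [IsLocalRing R] [IsNoetherianRing R] {ι : Type} [LinearOrder ι] [Fintype ι]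

theorem ell_ge {I : Ideal R} {ℓ : ℕ} (hl : analyticSpread R ↥I = (ℓ : WithBot ℕ∞)) {x : ι → ↥I}
    (hx : Ideal.span (Set.range fun j => (x j).1) = I) (hIm : I ≤ IsLocalRing.maximalIdeal R) {h : ℕ}
    (hh : ∀ p : Ideal R, p.IsPrime → I ≤ p → h ≤ ht p) : h ≤ ℓ := by
  obtain ⟨r, hr, Y, hY, s, hs, N, hN⟩ := red_main hl hx
  set J := Ideal.span (Set.range fun i => eval (fun j => Polynomial.C (x j).1) (Y i)) with hJ
  have hJI : J ≤ I.map Polynomial.C := by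
    rw [hJ, Ideal.span_le]
    rintro _ ⟨i, rfl⟩
    obtain ⟨c, hc⟩ := lin_form (hY i)
    simp only [hc, map_sum, map_mul, eval_C, eval_X]
    exact Ideal.sum_mem _ fun k _ => Ideal.mul_mem_left _ _ (Ideal.mem_map_of_mem _ (x k).2)
  have hJM : J ≤ M0 R := hJI.trans (Ideal.map_mono hIm)
  obtain ⟨P, hP, hPM⟩ := Ideal.exists_minimalPrimes_le hJM
  haveI := hP.1.1
  have h1 : P.height ≤ r := by
    have := Ideal.height_le_card_of_mem_minimalPrimes_span (Set.finite_range _) hP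
    refine this.trans ?_
    rw [← Set.image_univ]
    refine Nat.cast_le.2 ((Set.ncard_image_le Set.finite_univ).trans ?_)
    rw [Set.ncard_univ, Nat.card_eq_fintype_card, Fintype.card_fin]
  rw [← coe_ht] at h1
  have h1' : ht P ≤ r := by exact_mod_cast h1
  have h2 : I ≤ P.comap Polynomial.C := by
    intro a ha
    have h3 := hN (Polynomial.C a ^ (N+1)) (Ideal.pow_mem_pow (Ideal.mem_map_of_mem _ ha) _)
    have hJP : J ≤ P := hP.1.2
    have hJ2 : J * I.map Polynomial.C ^ N ≤ J := Ideal.mul_le_left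
    have h4 : s * Polynomial.C a ^ (N+1) ∈ P := hJP (hJ2 h3)
    rcases hP.1.1.mem_or_mem h4 with h5 | h5
    · exact absurd (hPM h5) hs
    · exact hP.1.1.mem_of_pow_mem _ h5
  have := hh (P.comap Polynomial.C) inferInstance h2
  have := bc_ht P
  omega

theorem PG_C {x : ι → R} {l : Finset ι} (P : Ideal (Polynomial R)) [hP : P.IsPrime] (h : PG (P.comap Polynomial.C) x l) :
    PG P (fun j => Polynomial.C (x j)) l := by
  intro b
  obtain ⟨s, hs, c, hc, h⟩ := h b
  refine ⟨Polynomial.C s, fun h => hs h, fun j => Polynomial.C (c j), fun j hj => by simp [hc j hj], ?_⟩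
  rw [← map_mul, h, map_sum]
  simp

theorem C_nzd {a : R} (ha : a ∈ nonZeroDivisors R) : Polynomial.C a ∈ nonZeroDivisors (Polynomial R) := by
  rw [mem_nonZeroDivisors_iff_right]
  intro f hf
  ext n
  have := congrArg (fun g => Polynomial.coeff g n) hf
  simp only [Polynomial.coeff_mul_C, Polynomial.coeff_zero] at this
  exact (mem_nonZeroDivisors_iff_right.1 ha) _ this

theorem mu_le {I : Ideal R} {d ℓ : ℕ} (hR : GorL R d) (hl : analyticSpread R ↥I = (ℓ : WithBot ℕ∞)) {x : ι → ↥I}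
    (hx : Ideal.span (Set.range fun j => (x j).1) = I) (hG : GcondIdeal R I (ℓ + 1)) {a : R} (haI : a ∈ I) (ha : a ∈ nonZeroDivisors R)
    (hZ : ∀ i k, 0 < k → V (IsLocalRing.maximalIdeal R) (Zm (fun j => (x j).1) Finset.univ i) k) :
    ∃ l, PG (IsLocalRing.maximalIdeal R) (fun j => (x j).1) l ∧ l.card ≤ ℓ := by
  classical
  obtain ⟨r, hr, Y, hY, s, hs, N, hN⟩ := red_main hl hx
  set X' : ι → Polynomial R := fun j => Polynomial.C (x j).1 with hX'
  have hsp : Ideal.span (Set.range X') = I.map Polynomial.C := by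
    have := span_C (fun j => (x j).1)
    rw [hx] at this; exact this
  let κ := ι ⊕ₗ Fin r
  let φ : ι ↪o κ := OrderEmbedding.ofMapLEIff (fun j => Sum.inlₗ j) (fun a b => Sum.Lex.inl_le_inl_iff)
  let ρ : Fin r ↪ κ := ⟨fun j => Sum.inrₗ j, fun a b h => by simpa using h⟩
  let y : Fin r → Polynomial R := fun i => eval X' (Y i)
  let u : κ → Polynomial R := fun b => Sum.elim X' y (ofLex b)
  have huφ : u ∘ φ = X' := rfl
  have huρ : ∀ i, u (ρ i) = y i := fun i => rfl
  have hcase : ∀ b : κ, (∃ j, b = φ j) ∨ ∃ i, b = ρ i := by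
    intro b
    rcases h : ofLex b with j | i
    · exact Or.inl ⟨j, h⟩
    · exact Or.inr ⟨i, h⟩
  have hy : ∀ i, y i ∈ Ideal.span (Set.range X') := by
    intro i
    obtain ⟨c, hc⟩ := lin_form (hY i)
    simp only [y, hc, map_sum, map_mul, eval_C, eval_X]
    exact Ideal.sum_mem _ fun k _ => Ideal.mul_mem_left _ _ (Ideal.subset_span ⟨k, rfl⟩)
  have hu : ∀ b, u b ∈ Ideal.span (Set.range (u ∘ φ)) := by
    intro b
    rw [huφ]
    rcases hcase b with ⟨j, rfl⟩ | ⟨i, rfl⟩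
    · exact Ideal.subset_span ⟨j, rfl⟩
    · exact hy i
  have hGd : ∀ P : Ideal (Polynomial R), P.IsPrime → Gd P := fun P hP => bc_Gd P (gor_Gd hR _)
  have hZ' : ∀ P : Ideal (Polynomial R), P.IsPrime → ∀ i k, 0 < k → V P (Zm X' Finset.univ i) k := by
    intro P hP i k hk
    obtain ⟨k, rfl⟩ := Nat.exists_eq_succ_of_ne_zero hk.ne'
    exact bc_Z (fun j => (x j).1) (IsLocalRing.maximalIdeal R) P (IsLocalRing.le_maximalIdeal (hP.comap _).ne_top) i k (hZ i _ hk)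
  have haX : Polynomial.C a ∈ Ideal.span (Set.range X') := by rw [hsp]; exact Ideal.mem_map_of_mem _ haI
  have haX' : Polynomial.C a ∈ Ideal.span (Set.range u) := by
    refine Ideal.span_mono ?_ haX
    rintro _ ⟨j, rfl⟩
    exact ⟨φ j, rfl⟩
  let Af : Finset κ := Finset.univ.map ρ
  have hAc : Af.card = r := by simp [Af]
  have hJA : Ideal.span (Set.range y) ≤ Ideal.span (u '' Af) := by
    refine Ideal.span_mono ?_
    rintro _ ⟨i, rfl⟩
    exact ⟨ρ i, by simp [Af], rfl⟩
  have hM : PG (M0 R) u Af := by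
    refine E_lemma (M0 R) haX' (C_nzd ha) (fun q hq _ => hGd q hq) (fun i k hk => Z_ext _ φ u hu k (fun i => hZ' _ inferInstance i k hk) i) ?_
    intro P hP hPM hhP
    rw [hAc] at hhP
    have hQ := (LT_main P haX (C_nzd ha) (fun q hq _ => hGd q hq) (hZ' P hP) ?_ Finset.univ ?_).2
    · obtain ⟨t, ht, h⟩ := red_QZ P hQ hY (fun h => hs (hPM h)) (N := N) (by rw [hsp]; exact hN)
      refine PG_of_mem P ht fun b => ?_
      rcases hcase b with ⟨j, rfl⟩ | ⟨i, rfl⟩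
      · exact hJA (h j)
      · exact Ideal.mul_mem_left _ _ (Ideal.subset_span ⟨ρ i, by simp [Af], rfl⟩)
    · intro q hq hqP hxq l hl
      have h1 := bc_ht q
      have h2 := ht_le hqP
      obtain ⟨l', h3, h4⟩ := Gcond_PG hx hG (q.comap Polynomial.C) (by
        rw [← Ideal.map_le_iff_le_comap, ← hsp, Ideal.span_le]
        rintro _ ⟨j, rfl⟩
        exact hxq j) (by omega)
      obtain ⟨l0, h5, h6, h7⟩ := PG_exch q hl (PG_C q h3)
      exact ⟨l0, h5, h6, by omega⟩
    · rw [PG_iff]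
      exact fun b => ⟨1, hP.one_notMem, by rw [one_mul]; exact Ideal.subset_span ⟨b, by simp, rfl⟩⟩
  have hM' : PG (M0 R) u (Finset.univ.map φ.toEmbedding) := by
    rw [PG_iff]
    refine fun b => ⟨1, (inferInstance : (M0 R).IsPrime).one_notMem, ?_⟩
    rw [one_mul]
    refine Ideal.span_mono ?_ (hu b)
    rintro _ ⟨j, rfl⟩
    exact ⟨φ j, by simp, rfl⟩
  obtain ⟨l0, h1, h2, h3⟩ := PG_exch (M0 R) hM' hM
  rw [hAc] at h3
  refine ⟨Finset.univ.filter fun j => φ j ∈ l0, ?_, ?_⟩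
  · intro b
    obtain ⟨t, ht, c, hc, h⟩ := h2 (φ b)
    have : ∃ n, t.coeff n ∉ IsLocalRing.maximalIdeal R := by
      by_contra hcon
      push Not at hcon
      exact ht (Ideal.mem_map_C_iff.2 hcon)
    obtain ⟨n, hn⟩ := this
    refine ⟨t.coeff n, hn, fun j => (c (φ j)).coeff n, fun j hj => ?_, ?_⟩
    · show (c (φ j)).coeff n = 0
      rw [hc (φ j) (fun h => hj (by simpa using h)), Polynomial.coeff_zero]
    · have h4 : ∑ j, u j * c j = ∑ j, X' j * c (φ j) := by
        rw [← Finset.sum_subset (Finset.subset_univ (Finset.univ.map φ.toEmbedding))]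
        · rw [Finset.sum_map]; rfl
        · intro j _ hj
          rw [hc j (fun h => hj (h1 h)), mul_zero]
      rw [h4] at h
      have h5 := congrArg (fun g => Polynomial.coeff g n) h
      have h6 : u (φ b) = Polynomial.C (x b).1 := rfl
      simp only [h6, Polynomial.coeff_mul_C, Polynomial.finsetSum_coeff, hX', Polynomial.coeff_C_mul] at h5
      exact h5
  · refine le_trans ?_ (h3.trans hr)
    exact Finset.card_le_card_of_injOn φ (fun j hj => by simpa using hj) φ.injective.injOn

theorem LT_top {I : Ideal R} {d ℓ : ℕ} (hR : GorL R d) (hl : analyticSpread R ↥I = (ℓ : WithBot ℕ∞)) {x : ι → ↥I}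
    (hx : Ideal.span (Set.range fun j => (x j).1) = I) (hG : GcondIdeal R I (ℓ + 1)) {a : R} (haI : a ∈ I) (ha : a ∈ nonZeroDivisors R)
    (hZ : ∀ i k, 0 < k → V (IsLocalRing.maximalIdeal R) (Zm (fun j => (x j).1) Finset.univ i) k) :
    EX (IsLocalRing.maximalIdeal R) (fun j => (x j).1) Finset.univ ∧ QZ (IsLocalRing.maximalIdeal R) (fun j => (x j).1) Finset.univ := by
  obtain ⟨l, h1, h2⟩ := mu_le hR hl hx hG haI ha hZ
  refine LT_main _ (a := a) (by rwa [hx]) ha (fun q hq _ => gor_Gd hR q) hZ ?_ _ (PG_mono _ (Finset.subset_univ _) h1)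
  intro q hq hqm hxq l' hl'
  by_cases hh : ht q ≤ ℓ
  · obtain ⟨l1, h3, h4⟩ := Gcond_PG hx hG q (by
      rw [← hx, Ideal.span_le]
      rintro _ ⟨j, rfl⟩
      exact hxq j) hh
    obtain ⟨l0, h5, h6, h7⟩ := PG_exch q hl' h3
    exact ⟨l0, h5, h6, by omega⟩
  · obtain ⟨l0, h5, h6, h7⟩ := PG_exch q hl' (PG_le _ hqm h1)
    exact ⟨l0, h5, h6, by omega⟩
end RedG
end S9

namespace S9
open CategoryTheory
section P4a
variable {R : Type u} [CommRing R] [IsNoetherianRing R]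

theorem exists_reg {M : Type u} [AddCommGroup M] [Module R M] [Module.Finite R M] {I : Ideal R} {t : ℕ}
    (hGd : ∀ q : Ideal R, q.IsPrime → Gd q)
    (hI : ∀ q : Ideal R, q.IsPrime → I ≤ q → t < ht q) (hM : ∀ q : Ideal R, q.IsPrime → ∀ k, t < k → V q M k) :
    ∃ a ∈ I, IsSMulRegular M a := by
  by_contra hcon
  push Not at hcon
  have h1 : (I : Set R) ⊆ ⋃ p ∈ associatedPrimes R M, (id p : Ideal R) := by
    simp only [id]
    rw [biUnion_associatedPrimes_eq_zero_divisors]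
    intro a ha
    have := hcon a ha
    rw [isSMulRegular_iff_right_eq_zero_of_smul] at this
    push Not at this
    obtain ⟨m, h1, h2⟩ := this
    exact ⟨m, h2, h1⟩
  obtain ⟨q, hq, hIq⟩ := (Ideal.subset_union_prime_finite (associatedPrimes.finite R M) (f := id) 0 0 fun _ h _ _ => h.1).1 h1
  haveI hqp : q.IsPrime := hq.1
  obtain ⟨-, m, hm⟩ := isAssociatedPrime_iff.1 hq
  have hm' : ∀ s, s ∈ q ↔ s • m = 0 := by
    intro s; rw [hm]; simp
  obtain ⟨s, hs, h⟩ := ass_lemma q (hGd q hqp) (hI q hqp hIq) (hM q hqp) (Submodule.span R {m}) (fun q' hq' hlt => by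
    obtain ⟨s, h1, h2⟩ := SetLike.exists_of_lt hlt
    refine ⟨s, h2, fun x hx => ?_⟩
    obtain ⟨c, rfl⟩ := Submodule.mem_span_singleton.1 hx
    rw [smul_comm, (hm' s).1 h1, smul_zero])
  exact hs ((hm' s).2 (h m (Submodule.mem_span_singleton_self m)))

theorem exists_uv {I : Ideal R} (hGd : ∀ q : Ideal R, q.IsPrime → Gd q)
    (hI : ∀ q : Ideal R, q.IsPrime → I ≤ q → 2 ≤ ht q) :
    ∃ u ∈ I, ∃ v ∈ I, u ∈ nonZeroDivisors R ∧ ∀ α β, v * α = u * β → ∃ γ, α = u * γ := by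
  obtain ⟨u, hu, hur⟩ := exists_reg (M := R) (t := 0) hGd (fun q hq h => by have := hI q hq h; omega) (fun q hq k hk => by
    obtain ⟨k, rfl⟩ := Nat.exists_eq_succ_of_ne_zero hk.ne'
    exact V_free q k)
  obtain ⟨v, hv, hvr⟩ := exists_reg (M := R ⧸ Ideal.span {u}) (t := 1) hGd (fun q hq h => by have := hI q hq h; omega) (fun q hq k hk => by
    obtain ⟨k, rfl⟩ := Nat.exists_eq_add_of_lt hk
    refine V_right q (k := 1 + k) (LinearMap.lsmul R R u) (Submodule.mkQ (Ideal.span {u})) hur ?_ (Submodule.mkQ_surjective _) (by rw [add_comm]; exact V_free q k) (V_free q _)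
    intro a
    simp only [Submodule.mkQ_apply, Submodule.Quotient.mk_eq_zero, Ideal.mem_span_singleton, Set.mem_range, LinearMap.lsmul_apply, smul_eq_mul, dvd_def]
    exact ⟨fun ⟨c, h⟩ => ⟨c, h.symm⟩, fun ⟨c, h⟩ => ⟨c, h.symm⟩⟩)
  refine ⟨u, hu, v, hv, ?_, fun α β h => ?_⟩
  · rw [mem_nonZeroDivisors_iff_right]
    intro z hz
    exact hur.right_eq_zero_of_smul (by rw [smul_eq_mul, mul_comm]; exact hz)
  · have : Submodule.Quotient.mk (p := Ideal.span {u}) α = 0 := by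
      refine hvr.right_eq_zero_of_smul ?_
      rw [← Submodule.Quotient.mk_smul, smul_eq_mul, h, Submodule.Quotient.mk_eq_zero]
      exact Ideal.mul_mem_right _ _ (Ideal.mem_span_singleton_self u)
    rw [Submodule.Quotient.mk_eq_zero, Ideal.mem_span_singleton] at this
    exact this

theorem V_depth (p : Ideal R) [hp : p.IsPrime] {d : ℕ} (hV : ∀ (N : Type u) [AddCommGroup N] [Module R N] [Module.Finite R N] (k : ℕ), d < k → V p N k) :
    ∀ (rs : List R) (M : Type u) [AddCommGroup M] [Module R M] [Module.Finite R M], (∀ r ∈ rs, r ∈ p) → 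
      RingTheory.Sequence.IsWeaklyRegular M rs → ∀ k, d < k + rs.length → V p M k
  | [], M, _, _, _, _, _, k, hk => hV M k (by simpa using hk)
  | r :: rs, M, _, _, _, h1, h2, k, hk => by
    rw [RingTheory.Sequence.isWeaklyRegular_cons_iff] at h2
    refine V_nak p r (h1 r (by simp)) h2.1 (V_depth p hV rs _ (fun r hr => h1 r (by simp [hr])) h2.2 (k+1) ?_)
    simp only [List.length_cons] at hk
    omega

theorem CM_V [IsLocalRing R] {d : ℕ} (hR : GorL R d) {M : Type u} [AddCommGroup M] [Module R M] [Module.Finite R M]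
    (hCM : IsCMModule R M) {h : ℕ} (hM : Nontrivial M → ∃ p : Ideal R, p.IsPrime ∧ ht p ≤ h ∧ Module.annihilator R M ≤ p) (k : ℕ) (hk : h < k) :
    V (IsLocalRing.maximalIdeal R) M k := by
  rcases hCM with hs | hCM
  · exact V_subsingleton _ _
  rcases subsingleton_or_nontrivial M with hs | hnt
  · exact V_subsingleton _ _
  obtain ⟨p, hp, hph, hann⟩ := hM hnt
  obtain ⟨⟨δ, h1, h2⟩, -⟩ := gor_main hR p
  have h3 : ((δ : ℕ∞) : WithBot ℕ∞) ≤ moduleDim R M := by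
    refine le_trans (WithBot.coe_le_coe.2 h2) ?_
    rw [moduleDim, ringKrullDim_quotient, Order.coheight_eq_krullDim_Ici]
    refine Order.krullDim_le_of_strictMono (fun q => ⟨q.1, fun a ha => q.2 (hann ha)⟩) ?_
    intro a b hab
    exact hab
  rw [← hCM, WithBot.coe_le_coe] at h3
  have h4 : ∃ rs : List R, δ ≤ rs.length ∧ (∀ r ∈ rs, r ∈ IsLocalRing.maximalIdeal R) ∧ RingTheory.Sequence.IsWeaklyRegular M rs := by
    rcases Nat.eq_zero_or_pos δ with h0 | h0
    · exact ⟨[], by simp [h0], by simp, RingTheory.Sequence.IsWeaklyRegular.nil R M⟩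
    · have h5 : ((δ - 1 : ℕ) : ℕ∞) < moduleDepth R M := lt_of_lt_of_le (by exact_mod_cast Nat.sub_lt h0 one_pos) h3
      rw [moduleDepth, sequenceGrade, lt_sSup_iff] at h5
      obtain ⟨n, ⟨rs, h6, h7, h8⟩, h9⟩ := h5
      refine ⟨rs, ?_, h7, h8.1⟩
      rw [← h6] at h9
      have : δ - 1 < rs.length := by exact_mod_cast h9
      omega
  obtain ⟨rs, h5, h6, h7⟩ := h4
  have hm : ht (IsLocalRing.maximalIdeal R) ≤ d := by
    obtain ⟨⟨δ', h1, -⟩, -⟩ := gor_main hR (IsLocalRing.maximalIdeal R)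
    omega
  exact V_depth _ (d := d) (fun N _ _ _ k hk => V_big hR _ N (by omega)) rs M h6 h7 k (by omega)
end P4a
end S9

namespace S9
open CategoryTheory
section P4b
variable {R : Type u} [CommRing R]

theorem D_mem {n : ℕ} {x : Fin n → R} {I : Ideal R} (hx : ∀ j, x j ∈ I) (η : Finset (Fin n) → R) (T : Finset (Fin n)) : D x η T ∈ I := by
  rw [D_apply, Finset.sum_apply]
  exact Ideal.sum_mem _ fun j _ => Ideal.mul_mem_right _ _ (hx j)

theorem exists_cyc {n : ℕ} {x : Fin n → R} (p : Ideal R) [hp : p.IsPrime] {l : Finset (Fin n)} (hl : PG p x l) (T : Finset (Fin n)) :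
    Disjoint T l → ∃ ω ∈ Dg R R T.card, D x ω = 0 ∧ ω T ∉ p := by
  induction T using Finset.induction_on with
  | empty =>
    intro _
    exact ⟨vac (Fin n) R, by simpa using vac_Dg, D_Dg0 _ vac_Dg, by simpa [vac] using hp.one_notMem⟩
  | insert b T hb ih =>
    intro hd
    rw [Finset.disjoint_insert_left] at hd
    obtain ⟨ω, h1, h2, h3⟩ := ih hd.2
    obtain ⟨t, ht, c, hc, htc⟩ := hl b
    refine ⟨W (Pi.single b t - c) ω, ?_, ?_, ?_⟩
    · rw [Finset.card_insert_of_notMem hb]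
      exact W_Dg _ h1
    · rw [D_W, h2, map_zero, sub_zero]
      have : ∑ j, x j * (Pi.single b t - c : Fin n → R) j = 0 := by
        simp only [Pi.sub_apply, mul_sub, Finset.sum_sub_distrib]
        rw [← htc, Finset.sum_eq_single b (fun j _ hj => by simp [hj]) (by simp)]
        simp [mul_comm]
      rw [this, zero_smul]
    · rw [W_apply, Finset.sum_apply, Finset.sum_eq_single b]
      · rw [Pi.smul_apply, we_apply, if_pos (Finset.mem_insert_self _ _), Finset.erase_insert hb]
        simp only [Pi.sub_apply, Pi.single_eq_same, hc b hd.1, sub_zero]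
        intro h
        have h5 : sg b (insert b T) • (t • (sg b (insert b T) • ω T)) ∈ p := by
          rw [zsmul_eq_mul]; exact p.mul_mem_left _ h
        rw [smul_comm t, ← mul_smul, sg_sq, one_smul] at h5
        exact (hp.mem_or_mem h5).elim ht h3
      · intro j _ hj
        rw [Pi.smul_apply, we_apply]
        by_cases hjl : j ∈ l
        · rw [if_neg, smul_zero]
          rw [Finset.mem_insert]
          rintro (h | h)
          · exact hj h
          · exact Finset.disjoint_left.1 hd.2 h hjl
        · simp [hj, hc j hjl]
      · simp

theorem ann_H {n : ℕ} {x : Fin n → R} (p : Ideal R) [hp : p.IsPrime] (hx : ∀ j, x j ∈ p) {l : Finset (Fin n)} (hl : PG p x l) {i : ℕ}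
    (hi : i + l.card ≤ n) : Module.annihilator R (Hm x i) ≤ p := by
  obtain ⟨T, hT, hTc⟩ := Finset.exists_subset_card_eq (s := lᶜ) (n := i) (by rw [Finset.card_compl, Fintype.card_fin]; omega)
  obtain ⟨ω, h1, h2, h3⟩ := exists_cyc p hl T (Finset.disjoint_left.2 fun a ha ha' => Finset.mem_compl.1 (hT ha) ha')
  rw [hTc] at h1
  intro s hs
  have h4 := Module.mem_annihilator.1 hs (Submodule.Quotient.mk ⟨ω, mem_Zm_univ.2 ⟨h1, h2⟩⟩)
  rw [← Submodule.Quotient.mk_smul, Submodule.Quotient.mk_eq_zero] at h4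
  obtain ⟨η, -, h5⟩ := h4
  have h6 := congrFun h5 T
  have h7 : s * ω T ∈ p := by
    have : s * ω T = D x η T := h6.symm
    rw [this]
    exact D_mem hx _ _
  exact (hp.mem_or_mem h7).resolve_right h3

theorem Dg_big {n : ℕ} {i : ℕ} (hi : n < i) {z : Finset (Fin n) → R} (hz : z ∈ Dg R R i) : z = 0 := by
  ext T
  refine hz T ?_
  have := T.card_le_univ
  simp at this
  omega

theorem nzd_smul {n : ℕ} {u : R} (hu : u ∈ nonZeroDivisors R) {z z' : Finset (Fin n) → R} (h : u • z = u • z') : z = z' := by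
  ext T
  have := congrFun h T
  simp only [Pi.smul_apply, smul_eq_mul] at this
  exact (mul_cancel_left_mem_nonZeroDivisors hu).1 this

theorem H_big {n : ℕ} {x : Fin n → R} {u v : R} (huI : u ∈ Ideal.span (Set.range x)) (hvI : v ∈ Ideal.span (Set.range x))
    (hu : u ∈ nonZeroDivisors R) (huv : ∀ α β, v * α = u * β → ∃ γ, α = u * γ) {i : ℕ} (hi : n ≤ i + 1) : Subsingleton (Hm x i) := by
  rw [Submodule.Quotient.subsingleton_iff, eq_top_iff]
  rintro ⟨z, hz⟩ -
  obtain ⟨hz1, hz2⟩ := mem_Zm_univ.1 hz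
  change z ∈ Bm x i
  obtain ⟨c, hc⟩ := Ideal.mem_span_range_iff_exists_fun.1 huI
  obtain ⟨c', hc'⟩ := Ideal.mem_span_range_iff_exists_fun.1 hvI
  have e1 : D x (W c z) = u • z := by
    rw [D_W, hz2, map_zero, sub_zero, ← hc]
    simp only [mul_comm]
  have e2 : D x (W c' z) = v • z := by
    rw [D_W, hz2, map_zero, sub_zero, ← hc']
    simp only [mul_comm]
  have key : v • W c z = u • W c' z := by
    rcases Nat.lt_or_ge n (i+1) with h | h
    · rw [Dg_big h (W_Dg c hz1), Dg_big h (W_Dg c' hz1), smul_zero, smul_zero]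
    · have hin : i + 1 = n := by omega
      have hw : v • W c z - u • W c' z ∈ Dg R R (i+1) := by
        exact Submodule.sub_mem _ (Submodule.smul_mem _ _ (W_Dg c hz1)) (Submodule.smul_mem _ _ (W_Dg c' hz1))
      have hD : D x (v • W c z - u • W c' z) = 0 := by
        rw [map_sub, map_smul, map_smul, e1, e2, smul_comm, sub_self]
      rw [← sub_eq_zero]
      refine nzd_smul hu ?_
      have h3 := D_W x c (v • W c z - u • W c' z)
      rw [hD, map_zero, sub_zero, Dg_big (i := i + 1 + 1) (by omega) (W_Dg c hw), map_zero] at h3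
      have : ∑ j, x j * c j = u := by rw [← hc]; simp only [mul_comm]
      rw [this] at h3
      rw [← h3, smul_zero]
  have h4 : ∀ T, ∃ γ, W c z T = u * γ := fun T => huv _ _ (by simpa using congrFun key T)
  choose g hg using h4
  have hg' : W c z = u • g := funext hg
  refine ⟨g, ?_, ?_⟩
  · intro T hT
    have := W_Dg c hz1 T hT
    rw [hg T] at this
    exact (mul_right_mem_nonZeroDivisors_eq_zero_iff hu).1 (by rw [mul_comm]; exact this)
  · refine nzd_smul hu ?_
    rw [← map_smul, ← hg', e1]

theorem V_koszul [IsNoetherianRing R] [IsLocalRing R] {d : ℕ} (hR : GorL R d) {n : ℕ} {x : Fin n → R} (hCM : ∀ i, IsCMModule R (koszulHomology R n x i))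
    (h2 : ∀ q : Ideal R, q.IsPrime → Ideal.span (Set.range x) ≤ q → 2 ≤ ht q) (p : Ideal R) [hp : p.IsPrime] (hxp : Ideal.span (Set.range x) ≤ p)
    (hhp : ht p ≤ 2) {l : Finset (Fin n)} (hl : PG p x l) (hlc : l.card ≤ 2) :
    ∀ i k, 0 < k → V (IsLocalRing.maximalIdeal R) (Zm x Finset.univ i) k := by
  obtain ⟨u, hu, v, hv, hun, huv⟩ := exists_uv (fun q hq => gor_Gd hR q) h2
  refine V_Z_of_H _ x fun i k hk => ?_
  have : Module.Finite R (koszulHomology R n x i) := Module.Finite.equiv (He x i).symm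
  refine V_equiv _ (He x i).symm (CM_V hR (hCM i) (h := 2) (fun hnt => ⟨p, hp, hhp, ?_⟩) k hk)
  rcases Nat.lt_or_ge (i+1) n with h | h
  · rw [(He x i).annihilator_eq]
    exact ann_H p (fun j => hxp (Ideal.subset_span ⟨j, rfl⟩)) hl (by omega)
  · have := H_big hu hv hun huv h
    exact absurd ((He x i).toEquiv.subsingleton) (not_subsingleton_iff_nontrivial.2 hnt)
end P4b
end S9

namespace S9
open CategoryTheory
section P10
variable {R : Type u} [CommRing R]

theorem minGens_le {B N : Type u} [CommRing B] [AddCommGroup N] [Module B N] (s : Finset N) (hs : Submodule.span B (s : Set N) = ⊤) :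
    minGens B N ≤ s.card := by
  refine Nat.sInf_le ⟨fun i => (s.equivFin.symm i).1, ?_⟩
  rw [← hs]
  congr 1
  ext y
  constructor
  · rintro ⟨i, rfl⟩
    exact (s.equivFin.symm i).2
  · intro hy
    exact ⟨s.equivFin ⟨y, hy⟩, by simp⟩

open Classical in
theorem minGens_E {I : Ideal R} (p : Ideal R) [hp : p.IsPrime] {E : Type u} [AddCommGroup E] [Module R E] {m : ℕ}
    (e : E ≃ₗ[R] (↥I × (Fin m → R))) (s : Finset ↥I) (hs : ∀ y : ↥I, ∃ t ∉ p, t • y ∈ Submodule.span R (s : Set ↥I)) :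
    minGens (Localization p.primeCompl) (LocalizedModule p.primeCompl E) ≤ s.card + m := by
  let A : Finset E := s.image fun y => e.symm (y, 0)
  let B : Finset E := Finset.univ.image fun i : Fin m => e.symm (0, Pi.single i 1)
  have hc : ((A ∪ B).image (LocalizedModule.mkLinearMap p.primeCompl E)).card ≤ s.card + m := by
    refine Finset.card_image_le.trans ((Finset.card_union_le _ _).trans (Nat.add_le_add Finset.card_image_le ?_))
    exact Finset.card_image_le.trans (by simp)
  refine le_trans (minGens_le _ ?_) hc
  rw [Finset.coe_image, span_loc]
  intro z
  obtain ⟨⟨y, c⟩, rfl⟩ := e.symm.surjective z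
  obtain ⟨t, ht, h⟩ := hs y
  refine ⟨t, ht, ?_⟩
  have h1 : e.symm (y, c) = (e.symm : (↥I × (Fin m → R)) →ₗ[R] E) (LinearMap.inl R _ _ y) + ∑ i, c i • e.symm (0, Pi.single i 1) := by
    simp only [← map_smul, ← map_sum]
    change _ = e.symm _ + _
    rw [← map_add]
    congr 1
    ext1
    · simp [Prod.fst_sum]
    · simp only [LinearMap.inl_apply, Prod.snd_add, Prod.snd_sum, Prod.smul_snd, zero_add]
      ext i
      simp [Finset.sum_apply, Pi.single_apply]
  rw [h1, smul_add]
  refine Submodule.add_mem _ ?_ (Submodule.smul_mem _ _ (Submodule.sum_mem _ fun i _ => Submodule.smul_mem _ _ (Submodule.subset_span ?_)))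
  · rw [← map_smul, ← map_smul]
    have h2 := Submodule.mem_map_of_mem (f := (e.symm : (↥I × (Fin m → R)) →ₗ[R] E) ∘ₗ LinearMap.inl R ↥I (Fin m → R)) h
    rw [Submodule.map_span] at h2
    refine Submodule.span_mono ?_ h2
    rintro _ ⟨w, hw, rfl⟩
    exact Finset.mem_coe.2 (Finset.mem_union_left _ (Finset.mem_image.2 ⟨w, hw, rfl⟩))
  · exact Finset.mem_coe.2 (Finset.mem_union_right _ (Finset.mem_image.2 ⟨i, Finset.mem_univ _, rfl⟩))

open Classical in
theorem Gcond_E [IsNoetherianRing R] {n : ℕ} {I : Ideal R} {x : Fin n → ↥I}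
    (hx : Ideal.span (Set.range fun j => (x j).1) = I) {ℓ : ℕ} (hG : GcondIdeal R I (ℓ + 1)) {E : Type u} [AddCommGroup E] [Module R E] {e : ℕ}
    (f : E ≃ₗ[R] (↥I × (Fin (e - 1) → R))) : Gcond R E e (ℓ + 1) := by
  intro p hp h1 h2
  rw [loc_dim] at h1 h2 ⊢
  have h1 : 1 ≤ ht p := by exact_mod_cast h1
  have h2 : ht p ≤ ℓ := by
    have : ht p + 1 ≤ ℓ + 1 := by exact_mod_cast h2
    omega
  have key : ∃ s : Finset ↥I, s.card ≤ ht p ∧ ∀ y : ↥I, ∃ t ∉ p, t • y ∈ Submodule.span R (s : Set ↥I) := by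
    by_cases hIp : I ≤ p
    · obtain ⟨l, h3, h4⟩ := Gcond_PG hx hG p hIp h2
      refine ⟨l.image x, Finset.card_image_le.trans h4, ?_⟩
      rw [Finset.coe_image]
      exact (PG_iff' p x hx l).1 h3
    · obtain ⟨a, ha, hap⟩ := SetLike.not_le_iff_exists.1 hIp
      refine ⟨{⟨a, ha⟩}, by simpa using h1, fun y => ⟨a, hap, ?_⟩⟩
      rw [Finset.coe_singleton, Submodule.mem_span_singleton]
      exact ⟨y.1, Subtype.ext (mul_comm _ _)⟩
  obtain ⟨s, h3, h4⟩ := key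
  have h5 := minGens_E p f s h4
  have h6 : minGens (Localization p.primeCompl) (LocalizedModule p.primeCompl E) ≤ ht p + (e - 1) := h5.trans (Nat.add_le_add_right h3 _)
  exact_mod_cast h6

theorem height_two [IsNoetherianRing R] {I : Ideal R} {h : ℕ} (hht : idealHeight R I = ((h : ℕ) : WithBot ℕ∞)) :
    (∀ q : Ideal R, q.IsPrime → I ≤ q → h ≤ ht q) ∧ ∃ p : Ideal R, p.IsPrime ∧ I ≤ p ∧ ht p = h := by
  unfold idealHeight at hht
  constructor
  · intro q hq hIq
    have : ((h : ℕ) : WithBot ℕ∞) ≤ localDimAt R q hq := by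
      rw [← hht]
      exact sInf_le ⟨q, hq, hIq, rfl⟩
    rw [loc_dim] at this
    exact_mod_cast this
  · by_contra hcon
    push Not at hcon
    have h1 : ((h + 1 : ℕ) : WithBot ℕ∞) ≤ ((h : ℕ) : WithBot ℕ∞) := by
      conv_rhs => rw [← hht]
      refine le_sInf ?_
      rintro _ ⟨p, hp, hIp, rfl⟩
      have h2 : ((h : ℕ) : WithBot ℕ∞) ≤ localDimAt R p hp := by
        rw [← hht]
        exact sInf_le ⟨p, hp, hIp, rfl⟩
      rw [loc_dim] at h2 ⊢
      have h3 : h ≤ ht p := by exact_mod_cast h2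
      have h4 := hcon p hp hIp
      have h5 : h + 1 ≤ ht p := by omega
      exact_mod_cast h5
    have h2 : h + 1 ≤ h := by exact_mod_cast h1
    omega
end P10

end S9

/-- For a strongly Cohen-Macaulay ideal `I` of height two with analytic
spread `ℓ` satisfying `G_{ℓ+1}` over a Gorenstein local ring, and `E = I ⊕ R^{e-1}`:
`ℓ(E) = ℓ + e - 1`, `E` satisfies `G_{ℓ(E)-e+2}`, `I` is of linear type,
`E^j ≅ ⊕_{0≤i≤j} I^i ⊗ F^{j-i}`, and `Ext^{j+1}(E^j, R) = 0` for `1 ≤ j ≤ ℓ(E)-e+1`. -/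
theorem statement_9 (R : Type u) [CommRing R] [IsLocalRing R] [IsNoetherianRing R]
    (hGor : IsGorensteinLocalRing R) (d : ℕ) (hd : ringKrullDim R = (d : WithBot ℕ∞))
    (I : Ideal R) (hscm : IsStronglyCM R I)
    (hht : idealHeight R I = ((2 : ℕ) : WithBot ℕ∞))
    (ℓ : ℕ) (hl : analyticSpread R ↥I = (ℓ : WithBot ℕ∞))
    (hG : GcondIdeal R I (ℓ + 1))
    (e : ℕ) (he : 0 < e - 1)
    (E : Type u) [AddCommGroup E] [Module R E] [Module.Finite R E]
    (hE : Nonempty (E ≃ₗ[R] (↥I × (Fin (e - 1) → R)))) :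
    analyticSpread R E = ((ℓ + e - 1 : ℕ) : WithBot ℕ∞) ∧
    Gcond R E e (ℓ + e - 1 - e + 2) ∧
    IsLinearType R ↥I ∧
    (∀ j : ℕ, Nonempty (↥(reesPower R E j) ≃ₗ[R]
      Π i : Fin (j + 1),
        (↥(I ^ (i : ℕ)) ⊗[R] ↥(reesPower R (Fin (e - 1) → R) (j - i))))) ∧
    (∀ j : ℕ, 1 ≤ j → j ≤ ℓ + e - 1 - e + 1 →
      extVanish R ↥(reesPower R E j) R (j + 1)) := by
  obtain ⟨f⟩ := hE
  obtain ⟨n, x0, hx0, hCM⟩ := hscm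
  have hR := S9.gor_of hGor hd
  obtain ⟨h2, p, hp, hIp, hhp⟩ := S9.height_two hht
  have hIm : I ≤ IsLocalRing.maximalIdeal R := hIp.trans (IsLocalRing.le_maximalIdeal hp.ne_top)
  let x : Fin n → ↥I := fun j => ⟨x0 j, hx0 ▸ Ideal.subset_span ⟨j, rfl⟩⟩
  have hx : Ideal.span (Set.range fun j => (x j).1) = I := hx0
  have hl2 : 2 ≤ ℓ := S9.ell_ge hl hx hIm h2
  obtain ⟨l, hl1, hlc⟩ := S9.Gcond_PG hx hG p hIp (by omega)
  have hZ := S9.V_koszul hR hCM (by rw [hx0]; exact h2) p (by rw [hx0]; exact hIp) hhp.le hl1 (by omega)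
  obtain ⟨a, haI, -, -, ha, -⟩ := S9.exists_uv (fun q hq => S9.gor_Gd hR q) h2
  obtain ⟨hEX, hQZ⟩ := S9.LT_top hR hl hx hG haI ha hZ
  have e1 : ℓ + e - 1 - e + 2 = ℓ + 1 := by omega
  refine ⟨?_, ?_, ?_, ?_, ?_⟩
  · rw [S9.spread_add f, hl]
    have : ℓ + e - 1 = ℓ + (e - 1) := by omega
    rw [this]
    norm_cast
  · rw [e1]
    exact S9.Gcond_E hx hG f
  · exact S9.linType_of hx fun g hg => S9.LT_lin hQZ g hg
  · exact fun j => S9.rees_iso f ha haI j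
  · intro j _ _
    rw [S9.extVanish_iff, ← S9.V_local]
    refine S9.rees_V _ f ha haI j (j+1) fun t ht => ?_
    have := S9.LT_pow hEX hQZ hZ t (j+1) (by omega)
    rwa [hx] at this
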